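/- Let κ = (κ₀,κ₁,κ₂,κ₃,κ₄) ∈ ℂ⁵ with 2κ₀+κ₁+κ₂+κ₃+κ₄ = 1 and let U = ℂ∖{0,1}. Suppose q, p : ℂ → ℂ are meromorphic at every point of U and solve P_VI(κ) at every point of U at which both are analytic. Then q is rational and p is rational: there exist polynomials A, B, C, D ∈ ℂ[X] with B ≠ 0 and D ≠ 0 such that q(z) = A(z)/B(z) and p(z) = C(z)/D(z) for all z ∈ U outside the (finite) zero sets of B and D and the poles of q and p. (Any single-valued global solution of Painlevé VI is a rational—in fact Riccati—solution.) -/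

import Mathlib

/-- The sixth Painlevé system `P_VI(κ)` holds for the pair `(q, p)` at the point `z`. -/
def SolvesPVIAt (κ₀ κ₁ κ₂ κ₃ κ₄ : ℂ) (q p : ℂ → ℂ) (z : ℂ) : Prop :=
  z * (z - 1) * deriv q z =
      2 * q z * (q z - 1) * (q z - z) * p z - κ₁ * (q z - 1) * (q z - z)
        - (κ₂ - 1) * q z * (q z - 1) - κ₃ * q z * (q z - z) ∧
  z * (z - 1) * deriv p z =
      -(3 * q z ^ 2 - 2 * (1 + z) * q z + z) * p z ^ 2
        + (κ₁ * (2 * q z - 1 - z) + (κ₂ - 1) * (2 * q z - 1) + κ₃ * (2 * q z - z)) * p z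
        - κ₀ * (κ₀ + κ₄)

namespace PainleveSix

/-- The `q`-component of the Hamiltonian vector field, multiplied by `z * (z - 1)`. -/
def fieldQ (a b d z q p : ℂ) : ℂ :=
  2 * q * (q - 1) * (q - z) * p - a * (q - 1) * (q - z) - (b - 1) * q * (q - 1) - d * q * (q - z)

/-- The `p`-component of the Hamiltonian vector field, multiplied by `z * (z - 1)`. -/
def fieldP (a b d e z q p : ℂ) : ℂ :=
  -(3 * q ^ 2 - 2 * (1 + z) * q + z) * p ^ 2
    + (a * (2 * q - 1 - z) + (b - 1) * (2 * q - 1) + d * (2 * q - z)) * p - e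

/-- `z * (z - 1)` times the Hamiltonian. -/
def energyA (a b d e z q p : ℂ) : ℂ :=
  q * (q - 1) * (q - z) * p ^ 2
    - (a * (q - 1) * (q - z) + (b - 1) * q * (q - 1) + d * q * (q - z)) * p + e * (q - z)

/-- The derivative of `energyA` along the flow. -/
def slopeA (a d e q p : ℂ) : ℂ :=
  -q * (q - 1) * p ^ 2 + (a * (q - 1) + d * q) * p - e

/-- The Hamiltonian in the variables `(q / z, z * p)`, multiplied by `z * (z - 1)`. -/
def energyB (a b d e z q p : ℂ) : ℂ :=
  energyA a b d e z q p + (1 - z) * (q * p)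

/-- The logarithmic derivative of `energyB` along the flow. -/
def slopeB (a b d e z q p : ℂ) : ℂ :=
  (q - z) * (q * p) ^ 2 - ((a + d - 1) * (q - z) + b * q) * (q * p) + e * (q - z)

/-- A solution of the sixth Painlevé system in the variable `t = log z`, on the left half-plane
outside a countable set. -/
structure IsFlow (a b d e : ℂ) (B : Set ℂ) (Q P : ℂ → ℂ) : Prop where
  countable : B.Countable
  hasDerivAt_fst : ∀ t : ℂ, t.re < 0 → t ∉ B →
    HasDerivAt Q (fieldQ a b d (Complex.exp t) (Q t) (P t) / (Complex.exp t - 1)) t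
  hasDerivAt_snd : ∀ t : ℂ, t.re < 0 → t ∉ B →
    HasDerivAt P (fieldP a b d e (Complex.exp t) (Q t) (P t) / (Complex.exp t - 1)) t
  periodic_fst : ∀ t : ℂ, Q (t + 2 * Real.pi * Complex.I) = Q t
  periodic_snd : ∀ t : ℂ, P (t + 2 * Real.pi * Complex.I) = P t
  periodic_set : ∀ t : ℂ, t + 2 * Real.pi * Complex.I ∈ B ↔ t ∈ B

theorem exp_sub_one_ne_zero {t : ℂ} (ht : t.re < 0) : Complex.exp t - 1 ≠ 0 := by
  intro h
  have h1 : ‖Complex.exp t‖ = 1 := by rw [sub_eq_zero.mp h]; simp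
  rw [Complex.norm_exp, Real.exp_eq_one_iff] at h1
  linarith

section Flow

variable {a b d e : ℂ} {B : Set ℂ} {Q P : ℂ → ℂ}

theorem IsFlow.hasDerivAt_energyA (h : IsFlow a b d e B Q P) {t : ℂ} (ht : t.re < 0)
    (hB : t ∉ B) :
    HasDerivAt (fun t => energyA a b d e (Complex.exp t) (Q t) (P t))
      (Complex.exp t * slopeA a d e (Q t) (P t)) t := by
  have hz := exp_sub_one_ne_zero ht
  have hq := h.hasDerivAt_fst t ht hB
  have hp := h.hasDerivAt_snd t ht hB
  have hE := Complex.hasDerivAt_exp t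
  have h1 := (((hq.mul (hq.sub_const 1)).mul (hq.sub hE)).mul (hp.pow 2)).sub
    ((((((hq.sub_const 1).const_mul a).mul (hq.sub hE)).add
      ((hq.const_mul (b - 1)).mul (hq.sub_const 1))).add
      ((hq.const_mul d).mul (hq.sub hE))).mul hp) |>.add ((hq.sub hE).const_mul e)
  refine h1.congr_deriv ?_
  simp only [fieldQ, fieldP, slopeA, Pi.mul_apply, Pi.sub_apply, Pi.add_apply, Pi.pow_apply]
  field_simp
  ring

theorem IsFlow.hasDerivAt_mul (h : IsFlow a b d e B Q P) {t : ℂ} (ht : t.re < 0)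
    (hB : t ∉ B) (hQ : Q t ≠ 0) :
    HasDerivAt (fun t => Q t * P t)
      (((Q t - Complex.exp t / Q t) * (Q t * P t) ^ 2
        - (a * (Q t - Complex.exp t / Q t) + (b - 1) * Q t + d * Q t) * (Q t * P t)
        + e * Q t) / (1 - Complex.exp t)) t := by
  have hz := exp_sub_one_ne_zero ht
  have hz' : 1 - Complex.exp t ≠ 0 := by
    intro h; apply hz; linear_combination -h
  have hq := h.hasDerivAt_fst t ht hB
  have hp := h.hasDerivAt_snd t ht hB
  refine (hq.mul hp).congr_deriv ?_
  rw [show 1 - Complex.exp t = -(Complex.exp t - 1) by ring]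
  simp only [fieldQ, fieldP]
  field_simp
  ring

theorem IsFlow.hasDerivAt_energyB (h : IsFlow a b d e B Q P) {t : ℂ} (ht : t.re < 0)
    (hB : t ∉ B) :
    HasDerivAt (fun t => energyB a b d e (Complex.exp t) (Q t) (P t))
      (slopeB a b d e (Complex.exp t) (Q t) (P t)) t := by
  have hz := exp_sub_one_ne_zero ht
  have hq := h.hasDerivAt_fst t ht hB
  have hp := h.hasDerivAt_snd t ht hB
  have hE := Complex.hasDerivAt_exp t
  have h1 := (h.hasDerivAt_energyA ht hB).add ((hE.const_sub 1).mul (hq.mul hp))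
  refine h1.congr_deriv ?_
  simp only [fieldQ, fieldP, slopeA, slopeB, Pi.mul_apply]
  field_simp
  ring

end Flow

theorem norm_slopeA_le (a b d e : ℂ) : ∃ C : ℝ, 0 < C ∧ ∀ z q p : ℂ, 2 * ‖z‖ ≤ ‖q‖ →
    ‖q‖ * ‖slopeA a d e q p‖ ≤ C * (1 + ‖q‖) * (1 + ‖energyA a b d e z q p‖) := by
  obtain ⟨k, hk⟩ : ∃ k, k = 1 + ‖a‖ + ‖b‖ + ‖d‖ + ‖e‖ := ⟨_, rfl⟩
  have ha := norm_nonneg a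
  have hb := norm_nonneg b
  have hd := norm_nonneg d
  have he := norm_nonneg e
  have hk1 : 1 ≤ k := by linarith
  refine ⟨10 * k ^ 2, by positivity, fun z q p hzq => ?_⟩
  set X := ‖slopeA a d e q p‖ with hX
  set m := ‖q‖ with hm
  set E := ‖energyA a b d e z q p‖ with hE
  set y := ‖(q - 1) * (q * p)‖ with hy
  have hm0 : 0 ≤ m := norm_nonneg _
  have hX0 : 0 ≤ X := norm_nonneg _
  have hE0 : 0 ≤ E := norm_nonneg _
  have hy0 : 0 ≤ y := norm_nonneg _
  have hq1 : ‖q - 1‖ ≤ 1 + m := by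
    calc ‖q - 1‖ ≤ ‖q‖ + ‖(1 : ℂ)‖ := norm_sub_le _ _
      _ = 1 + m := by simp [hm]; ring
  have e1 : (q - z) * slopeA a d e q p
      = -energyA a b d e z q p - (b - 1) * ((q - 1) * (q * p)) := by
    simp only [slopeA, energyA]; ring
  have e2 : ((q - 1) * (q * p)) ^ 2 = (a * (q - 1) + d * q) * ((q - 1) * (q * p))
      - q * (q - 1) * (slopeA a d e q p + e) := by
    simp only [slopeA]; ring
  have h1 : m * X ≤ 2 * E + 2 * (k * y) := by
    have l : m / 2 ≤ ‖q - z‖ := by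
      have := norm_sub_norm_le q z
      linarith
    have n := congrArg norm e1
    rw [norm_mul] at n
    have n2 : ‖-energyA a b d e z q p - (b - 1) * ((q - 1) * (q * p))‖ ≤ E + k * y := by
      refine (norm_sub_le _ _).trans ?_
      rw [norm_neg, norm_mul (b - 1)]
      have : ‖b - 1‖ ≤ k := (norm_sub_le _ _).trans (by rw [norm_one]; linarith)
      gcongr
    have : m / 2 * X ≤ ‖q - z‖ * X := by gcongr
    linarith
  have h2 : y ^ 2 ≤ k * (1 + m) * y + (1 + m) * (m * X) + k * (1 + m) ^ 2 := by
    have n := congrArg norm e2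
    rw [norm_pow] at n
    have n1 : ‖a * (q - 1) + d * q‖ ≤ k * (1 + m) := by
      refine (norm_add_le _ _).trans ?_
      rw [norm_mul, norm_mul]
      nlinarith [mul_le_mul_of_nonneg_left hq1 ha, mul_nonneg hb hm0, mul_nonneg he hm0]
    have n2 : ‖q * (q - 1) * (slopeA a d e q p + e)‖ ≤ m * (1 + m) * (X + k) := by
      rw [norm_mul, norm_mul]
      have : ‖slopeA a d e q p + e‖ ≤ X + k := (norm_add_le _ _).trans (by linarith)
      gcongr
    have n3 : y ^ 2 ≤ k * (1 + m) * y + m * (1 + m) * (X + k) := by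
      rw [n]
      refine (norm_sub_le _ _).trans ?_
      rw [norm_mul (a * (q - 1) + d * q)]
      gcongr
    nlinarith [mul_nonneg hm0 hm0, mul_nonneg (by linarith : 0 ≤ k) hm0]
  have h3 : 4 * (k * y) ≤ m * X + 10 * k ^ 2 * (1 + m) := by
    by_contra! hc
    have : (1 + m) * (m * X) ≤ (1 + m) * (4 * (k * y) - 10 * k ^ 2 * (1 + m)) := by
      gcongr; linarith
    have hkk : k * (1 + m) ^ 2 ≤ k ^ 2 * (1 + m) ^ 2 := by
      gcongr; nlinarith
    nlinarith [sq_nonneg (y - 5 / 2 * (k * (1 + m))), mul_pos (by linarith : 0 < k)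
      (by linarith : 0 < 1 + m), sq_pos_of_pos (mul_pos (by linarith : 0 < k)
      (by linarith : 0 < 1 + m))]
  have hkk : 1 ≤ k ^ 2 := by nlinarith
  nlinarith [mul_nonneg hm0 hE0, mul_nonneg (mul_nonneg hm0 hE0) (by linarith : 0 ≤ k ^ 2),
    mul_le_mul_of_nonneg_right hkk hE0]

theorem norm_slopeB_le (a b d e : ℂ) : ∃ C : ℝ, 0 < C ∧ ∀ z q p : ℂ, ‖q‖ ≤ 1 / 2 →
    ‖slopeB a b d e z q p‖ ≤ C * (‖q‖ + ‖z‖) * (1 + ‖energyB a b d e z q p‖) := by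
  obtain ⟨k, hk⟩ : ∃ k, k = 2 + ‖a‖ + ‖b‖ + ‖d‖ + ‖e‖ := ⟨_, rfl⟩
  have ha := norm_nonneg a
  have hb := norm_nonneg b
  have hd := norm_nonneg d
  have he := norm_nonneg e
  have hk1 : 1 ≤ k := by linarith
  refine ⟨14 * k ^ 2, by positivity, fun z q p hqh => ?_⟩
  set X := ‖slopeB a b d e z q p‖ with hX
  obtain ⟨m, hm⟩ : ∃ m, m = ‖q‖ + ‖z‖ := ⟨_, rfl⟩
  rw [← hm]
  set E := ‖energyB a b d e z q p‖ with hE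
  set y := ‖(q - z) * (q * p)‖ with hy
  have hm0 : 0 ≤ m := by rw [hm]; positivity
  have hqm : ‖q‖ ≤ m := by rw [hm]; linarith [norm_nonneg z]
  have hX0 : 0 ≤ X := norm_nonneg _
  have hE0 : 0 ≤ E := norm_nonneg _
  have hy0 : 0 ≤ y := norm_nonneg _
  have hqz : ‖q - z‖ ≤ m := by rw [hm]; exact norm_sub_le _ _
  have e1 : (q - 1) * slopeB a b d e z q p
      = q * energyB a b d e z q p - e * (q - z) + (d - 1) * ((q - z) * (q * p)) := by
    simp only [slopeB, energyA, energyB]; ring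
  have e2 : ((q - z) * (q * p)) ^ 2 = ((a + d - 1) * (q - z) + b * q) * ((q - z) * (q * p))
      + (q - z) * (slopeB a b d e z q p - e * (q - z)) := by
    simp only [slopeB]; ring
  have h1 : X ≤ 2 * (m * E) + 2 * (k * m) + 2 * (k * y) := by
    have l : 1 / 2 ≤ ‖q - 1‖ := by
      have := norm_sub_norm_le 1 q
      rw [norm_one, norm_sub_rev] at this
      linarith
    have n := congrArg norm e1
    rw [norm_mul] at n
    have n2 : ‖q * energyB a b d e z q p - e * (q - z) + (d - 1) * ((q - z) * (q * p))‖
        ≤ m * E + k * m + k * y := by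
      refine (norm_add_le _ _).trans (add_le_add ((norm_sub_le _ _).trans ?_) ?_)
      · rw [norm_mul, norm_mul]
        have : ‖e‖ ≤ k := by linarith
        gcongr
      · rw [norm_mul (d - 1)]
        have : ‖d - 1‖ ≤ k := (norm_sub_le _ _).trans (by rw [norm_one]; linarith)
        gcongr
    have : 1 / 2 * X ≤ ‖q - 1‖ * X := by gcongr
    linarith
  have h2 : y ^ 2 ≤ k * m * y + m * X + k * m ^ 2 := by
    have n := congrArg norm e2
    rw [norm_pow] at n
    have n1 : ‖(a + d - 1) * (q - z) + b * q‖ ≤ k * m := by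
      refine (norm_add_le _ _).trans ?_
      rw [norm_mul, norm_mul]
      have : ‖a + d - 1‖ ≤ ‖a‖ + ‖d‖ + 1 :=
        (norm_sub_le _ _).trans (by rw [norm_one]; linarith [norm_add_le a d])
      calc ‖a + d - 1‖ * ‖q - z‖ + ‖b‖ * ‖q‖ ≤ (‖a‖ + ‖d‖ + 1) * m + ‖b‖ * m := by gcongr
        _ ≤ k * m := by nlinarith
    have n2 : ‖(q - z) * (slopeB a b d e z q p - e * (q - z))‖ ≤ m * (X + k * m) := by
      rw [norm_mul]
      have : ‖slopeB a b d e z q p - e * (q - z)‖ ≤ X + k * m := by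
        refine (norm_sub_le _ _).trans ?_
        rw [norm_mul]
        have : ‖e‖ ≤ k := by linarith
        gcongr
      gcongr
    have n3 : y ^ 2 ≤ k * m * y + m * (X + k * m) := by
      rw [n]
      refine (norm_add_le _ _).trans ?_
      rw [norm_mul ((a + d - 1) * (q - z) + b * q)]
      gcongr
    nlinarith
  have h3 : 4 * (k * y) ≤ X + 10 * k ^ 2 * m := by
    by_contra! hc
    have : m * X ≤ m * (4 * (k * y) - 10 * k ^ 2 * m) := by
      gcongr; linarith
    have hkk : k * m ^ 2 ≤ k ^ 2 * m ^ 2 := by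
      gcongr; nlinarith
    have hmm : 0 ≤ (k * m) ^ 2 := by positivity
    have hy1 : (y - 5 / 2 * (k * m)) ^ 2 + 11 / 4 * (k * m) ^ 2 ≤ 0 := by
      linarith [h2]
    have hy2 : (k * m) ^ 2 = 0 := by linarith [sq_nonneg (y - 5 / 2 * (k * m))]
    have hy3 : k * m = 0 := by simpa using hy2
    have hm3 : m = 0 := by
      rcases mul_eq_zero.mp hy3 with h | h
      · linarith
      · exact h
    have hyy : y = 0 := by
      rw [hy3] at hy1
      have : y ^ 2 ≤ 0 := by linarith
      exact pow_eq_zero_iff (two_ne_zero) |>.mp (le_antisymm this (sq_nonneg y))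
    rw [hyy, hm3] at hc
    linarith
  have hkk : k ≤ k ^ 2 := by nlinarith
  have hkk1 : 1 ≤ k ^ 2 := by nlinarith
  have := mul_le_mul_of_nonneg_right hkk hm0
  have h5 : m * E ≤ k ^ 2 * (m * E) := by
    exact le_mul_of_one_le_left (mul_nonneg hm0 hE0) hkk1
  have h6 := mul_nonneg hm0 hE0
  have h7 : 0 ≤ k ^ 2 * m := by positivity
  have h8 : 14 * k ^ 2 * m * (1 + E) = 14 * (k ^ 2 * m) + 14 * (k ^ 2 * (m * E)) := by ring
  rw [h8]
  linarith

/-- In the intermediate zone `|z| ≪ |q| ≪ 1` the product `q * p` is controlled by `energyA`. -/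
theorem norm_mul_sq_le (a b d e : ℂ) : ∃ C : ℝ, 0 < C ∧ ∀ z q p : ℂ, ‖q‖ ≤ 1 / 10 →
    10 * ‖z‖ ≤ ‖q‖ → q ≠ 0 →
    ‖q * p‖ ^ 2 ≤ C * (1 + ‖energyA a b d e z q p‖) := by
  obtain ⟨k, hk⟩ : ∃ k, k = 2 + ‖a‖ + ‖b‖ + ‖d‖ + ‖e‖ := ⟨_, rfl⟩
  have ha := norm_nonneg a
  have hb := norm_nonneg b
  have hd := norm_nonneg d
  have he := norm_nonneg e
  have hk0 : 0 < k := by linarith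
  refine ⟨24 * k ^ 2, by positivity, fun z q p hq hz hq0 => ?_⟩
  set E := ‖energyA a b d e z q p‖ with hE
  set y := ‖q * p‖ with hy
  have hqp : 0 < ‖q‖ := norm_pos_iff.mpr hq0
  have hE0 : 0 ≤ E := norm_nonneg _
  have hy0 : 0 ≤ y := norm_nonneg _
  have hz0 := norm_nonneg z
  have e1 : (q - 1) * (1 - z / q) * (q * p) ^ 2 = energyA a b d e z q p
      + (a * ((q - 1) * (1 - z / q)) + (b - 1) * (q - 1) + d * (q - z)) * (q * p)
      - e * (q - z) := by
    simp only [energyA]; field_simp; ring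
  have u1 : ‖z / q‖ ≤ 1 / 10 := by rw [norm_div, div_le_iff₀ hqp]; linarith
  have l1 : 9 / 10 ≤ ‖q - 1‖ := by
    have := norm_sub_norm_le 1 q
    rw [norm_one, norm_sub_rev] at this
    linarith
  have l2 : 9 / 10 ≤ ‖1 - z / q‖ := by
    have := norm_sub_norm_le 1 (z / q)
    rw [norm_one] at this
    linarith
  have l3 : ‖q - 1‖ ≤ 11 / 10 := (norm_sub_le _ _).trans (by rw [norm_one]; linarith)
  have l4 : ‖1 - z / q‖ ≤ 11 / 10 := (norm_sub_le _ _).trans (by rw [norm_one]; linarith)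
  have l5 : ‖q - z‖ ≤ 1 := (norm_sub_le _ _).trans (by linarith)
  have n := congrArg norm e1
  rw [norm_mul, norm_mul, norm_pow] at n
  have low : 1 / 2 * y ^ 2 ≤ ‖q - 1‖ * ‖1 - z / q‖ * ‖q * p‖ ^ 2 := by
    have : 1 / 2 ≤ ‖q - 1‖ * ‖1 - z / q‖ := by nlinarith
    gcongr
  have up : ‖energyA a b d e z q p
      + (a * ((q - 1) * (1 - z / q)) + (b - 1) * (q - 1) + d * (q - z)) * (q * p)
      - e * (q - z)‖ ≤ E + (2 * k) * y + k := by
    refine (norm_sub_le _ _).trans (add_le_add ((norm_add_le _ _).trans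
      (add_le_add le_rfl ?_)) ?_)
    · rw [norm_mul]
      have : ‖a * ((q - 1) * (1 - z / q)) + (b - 1) * (q - 1) + d * (q - z)‖ ≤ 2 * k := by
        refine (norm_add₃_le).trans ?_
        rw [norm_mul, norm_mul, norm_mul, norm_mul]
        have hb1 : ‖b - 1‖ ≤ ‖b‖ + 1 := (norm_sub_le _ _).trans (by rw [norm_one])
        calc ‖a‖ * (‖q - 1‖ * ‖1 - z / q‖) + ‖b - 1‖ * ‖q - 1‖ + ‖d‖ * ‖q - z‖
            ≤ ‖a‖ * (11 / 10 * (11 / 10)) + (‖b‖ + 1) * (11 / 10) + ‖d‖ * 1 := by gcongr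
          _ ≤ 2 * k := by linarith
      gcongr
    · rw [norm_mul]
      have := mul_le_mul_of_nonneg_left l5 he
      linarith
  have hk2 : 2 ≤ k := by linarith
  have hkk : 4 ≤ k ^ 2 := by nlinarith
  nlinarith [sq_nonneg (y - 4 * k), mul_nonneg hE0 (by linarith : 0 ≤ k ^ 2 - 4)]

/-- A smooth cutoff, equal to `1` for moderate and to `0` for large arguments, varying slowly on the
logarithmic scale as `η → 0`. -/
noncomputable def cutoff (η x : ℝ) : ℝ := 1 - Real.smoothTransition (η * Real.log (1 + x) - 1)

theorem cutoff_nonneg (η x : ℝ) : 0 ≤ cutoff η x :=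
  sub_nonneg.mpr (Real.smoothTransition.le_one _)

theorem cutoff_le_one (η x : ℝ) : cutoff η x ≤ 1 :=
  sub_le_self _ (Real.smoothTransition.nonneg _)

theorem exp_inv_le_of_cutoff_ne_one {η x : ℝ} (hη : 0 < η) (hx : 0 ≤ x) (h : cutoff η x ≠ 1) :
    Real.exp η⁻¹ ≤ 1 + x := by
  rw [← Real.le_log_iff_exp_le (by linarith), inv_le_iff_one_le_mul₀' hη]
  by_contra! hc
  apply h
  rw [cutoff, Real.smoothTransition.zero_of_nonpos (by linarith), sub_zero]

theorem le_exp_of_cutoff_ne_zero {η x : ℝ} (hη : 0 < η) (hx : 0 ≤ x) (h : cutoff η x ≠ 0) :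
    1 + x ≤ Real.exp η⁻¹ ^ 2 := by
  rw [← Real.exp_nat_mul, ← Real.log_le_iff_le_exp (by linarith)]
  by_contra! hc
  apply h
  rw [cutoff, Real.smoothTransition.one_of_one_le, sub_self]
  push_cast at hc
  have : η * (2 * η⁻¹) ≤ η * Real.log (1 + x) := by gcongr
  have h2 : η * (2 * η⁻¹) = 2 := by field_simp
  linarith

theorem deriv_smoothTransition_eq_zero {x : ℝ} (hx : x ∉ Set.Icc (0 : ℝ) 1) :
    deriv Real.smoothTransition x = 0 := by
  rcases lt_or_ge x 0 with h | h
  · have : Real.smoothTransition =ᶠ[nhds x] fun _ => 0 := by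
      filter_upwards [Iio_mem_nhds h] with y hy
      exact Real.smoothTransition.zero_of_nonpos (le_of_lt hy)
    rw [this.deriv_eq]; simp
  · have h1 : 1 < x := by
      by_contra! hc
      exact hx ⟨h, hc⟩
    have : Real.smoothTransition =ᶠ[nhds x] fun _ => 1 := by
      filter_upwards [Ioi_mem_nhds h1] with y hy
      exact Real.smoothTransition.one_of_one_le (le_of_lt hy)
    rw [this.deriv_eq]; simp

theorem exists_abs_deriv_smoothTransition_le :
    ∃ M : ℝ, 0 < M ∧ ∀ x, |deriv Real.smoothTransition x| ≤ M := by
  have hc : Continuous (deriv Real.smoothTransition) :=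
    (Real.smoothTransition.contDiff (n := 1)).continuous_deriv le_rfl
  obtain ⟨M, hM⟩ := (isCompact_Icc (a := (0 : ℝ)) (b := 1)).exists_bound_of_continuousOn
    hc.continuousOn
  refine ⟨|M| + 1, by positivity, fun x => ?_⟩
  by_cases hx : x ∈ Set.Icc (0 : ℝ) 1
  · exact (hM x hx).trans ((le_abs_self M).trans (by linarith))
  · rw [deriv_smoothTransition_eq_zero hx, abs_zero]
    positivity

theorem exists_hasDerivAt_cutoff : ∃ M : ℝ, 0 < M ∧ ∀ η x : ℝ, 0 < η → 0 ≤ x →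
    ∃ D, HasDerivAt (cutoff η) D x ∧ |D| * (1 + x) ≤ M * η ∧
      (D ≠ 0 → Real.exp η⁻¹ ≤ 1 + x ∧ 1 + x ≤ Real.exp η⁻¹ ^ 2) := by
  obtain ⟨M, hM, hb⟩ := exists_abs_deriv_smoothTransition_le
  refine ⟨M, hM, fun η x hη hx => ?_⟩
  have hx1 : 1 + x ≠ 0 := by linarith
  have hd : DifferentiableAt ℝ Real.smoothTransition (η * Real.log (1 + x) - 1) :=
    (Real.smoothTransition.contDiff (n := 1)).differentiable one_ne_zero _
  have hl : HasDerivAt (fun x => η * Real.log (1 + x) - 1) (η * (1 / (1 + x))) x :=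
    ((((hasDerivAt_id x).const_add 1).log hx1).const_mul η).sub_const 1
  have hD := (hd.hasDerivAt.comp x hl).const_sub 1
  refine ⟨_, hD, ?_, fun h0 => ?_⟩
  · rw [abs_neg, abs_mul, abs_mul, abs_of_pos hη, abs_of_pos (by positivity : 0 < 1 / (1 + x))]
    have := hb (η * Real.log (1 + x) - 1)
    calc _ = |deriv Real.smoothTransition (η * Real.log (1 + x) - 1)| * η := by field_simp
      _ ≤ M * η := by gcongr
  · have hu : η * Real.log (1 + x) - 1 ∈ Set.Icc (0 : ℝ) 1 := by
      by_contra hc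
      rw [deriv_smoothTransition_eq_zero hc] at h0
      simp at h0
    constructor
    · rw [← Real.le_log_iff_exp_le (by linarith), inv_le_iff_one_le_mul₀' hη]
      linarith [hu.1]
    · rw [← Real.exp_nat_mul, ← Real.log_le_iff_le_exp (by linarith)]
      by_contra! hc
      push_cast at hc
      have : η * (2 * η⁻¹) < η * Real.log (1 + x) := by gcongr
      have h2 : η * (2 * η⁻¹) = 2 := by field_simp
      linarith [hu.2]

/-- The interpolation between the two energies with weight `c`. -/
def energyMix (a b d e c z q p : ℂ) : ℂ :=
  energyA a b d e z q p + c * ((1 - z) * (q * p))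

theorem norm_mul_sq_le_energyMix (a b d e : ℂ) : ∃ C : ℝ, 0 < C ∧ ∀ c z q p : ℂ, ‖c‖ ≤ 1 →
    ‖q‖ ≤ 1 / 10 → 10 * ‖z‖ ≤ ‖q‖ → q ≠ 0 →
    ‖q * p‖ ^ 2 ≤ C * (1 + ‖energyMix a b d e c z q p‖) := by
  obtain ⟨C, hC, h⟩ := norm_mul_sq_le a b d e
  refine ⟨2 * C + 4 * C ^ 2, by positivity, fun c z q p hc hq hz hq0 => ?_⟩
  have h1 := h z q p hq hz hq0
  have hz1 : ‖1 - z‖ ≤ 2 := (norm_sub_le _ _).trans (by rw [norm_one]; linarith [norm_nonneg z])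
  have h2 : ‖energyA a b d e z q p‖ ≤ ‖energyMix a b d e c z q p‖ + 2 * ‖q * p‖ := by
    have : energyA a b d e z q p = energyMix a b d e c z q p - c * ((1 - z) * (q * p)) := by
      simp only [energyMix]; ring
    rw [this]
    refine (norm_sub_le _ _).trans ?_
    gcongr
    rw [norm_mul, norm_mul (1 - z)]
    calc ‖c‖ * (‖1 - z‖ * ‖q * p‖) ≤ 1 * (2 * ‖q * p‖) := by gcongr
      _ = _ := by ring
  have h3 := mul_le_mul_of_nonneg_left h2 hC.le
  have hG := norm_nonneg (energyMix a b d e c z q p)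
  have h4 : 0 ≤ C ^ 2 * ‖energyMix a b d e c z q p‖ := by positivity
  have h5 : 2 * (C * (2 * ‖q * p‖)) ≤ 4 * C ^ 2 + ‖q * p‖ ^ 2 := by
    linarith [sq_nonneg (2 * C - ‖q * p‖)]
  linarith

/-- The drift of `energyMix` away from the transition zone of the weight. -/
theorem norm_drift_le (a b d e : ℂ) : ∃ C : ℝ, 0 < C ∧ ∀ (c : ℝ) (z q p : ℂ) (r R : ℝ),
    0 ≤ c → c ≤ 1 → 0 < r → 1 ≤ R → r * R ≤ 1 / 10 → ‖z‖ = r ^ 2 →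
    (c ≠ 1 → r ≤ ‖q‖) → (c ≠ 0 → ‖q‖ ≤ r * R) →
    ‖(1 - (c : ℂ)) * (z * slopeA a d e q p) + c * slopeB a b d e z q p‖
      ≤ C * (r * R) * (1 + ‖energyMix a b d e c z q p‖) := by
  obtain ⟨CA, hCA, hA⟩ := norm_slopeA_le a b d e
  obtain ⟨CB, hCB, hB⟩ := norm_slopeB_le a b d e
  obtain ⟨CW, hCW, hW⟩ := norm_mul_sq_le_energyMix a b d e
  refine ⟨(2 * CA + 2 * CB) * (2 + CW), by positivity, ?_⟩
  intro c z q p r R hc0 hc1 hr hR hrR hz hq1 hq0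
  have hr10 : r ≤ 1 / 10 := le_trans (by nlinarith) hrR
  have hnc : ‖(c : ℂ)‖ = c := by rw [Complex.norm_real, Real.norm_of_nonneg hc0]
  have hnc' : ‖1 - (c : ℂ)‖ = 1 - c := by
    rw [← Complex.ofReal_one, ← Complex.ofReal_sub, Complex.norm_real,
      Real.norm_of_nonneg (by linarith)]
  have hz1 : ‖1 - z‖ ≤ 2 := (norm_sub_le _ _).trans (by rw [norm_one, hz]; nlinarith)
  set G := ‖energyMix a b d e c z q p‖ with hG
  have hG0 : 0 ≤ G := norm_nonneg _
  have hmid : c ≠ 0 → c ≠ 1 → 2 * ‖q * p‖ ≤ 1 + CW * (1 + G) := by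
    intro h0 h1
    have l1 := hq1 h1
    have l0 := hq0 h0
    have := hW c z q p (by rw [hnc]; exact hc1) (l0.trans hrR) (by rw [hz]; nlinarith)
      (norm_pos_iff.mp (hr.trans_le l1))
    linarith [sq_nonneg (‖q * p‖ - 1)]
  have boundA : ‖(1 - (c : ℂ)) * (z * slopeA a d e q p)‖
      ≤ 2 * CA * (r * R) * ((2 + CW) * (1 + G)) := by
    by_cases h1 : c = 1
    · subst h1
      simp only [Complex.ofReal_one, sub_self, zero_mul, norm_zero]
      positivity
    have l1 := hq1 h1
    have hqpos : 0 < ‖q‖ := hr.trans_le l1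
    have hE : ‖energyA a b d e z q p‖ ≤ 1 + G + CW * (1 + G) := by
      by_cases h0 : c = 0
      · have : energyA a b d e z q p = energyMix a b d e c z q p := by
          simp [energyMix, h0]
        rw [this, ← hG]
        have : 0 ≤ CW * (1 + G) := by positivity
        linarith
      · have : energyA a b d e z q p = energyMix a b d e c z q p - c * ((1 - z) * (q * p)) := by
          simp only [energyMix]; ring
        rw [this]
        refine (norm_sub_le _ _).trans ?_
        rw [norm_mul, norm_mul (1 - z), hnc]
        have h3 := hmid h0 h1
        have : c * (‖1 - z‖ * ‖q * p‖) ≤ 1 * (2 * ‖q * p‖) := by gcongr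
        linarith
    have h2 := hA z q p (by rw [hz]; nlinarith)
    have h3 : r * ‖slopeA a d e q p‖ ≤ CA * 2 * (1 + ‖energyA a b d e z q p‖) := by
      by_cases hbig : ‖q‖ ≤ 1
      · calc r * ‖slopeA a d e q p‖ ≤ ‖q‖ * ‖slopeA a d e q p‖ := by gcongr
          _ ≤ _ := h2
          _ ≤ _ := by gcongr; linarith
      · push Not at hbig
        have h5 : ‖q‖ * ‖slopeA a d e q p‖
            ≤ ‖q‖ * (CA * 2 * (1 + ‖energyA a b d e z q p‖)) := by
          refine h2.trans ?_
          rw [show ‖q‖ * (CA * 2 * (1 + ‖energyA a b d e z q p‖))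
            = CA * (2 * ‖q‖) * (1 + ‖energyA a b d e z q p‖) by ring]
          gcongr
          linarith
        have h6 := le_of_mul_le_mul_left h5 hqpos
        have h7 : r * ‖slopeA a d e q p‖ ≤ 1 * ‖slopeA a d e q p‖ := by
          gcongr; linarith
        linarith
    rw [norm_mul, norm_mul, hnc', hz]
    calc (1 - c) * (r ^ 2 * ‖slopeA a d e q p‖)
        ≤ 1 * (r ^ 2 * ‖slopeA a d e q p‖) := by gcongr; linarith
      _ = r * (r * ‖slopeA a d e q p‖) := by ring
      _ ≤ r * (CA * 2 * (1 + ‖energyA a b d e z q p‖)) := by gcongr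
      _ ≤ r * (CA * 2 * ((2 + CW) * (1 + G))) := by gcongr; linarith
      _ = 2 * CA * r * ((2 + CW) * (1 + G)) := by ring
      _ ≤ 2 * CA * (r * R) * ((2 + CW) * (1 + G)) := by
        gcongr; exact le_mul_of_one_le_right hr.le hR
  have boundB : ‖c * slopeB a b d e z q p‖ ≤ 2 * CB * (r * R) * ((2 + CW) * (1 + G)) := by
    by_cases h0 : c = 0
    · subst h0
      simp only [Complex.ofReal_zero, zero_mul, norm_zero]
      positivity
    have l0 := hq0 h0
    have hE : ‖energyB a b d e z q p‖ ≤ 1 + G + CW * (1 + G) := by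
      by_cases h1 : c = 1
      · have : energyB a b d e z q p = energyMix a b d e c z q p := by
          simp [energyMix, energyB, h1]
        rw [this, ← hG]
        have : 0 ≤ CW * (1 + G) := by positivity
        linarith
      · have : energyB a b d e z q p
            = energyMix a b d e c z q p + (1 - (c : ℂ)) * ((1 - z) * (q * p)) := by
          simp only [energyMix, energyB]; ring
        rw [this]
        refine (norm_add_le _ _).trans ?_
        rw [norm_mul, norm_mul (1 - z), hnc']
        have h3 := hmid h0 h1
        have : (1 - c) * (‖1 - z‖ * ‖q * p‖) ≤ 1 * (2 * ‖q * p‖) := by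
          gcongr; linarith
        linarith
    have h2 := hB z q p (by linarith)
    rw [norm_mul, hnc]
    have h4 : ‖q‖ + ‖z‖ ≤ 2 * (r * R) := by
      rw [hz]
      nlinarith
    calc c * ‖slopeB a b d e z q p‖ ≤ 1 * ‖slopeB a b d e z q p‖ := by gcongr
      _ ≤ CB * (‖q‖ + ‖z‖) * (1 + ‖energyB a b d e z q p‖) := by rw [one_mul]; exact h2
      _ ≤ CB * (2 * (r * R)) * ((2 + CW) * (1 + G)) := by gcongr; linarith
      _ = _ := by ring
  calc _ ≤ _ := norm_add_le _ _
    _ ≤ _ := add_le_add boundA boundB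
    _ = _ := by ring

theorem norm_fieldQ_div_le (a b d : ℂ) : ∃ C : ℝ, 0 < C ∧ ∀ z q p : ℂ,
    ‖q‖ ≤ 1 / 10 → 10 * ‖z‖ ≤ ‖q‖ →
    ‖fieldQ a b d z q p / (z - 1)‖ ≤ C * ‖q‖ * (1 + ‖q * p‖) := by
  obtain ⟨k, hk⟩ : ∃ k, k = 2 + ‖a‖ + ‖b‖ + ‖d‖ := ⟨_, rfl⟩
  have ha := norm_nonneg a
  have hb := norm_nonneg b
  have hd := norm_nonneg d
  have hk0 : 0 < k := by linarith
  refine ⟨20 * k, by positivity, fun z q p hq hz => ?_⟩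
  have hz0 := norm_nonneg z
  have hq0 := norm_nonneg q
  have l1 : 1 / 2 ≤ ‖z - 1‖ := by
    have := norm_sub_norm_le 1 z
    rw [norm_one, norm_sub_rev] at this
    linarith
  have l3 : ‖q - 1‖ ≤ 2 := (norm_sub_le _ _).trans (by rw [norm_one]; linarith)
  have l5 : ‖q - z‖ ≤ 2 * ‖q‖ := (norm_sub_le _ _).trans (by linarith)
  have hb1 : ‖b - 1‖ ≤ ‖b‖ + 1 := (norm_sub_le _ _).trans (by rw [norm_one])
  have e1 : fieldQ a b d z q p = 2 * (q - 1) * (q - z) * (q * p) - a * (q - 1) * (q - z)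
      - (b - 1) * q * (q - 1) - d * q * (q - z) := by
    simp only [fieldQ]; ring
  rw [norm_div, div_le_iff₀ (by linarith), e1]
  have n : ‖2 * (q - 1) * (q - z) * (q * p) - a * (q - 1) * (q - z)
      - (b - 1) * q * (q - 1) - d * q * (q - z)‖ ≤ 8 * ‖q‖ * ‖q * p‖ + ‖a‖ * 2 * (2 * ‖q‖)
      + (‖b‖ + 1) * ‖q‖ * 2 + ‖d‖ * 1 * (2 * ‖q‖) := by
    refine (norm_sub_le _ _).trans (add_le_add ((norm_sub_le _ _).trans (add_le_add
      ((norm_sub_le _ _).trans (add_le_add ?_ ?_)) ?_)) ?_)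
    · rw [norm_mul, norm_mul (2 * (q - 1)), norm_mul 2, Complex.norm_ofNat]
      calc 2 * ‖q - 1‖ * ‖q - z‖ * ‖q * p‖ ≤ 2 * 2 * (2 * ‖q‖) * ‖q * p‖ := by gcongr
        _ = _ := by ring
    · rw [norm_mul, norm_mul]; gcongr
    · rw [norm_mul, norm_mul]; gcongr
    · rw [norm_mul, norm_mul]; gcongr; linarith
  refine n.trans ?_
  have h2 : 20 * k * ‖q‖ * (1 + ‖q * p‖) * (1 / 2) ≤ 20 * k * ‖q‖ * (1 + ‖q * p‖) * ‖z - 1‖ := by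
    gcongr
  refine le_trans ?_ h2
  have := mul_nonneg hq0 (norm_nonneg (q * p))
  have h3 : 2 * (‖q‖ * ‖q * p‖) ≤ k * (‖q‖ * ‖q * p‖) := by
    gcongr; linarith
  have h4 := mul_nonneg ha hq0
  have h5 := mul_nonneg hb hq0
  have h6 := mul_nonneg hd hq0
  have h7 : k * ‖q‖ = 2 * ‖q‖ + ‖a‖ * ‖q‖ + ‖b‖ * ‖q‖ + ‖d‖ * ‖q‖ := by rw [hk]; ring
  linarith

/-- The interpolated energy along a flow. -/
noncomputable def flowEnergy (a b d e : ℂ) (η : ℝ) (Q P : ℂ → ℂ) (t : ℂ) : ℂ :=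
  energyMix a b d e (cutoff η (‖Q t‖ ^ 2 * Real.exp (-t.re)) : ℝ) (Complex.exp t) (Q t) (P t)

variable {a b d e : ℂ} {B : Set ℂ} {Q P : ℂ → ℂ}

theorem exists_hasDerivAt_flowEnergy (a b d e : ℂ) : ∃ C : ℝ, 0 < C ∧ ∀ η : ℝ, 0 < η → η ≤ 1 →
    ∃ S : ℝ, 0 < S ∧ ∀ (B : Set ℂ) (Q P : ℂ → ℂ), IsFlow a b d e B Q P → ∀ x θ : ℝ, x < -S →
      (x + θ * Complex.I : ℂ) ∉ B →
      ∃ D : ℂ, HasDerivAt (fun s : ℝ => flowEnergy a b d e η Q P (s + θ * Complex.I)) D x ∧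
        ‖D‖ ≤ C * η * (1 + ‖flowEnergy a b d e η Q P (x + θ * Complex.I)‖) := by
  obtain ⟨CD, hCD, hdrift⟩ := norm_drift_le a b d e
  obtain ⟨CW, hCW, hW⟩ := norm_mul_sq_le_energyMix a b d e
  obtain ⟨CF, hCF, hF⟩ := norm_fieldQ_div_le a b d
  obtain ⟨M, hM, hcut⟩ := exists_hasDerivAt_cutoff
  refine ⟨1 + M * (2 * CF + 1) * 4 * (1 + CW), by positivity, fun η hη hη1 => ?_⟩
  set R := Real.exp η⁻¹ with hR
  have hR2 : 2 ≤ R := by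
    have := Real.add_one_le_exp η⁻¹
    have := (one_le_inv₀ hη).mpr hη1
    linarith
  obtain ⟨m, hm0, hm1, hm2⟩ : ∃ m : ℝ, 0 < m ∧ m * R ≤ 1 / 10 ∧ CD * (m * R) ≤ η := by
    refine ⟨min (1 / (10 * R)) (η / (CD * R)), by positivity, ?_, ?_⟩
    · calc _ ≤ 1 / (10 * R) * R := by gcongr; exact min_le_left _ _
        _ = _ := by field_simp
    · calc _ ≤ CD * (η / (CD * R) * R) := by gcongr; exact min_le_right _ _
        _ = _ := by field_simp
  have hm01 : m ≤ 1 / 10 := by nlinarith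
  refine ⟨-2 * Real.log m, by
    have := Real.log_neg hm0 (by linarith)
    linarith, ?_⟩
  intro B Q P hflow x θ hx ht
  set t : ℂ := x + θ * Complex.I with htdef
  have htre : t.re = x := by simp [htdef]
  have hlogm := Real.log_neg hm0 (by linarith)
  have ht0 : t.re < 0 := by rw [htre]; linarith
  set r := Real.exp (x / 2) with hr
  have hr0 : 0 < r := Real.exp_pos _
  have hrm : r ≤ m := by
    rw [hr, ← Real.le_log_iff_exp_le hm0]; linarith
  have hrR : r * R ≤ 1 / 10 := le_trans (by gcongr) hm1
  have hr2 : r ^ 2 = Real.exp x := by rw [hr, ← Real.exp_nat_mul]; congr 1; push_cast; ring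
  set z := Complex.exp t with hz
  have hzr : ‖z‖ = r ^ 2 := by rw [hz, Complex.norm_exp, htre, hr2]
  set q := Q t with hq
  set p := P t with hp
  set X := ‖q‖ ^ 2 * Real.exp (-t.re) with hX
  have hX0 : 0 ≤ X := by positivity
  have hexp : Real.exp (-t.re) = (r ^ 2)⁻¹ := by rw [htre, hr2, Real.exp_neg]
  have hXr : ‖q‖ ^ 2 = X * r ^ 2 := by rw [hX, hexp]; field_simp
  set c := cutoff η X with hc
  have low : R ≤ 1 + X → r ≤ ‖q‖ := by
    intro h
    refine (pow_le_pow_iff_left₀ hr0.le (norm_nonneg _) two_ne_zero).mp ?_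
    rw [hXr]
    nlinarith [sq_nonneg r]
  have high : 1 + X ≤ R ^ 2 → ‖q‖ ≤ r * R := by
    intro h
    refine (pow_le_pow_iff_left₀ (norm_nonneg _) (by positivity) two_ne_zero).mp ?_
    rw [hXr]
    nlinarith [sq_nonneg r]
  have hd := hdrift c z q p r R (cutoff_nonneg _ _) (cutoff_le_one _ _) hr0 (by linarith) hrR hzr
    (fun h => low (exp_inv_le_of_cutoff_ne_one hη hX0 h))
    (fun h => high (le_exp_of_cutoff_ne_zero hη hX0 h))
  set G := ‖flowEnergy a b d e η Q P t‖ with hG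
  have hGe : ‖energyMix a b d e c z q p‖ = G := rfl
  rw [hGe] at hd
  have hG0 : 0 ≤ G := norm_nonneg _
  -- derivatives along the ray
  have ray : ∀ {f : ℂ → ℂ} {f' : ℂ}, HasDerivAt f f' t →
      HasDerivAt (fun s : ℝ => f (s + θ * Complex.I)) f' x := fun h =>
    (HasDerivAt.comp_add_const (x : ℂ) (θ * Complex.I) h).comp_ofReal
  have hA := ray (hflow.hasDerivAt_energyA ht0 ht)
  have hB := ray (hflow.hasDerivAt_energyB ht0 ht)
  have hQ := ray (hflow.hasDerivAt_fst t ht0 ht)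
  set q' := fieldQ a b d z q p / (z - 1) with hq'
  have hXd : HasDerivAt (fun s : ℝ => ‖Q (s + θ * Complex.I)‖ ^ 2 *
      Real.exp (-((s + θ * Complex.I : ℂ).re)))
      (2 * inner ℝ q q' * Real.exp (-x) + ‖q‖ ^ 2 * (Real.exp (-x) * (-1))) x := by
    have h1 := hQ.norm_sq
    have h2 : HasDerivAt (fun s : ℝ => Real.exp (-s)) (Real.exp (-x) * (-1)) x :=
      (hasDerivAt_neg x).exp
    exact (h1.mul h2).congr_of_eventuallyEq (Filter.Eventually.of_forall fun s => by simp)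
  obtain ⟨Dc, hDc, hDcb, hDcz⟩ := hcut η X hη hX0
  have hcd := (HasDerivAt.comp (h₂ := cutoff η) x (by
    show HasDerivAt (cutoff η) Dc (‖Q (x + θ * Complex.I)‖ ^ 2 *
      Real.exp (-((x + θ * Complex.I : ℂ).re)))
    exact hDc) hXd).ofReal_comp
  have htot := hA.add (hcd.mul (hB.sub hA))
  refine ⟨_, (htot.congr_of_eventuallyEq (Filter.Eventually.of_forall fun s => ?_)), ?_⟩
  · simp only [flowEnergy, energyMix, energyB, Pi.add_apply, Pi.mul_apply, Pi.sub_apply,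
      Function.comp_apply]
    ring
  · have e1 : ∀ u : ℝ, z * slopeA a d e q p + ((u : ℂ) *
        (energyB a b d e z q p - energyA a b d e z q p)
        + (c : ℂ) * (slopeB a b d e z q p - z * slopeA a d e q p))
        = ((1 - (c : ℂ)) * (z * slopeA a d e q p) + c * slopeB a b d e z q p)
          + u * ((1 - z) * (q * p)) := by
      intro u
      simp only [energyB]
      ring
    refine (congrArg norm (e1 _)).trans_le ?_
    refine (norm_add_le _ _).trans ?_
    have hfirst : CD * (r * R) * (1 + G) ≤ η * (1 + G) := by
      gcongr
      refine le_trans ?_ hm2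
      gcongr
    rw [norm_mul, Complex.norm_real, Real.norm_eq_abs, abs_mul]
    have hsecond : |Dc| * |2 * inner ℝ q q' * Real.exp (-x) + ‖q‖ ^ 2 * (Real.exp (-x) * (-1))|
        * ‖(1 - z) * (q * p)‖ ≤ M * (2 * CF + 1) * 4 * (1 + CW) * η * (1 + G) := by
      by_cases hD0 : Dc = 0
      · rw [hD0, abs_zero, zero_mul, zero_mul]
        positivity
      obtain ⟨hlo, hhi⟩ := hDcz hD0
      have hq1 := low hlo
      have hq2 := (high hhi).trans hrR
      have hqpos : 0 < ‖q‖ := hr0.trans_le hq1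
      have hzq : 10 * ‖z‖ ≤ ‖q‖ := by rw [hzr]; nlinarith
      have hw := hW c z q p (by
        rw [Complex.norm_real, Real.norm_of_nonneg (cutoff_nonneg _ _)]
        exact cutoff_le_one _ _) hq2 hzq (norm_pos_iff.mp hqpos)
      rw [hGe] at hw
      set y := ‖q * p‖ with hy
      have hy0 : 0 ≤ y := norm_nonneg _
      have hf := hF z q p hq2 hzq
      rw [← hq'] at hf
      have hex : Real.exp (-x) * ‖q‖ ^ 2 = X := by rw [hX, htre]; ring
      have hX' : |2 * inner ℝ q q' * Real.exp (-x) + ‖q‖ ^ 2 * (Real.exp (-x) * (-1))|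
          ≤ (2 * CF + 1) * (1 + y) * X := by
        have h1 : |inner ℝ q q'| ≤ ‖q‖ * (CF * ‖q‖ * (1 + y)) :=
          (abs_real_inner_le_norm q q').trans (by gcongr)
        have h2 : |2 * inner ℝ q q' * Real.exp (-x) + ‖q‖ ^ 2 * (Real.exp (-x) * (-1))|
            ≤ 2 * |inner ℝ q q'| * Real.exp (-x) + X := by
          refine (abs_add_le _ _).trans (add_le_add (le_of_eq ?_) (le_of_eq ?_))
          · rw [abs_mul, abs_mul, abs_of_pos (Real.exp_pos _), abs_two]
          · rw [← hex, mul_neg_one, mul_neg, abs_neg, abs_of_nonneg (by positivity)]; ring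
        refine h2.trans ?_
        have h3 : 2 * |inner ℝ q q'| * Real.exp (-x)
            ≤ 2 * (‖q‖ * (CF * ‖q‖ * (1 + y))) * Real.exp (-x) := by gcongr
        have h4 : 2 * (‖q‖ * (CF * ‖q‖ * (1 + y))) * Real.exp (-x)
            = 2 * CF * (1 + y) * X := by rw [← hex]; ring
        have h5 : 0 ≤ y * X := by positivity
        linarith
      have hz2 : ‖(1 - z) * (q * p)‖ ≤ 2 * y := by
        rw [norm_mul]
        gcongr
        exact (norm_sub_le _ _).trans (by rw [norm_one]; linarith)
      have hyy : (1 + y) * (2 * y) ≤ 4 * (1 + CW) * (1 + G) := by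
        have : 0 ≤ CW * (1 + G) := by positivity
        linarith [sq_nonneg (y - 1)]
      calc _ ≤ |Dc| * ((2 * CF + 1) * (1 + y) * X) * (2 * y) := by gcongr
        _ ≤ |Dc| * ((2 * CF + 1) * (1 + y) * (1 + X)) * (2 * y) := by gcongr; linarith
        _ = (|Dc| * (1 + X)) * (2 * CF + 1) * ((1 + y) * (2 * y)) := by ring
        _ ≤ (M * η) * (2 * CF + 1) * (4 * (1 + CW) * (1 + G)) := by gcongr
        _ = _ := by ring
    calc _ ≤ η * (1 + G) + M * (2 * CF + 1) * 4 * (1 + CW) * η * (1 + G) :=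
          add_le_add (hd.trans hfirst) hsecond
      _ = _ := by ring

variable {a b d e : ℂ} {B : Set ℂ} {Q P : ℂ → ℂ}

theorem IsFlow.continuousAt_flowEnergy (h : IsFlow a b d e B Q P) {η : ℝ} (hη : 0 < η) {t : ℂ}
    (ht : t.re < 0) (hB : t ∉ B) : ContinuousAt (flowEnergy a b d e η Q P) t := by
  have hq := (h.hasDerivAt_fst t ht hB).continuousAt
  have hp := (h.hasDerivAt_snd t ht hB).continuousAt
  have hX : ContinuousAt (fun t : ℂ => ‖Q t‖ ^ 2 * Real.exp (-t.re)) t := by fun_prop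
  obtain ⟨M, -, hM⟩ := exists_hasDerivAt_cutoff
  obtain ⟨D, hD, -⟩ := hM η (‖Q t‖ ^ 2 * Real.exp (-t.re)) hη (by positivity)
  have hc : ContinuousAt (fun t : ℂ => cutoff η (‖Q t‖ ^ 2 * Real.exp (-t.re))) t :=
    ContinuousAt.comp (g := cutoff η) hD.continuousAt hX
  have hc' : ContinuousAt (fun t : ℂ => ((cutoff η (‖Q t‖ ^ 2 * Real.exp (-t.re)) : ℝ) : ℂ)) t :=
    Complex.continuous_ofReal.continuousAt.comp hc
  unfold flowEnergy energyMix energyA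
  fun_prop

theorem IsFlow.periodic_flowEnergy (h : IsFlow a b d e B Q P) (η : ℝ) (t : ℂ) :
    flowEnergy a b d e η Q P (t + 2 * Real.pi * Complex.I) = flowEnergy a b d e η Q P t := by
  unfold flowEnergy
  rw [h.periodic_fst, h.periodic_snd, Complex.exp_periodic]
  simp

theorem exists_lt_forall_re_ne {B : Set ℂ} (hB : B.Countable) (x : ℝ) :
    ∃ y < x, ∀ t ∈ B, t.re ≠ y := by
  obtain ⟨y, hy1, hy2⟩ := (((hB.image Complex.re).dense_compl ℝ).inter_open_nonempty _ isOpen_Iio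
    ⟨x - 1, by simp⟩ : (Set.Iio x ∩ (Complex.re '' B)ᶜ).Nonempty)
  exact ⟨y, hy1, fun t ht h => hy2 ⟨t, ht, h⟩⟩

theorem dense_forall_im_ne {B : Set ℂ} (hB : B.Countable) :
    Dense {θ : ℝ | ∀ t ∈ B, t.im ≠ θ} := by
  have hsub : (Complex.im '' B)ᶜ ⊆ {θ : ℝ | ∀ t ∈ B, t.im ≠ θ} :=
    fun y hy t ht h => hy ⟨t, ht, h⟩
  exact ((hB.image Complex.im).dense_compl ℝ).mono hsub

theorem dense_forall_re_ne {B : Set ℂ} (hB : B.Countable) :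
    Dense {θ : ℝ | ∀ t ∈ B, t.re ≠ θ} := by
  have hsub : (Complex.re '' B)ᶜ ⊆ {θ : ℝ | ∀ t ∈ B, t.re ≠ θ} :=
    fun y hy t ht h => hy ⟨t, ht, h⟩
  exact ((hB.image Complex.re).dense_compl ℝ).mono hsub

theorem IsFlow.exists_norm_flowEnergy_le (h : IsFlow a b d e B Q P) {ε : ℝ} (hε : 0 < ε) :
    ∃ η C S : ℝ, 0 < η ∧ η ≤ 1 ∧ 0 < C ∧ 0 < S ∧ ∀ t ∉ B, t.re < -S →
      ‖flowEnergy a b d e η Q P t‖ ≤ C * Real.exp (-ε * t.re) := by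
  obtain ⟨CR, hCR, hrate⟩ := exists_hasDerivAt_flowEnergy a b d e
  obtain ⟨η, hη, hη1, hηε⟩ : ∃ η : ℝ, 0 < η ∧ η ≤ 1 ∧ CR * η ≤ ε := by
    refine ⟨min 1 (ε / CR), by positivity, min_le_left _ _, ?_⟩
    calc _ ≤ CR * (ε / CR) := by gcongr; exact min_le_right _ _
      _ = ε := by field_simp
  obtain ⟨S, hS, hder⟩ := hrate η hη hη1
  obtain ⟨x₁, hx₁, hx₁B⟩ := exists_lt_forall_re_ne h.countable (-S)
  set G := flowEnergy a b d e η Q P with hG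
  obtain ⟨K, hK0, hK⟩ : ∃ K : ℝ, 0 < K ∧ ∀ θ : ℝ, ‖G (x₁ + θ * Complex.I)‖ ≤ K := by
    have hcont : Continuous fun θ : ℝ => G (x₁ + θ * Complex.I) := by
      rw [continuous_iff_continuousAt]
      intro θ
      have : ContinuousAt G (x₁ + θ * Complex.I) :=
        h.continuousAt_flowEnergy hη (by simp; linarith) (fun hmem => hx₁B _ hmem (by simp))
      exact ContinuousAt.comp (g := G) this (by fun_prop)
    have hper : Function.Periodic (fun θ : ℝ => G (x₁ + θ * Complex.I)) (2 * Real.pi) := by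
      intro θ
      have := h.periodic_flowEnergy η (x₁ + θ * Complex.I)
      rw [← hG] at this
      simp only
      rw [← this]
      congr 1
      push_cast
      ring
    have := hper.isBounded_of_continuous (by positivity) hcont
    obtain ⟨K, hK⟩ := this.exists_norm_le
    refine ⟨|K| + 1, by positivity, fun θ => (hK _ ⟨θ, rfl⟩).trans ?_⟩
    linarith [le_abs_self K]
  have hray : ∀ θ : ℝ, (∀ t ∈ B, t.im ≠ θ) → ∀ x ≤ x₁,
      ‖G (x + θ * Complex.I)‖ ≤ (K + 1) * Real.exp (ε * (x₁ - x)) := by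
    intro θ hθ x hx
    have hd : ∀ s : ℝ, 0 ≤ s → ∃ D : ℂ,
        HasDerivAt (fun s : ℝ => G ((x₁ - s : ℝ) + θ * Complex.I)) D s ∧
        ‖D‖ ≤ ε * ‖G ((x₁ - s : ℝ) + θ * Complex.I)‖ + ε := by
      intro s hs
      obtain ⟨D, hD, hDn⟩ := hder B Q P h (x₁ - s) θ (by linarith)
        (fun hmem => hθ _ hmem (by simp))
      refine ⟨-D, ?_, ?_⟩
      · have := HasDerivAt.scomp s hD ((hasDerivAt_id s).const_sub x₁)
        rw [neg_one_smul] at this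
        exact this
      · rw [norm_neg]
        refine hDn.trans ?_
        rw [← hG]
        have := norm_nonneg (G ((x₁ - s : ℝ) + θ * Complex.I))
        nlinarith
    choose! D hD hDn using hd
    have := norm_le_gronwallBound_of_norm_deriv_right_le
      (f := fun s : ℝ => G ((x₁ - s : ℝ) + θ * Complex.I)) (f' := D) (δ := K) (K := ε) (ε := ε)
      (a := 0) (b := x₁ - x)
      (fun s hs => (hD s hs.1).continuousAt.continuousWithinAt)
      (fun s hs => (hD s hs.1).hasDerivWithinAt)
      (by simpa using hK θ) (fun s hs => hDn s hs.1) (x₁ - x) ⟨by linarith, le_rfl⟩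
    rw [gronwallBound_of_K_ne_0 hε.ne', div_self hε.ne', sub_zero] at this
    simp only [sub_sub_cancel] at this
    refine this.trans ?_
    linarith
  refine ⟨η, (K + 1) * Real.exp (ε * x₁) + 1, -x₁, hη, hη1, by positivity, by linarith, ?_⟩
  intro t ht htre
  have hcG := h.continuousAt_flowEnergy hη (show t.re < 0 by linarith) ht
  by_contra! hc
  have hopen : ContinuousAt (fun θ : ℝ => ‖G (t.re + θ * Complex.I)‖) t.im := by
    refine ContinuousAt.norm (ContinuousAt.comp (g := G) ?_ (by fun_prop))
    rw [Complex.re_add_im]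
    exact hcG
  have hlt : (K + 1) * Real.exp (ε * (x₁ - t.re)) < ‖G (t.re + t.im * Complex.I)‖ := by
    rw [Complex.re_add_im]
    refine lt_of_le_of_lt ?_ hc
    have : ε * (x₁ - t.re) = ε * x₁ + -ε * t.re := by ring
    rw [this, Real.exp_add]
    have := Real.exp_pos (-ε * t.re)
    linarith
  have hev := hopen.eventually (lt_mem_nhds hlt)
  obtain ⟨θ, hθ1, hθ2⟩ := ((dense_forall_im_ne h.countable).inter_nhds_nonempty hev)
  exact absurd (hray θ hθ1 t.re (by linarith)) (not_le.mpr hθ2)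

variable {a b d e : ℂ} {B : Set ℂ} {Q P : ℂ → ℂ}

theorem exp_half_sq (x : ℝ) : Real.exp (x / 2) ^ 2 = Real.exp x := by
  rw [← Real.exp_nat_mul]; congr 1; push_cast; ring

theorem IsFlow.exists_apriori_bound (h : IsFlow a b d e B Q P) {ε : ℝ} (hε : 0 < ε) :
    ∃ C S : ℝ, 0 < C ∧ 0 < S ∧ ∀ t ∉ B, t.re < -S →
      (Real.exp t.re ≤ 64 * ‖Q t‖ ^ 2 →
        ‖energyA a b d e (Complex.exp t) (Q t) (P t)‖ ≤ C * Real.exp (-ε * t.re)) ∧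
      (‖Q t‖ ^ 2 ≤ 64 * Real.exp t.re →
        ‖energyB a b d e (Complex.exp t) (Q t) (P t)‖ ≤ C * Real.exp (-ε * t.re)) ∧
      (Real.exp t.re ≤ 64 * ‖Q t‖ ^ 2 → ‖Q t‖ ^ 2 ≤ 64 * Real.exp t.re →
        ‖Q t * P t‖ ^ 2 ≤ C * Real.exp (-ε * t.re)) := by
  obtain ⟨η, C, S, hη, hη1, hC, hS, hb⟩ := h.exists_norm_flowEnergy_le hε
  obtain ⟨CW, hCW, hW⟩ := norm_mul_sq_le_energyMix a b d e
  set R := Real.exp η⁻¹ with hR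
  have hR2 : 2 ≤ R := by
    have := Real.add_one_le_exp η⁻¹
    have := (one_le_inv₀ hη).mpr hη1
    linarith
  obtain ⟨m, hm0, hm1, hm2⟩ : ∃ m : ℝ, 0 < m ∧ m * R ≤ 1 / 10 ∧ m ≤ 1 / 80 := by
    refine ⟨min (1 / (10 * R)) (1 / 80), by positivity, ?_, min_le_right _ _⟩
    calc _ ≤ 1 / (10 * R) * R := by gcongr; exact min_le_left _ _
      _ = _ := by field_simp
  have hlogm := Real.log_neg hm0 (by linarith)
  refine ⟨(2 + CW) * (1 + C), S + -2 * Real.log m, by positivity, by linarith,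
    fun t ht htre => ?_⟩
  set x := t.re with hx
  have hG := hb t ht (by linarith)
  rw [← hx] at hG
  set r := Real.exp (x / 2) with hr
  have hr0 : 0 < r := Real.exp_pos _
  have hrm : r ≤ m := by
    rw [hr, ← Real.le_log_iff_exp_le hm0]; linarith
  have hr2 : r ^ 2 = Real.exp x := exp_half_sq x
  rw [← hr2]
  set z := Complex.exp t with hz
  have hzr : ‖z‖ = r ^ 2 := by rw [hz, Complex.norm_exp, ← hx, hr2]
  set q := Q t with hq
  set p := P t with hp
  set X := ‖q‖ ^ 2 * Real.exp (-t.re) with hX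
  have hX0 : 0 ≤ X := by positivity
  have hexp : Real.exp (-t.re) = (r ^ 2)⁻¹ := by rw [← hx, hr2, Real.exp_neg]
  have hXr : ‖q‖ ^ 2 = X * r ^ 2 := by rw [hX, hexp]; field_simp
  set c := cutoff η X with hc
  have hGe : flowEnergy a b d e η Q P t = energyMix a b d e c z q p := rfl
  rw [hGe] at hG
  set G := ‖energyMix a b d e c z q p‖ with hGdef
  have hG0 : 0 ≤ G := norm_nonneg _
  have hE1 : 1 ≤ Real.exp (-ε * x) := Real.one_le_exp (by nlinarith)
  have hG1 : 1 + G ≤ (1 + C) * Real.exp (-ε * x) := by linarith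
  have hzone : r ^ 2 ≤ 64 * ‖q‖ ^ 2 → ‖q‖ ≤ r * R ∨ ‖q‖ ^ 2 ≤ 64 * r ^ 2 →
      ‖q * p‖ ^ 2 ≤ CW * (1 + G) := by
    intro h1 h2
    have hlow : r ≤ 8 * ‖q‖ := by
      refine (pow_le_pow_iff_left₀ hr0.le (by positivity) two_ne_zero).mp ?_
      linarith [h1, mul_pow 8 ‖q‖ 2]
    have hq10 : ‖q‖ ≤ 1 / 10 := by
      rcases h2 with h2 | h2
      · exact h2.trans (le_trans (by gcongr) hm1)
      · have : ‖q‖ ≤ 8 * r := by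
          refine (pow_le_pow_iff_left₀ (norm_nonneg _) (by positivity) two_ne_zero).mp ?_
          linarith [mul_pow 8 r 2]
        linarith
    refine hW c z q p ?_ hq10 ?_ ?_
    · rw [Complex.norm_real, Real.norm_of_nonneg (cutoff_nonneg _ _)]
      exact cutoff_le_one _ _
    · rw [hzr]; nlinarith
    · exact norm_pos_iff.mp (by linarith)
  have hz1 : ‖1 - z‖ ≤ 2 := (norm_sub_le _ _).trans (by rw [norm_one, hzr]; nlinarith)
  have hy : ∀ v : ℝ, 0 ≤ v → v ≤ 1 → ‖q * p‖ ^ 2 ≤ CW * (1 + G) →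
      ‖(v : ℂ) * ((1 - z) * (q * p))‖ ≤ 1 + CW * (1 + G) := by
    intro v hv0 hv1 hh
    rw [norm_mul, norm_mul (1 - z), Complex.norm_real, Real.norm_of_nonneg hv0]
    calc v * (‖1 - z‖ * ‖q * p‖) ≤ 1 * (2 * ‖q * p‖) := by gcongr
      _ ≤ 1 + CW * (1 + G) := by linarith [sq_nonneg (‖q * p‖ - 1)]
  have hfin : ∀ u : ℝ, u ≤ G + (1 + CW * (1 + G)) →
      u ≤ (2 + CW) * (1 + C) * Real.exp (-ε * x) := by
    intro u hu
    calc u ≤ (2 + CW) * (1 + G) := by linarith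
      _ ≤ (2 + CW) * ((1 + C) * Real.exp (-ε * x)) := by gcongr
      _ = _ := by ring
  have hpos : 0 ≤ CW * (1 + G) := by positivity
  refine ⟨fun h1 => hfin _ ?_, fun h1 => hfin _ ?_, fun h1 h2 => hfin _ ?_⟩
  · by_cases h0 : c = 0
    · have : energyA a b d e z q p = energyMix a b d e c z q p := by simp [energyMix, h0]
      rw [this]
      linarith
    · have hq1 : ‖q‖ ≤ r * R := by
        have := le_exp_of_cutoff_ne_zero hη hX0 h0
        refine (pow_le_pow_iff_left₀ (norm_nonneg _) (by positivity) two_ne_zero).mp ?_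
        rw [hXr]
        nlinarith [sq_nonneg r]
      have : energyA a b d e z q p = energyMix a b d e c z q p - c * ((1 - z) * (q * p)) := by
        simp only [energyMix]; ring
      rw [this]
      exact (norm_sub_le _ _).trans (add_le_add le_rfl
        (hy c (cutoff_nonneg _ _) (cutoff_le_one _ _) (hzone h1 (Or.inl hq1))))
  · by_cases h0 : c = 1
    · have : energyB a b d e z q p = energyMix a b d e c z q p := by
        simp [energyMix, energyB, h0]
      rw [this]
      linarith
    · have hq1 : r ^ 2 ≤ ‖q‖ ^ 2 := by
        have := exp_inv_le_of_cutoff_ne_one hη hX0 h0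
        rw [hXr]
        nlinarith [sq_nonneg r]
      have : energyB a b d e z q p
          = energyMix a b d e c z q p + ((1 - c : ℝ) : ℂ) * ((1 - z) * (q * p)) := by
        simp only [energyMix, energyB]; push_cast; ring
      rw [this]
      exact (norm_add_le _ _).trans (add_le_add le_rfl
        (hy (1 - c) (sub_nonneg.mpr (cutoff_le_one _ _)) (by linarith [cutoff_nonneg η X])
          (hzone (by linarith [sq_nonneg ‖q‖]) (Or.inr h1))))
  · have := hzone h1 (Or.inr h2)
    linarith

/-- The leading logarithmic derivative of `q` in the intermediate zone. -/
def exponent (a b w : ℂ) : ℂ := 2 * w - (a + b - 1)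

theorem exists_norm_logDeriv_le (a b d e : ℂ) : ∃ C : ℝ, 0 < C ∧ ∀ z q p : ℂ, q ≠ 0 →
    ‖q‖ + ‖z / q‖ ≤ 1 / 2 →
    ‖fieldQ a b d z q p / (z - 1) / q - exponent a b (q * p)‖
      ≤ C * (‖q‖ + ‖z / q‖) * (1 + ‖q * p‖) ∧
    ‖((q - z / q) * (q * p) ^ 2 - (a * (q - z / q) + (b - 1) * q + d * q) * (q * p)
        + e * q) / (1 - z)‖
      ≤ C * (‖q‖ + ‖z / q‖) * (1 + ‖q * p‖) ^ 2 := by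
  obtain ⟨k, hk⟩ : ∃ k, k = 2 + ‖a‖ + ‖b‖ + ‖d‖ + ‖e‖ := ⟨_, rfl⟩
  have ha := norm_nonneg a
  have hb := norm_nonneg b
  have hd := norm_nonneg d
  have he := norm_nonneg e
  have hk0 : 0 < k := by linarith
  refine ⟨12 * k, by positivity, fun z q p hq hD => ?_⟩
  obtain ⟨u, hu⟩ : ∃ u, u = z / q := ⟨_, rfl⟩
  have hzu : z = u * q := by rw [hu]; field_simp
  rw [← hu] at hD ⊢
  have hq0 := norm_nonneg q
  have hu0 := norm_nonneg u
  obtain ⟨D, hDdef⟩ : ∃ D, D = ‖q‖ + ‖u‖ := ⟨_, rfl⟩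
  rw [← hDdef] at hD ⊢
  have hD0 : 0 ≤ D := by rw [hDdef]; positivity
  have hzn : ‖z‖ ≤ D / 2 := by
    rw [hzu, norm_mul]
    nlinarith
  have l1 : 1 / 2 ≤ ‖z - 1‖ := by
    have := norm_sub_norm_le 1 z
    rw [norm_one, norm_sub_rev] at this
    linarith
  have hz1 : z - 1 ≠ 0 := norm_pos_iff.mp (by linarith)
  have l1' : 1 / 2 ≤ ‖1 - z‖ := by rwa [norm_sub_rev]
  have hb1 : ‖b - 1‖ ≤ ‖b‖ + 1 := (norm_sub_le _ _).trans (by rw [norm_one])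
  set w := q * p with hw
  have hw0 := norm_nonneg w
  have n1 : ‖u + q - 2 * z‖ ≤ 2 * D := by
    refine (norm_sub_le _ _).trans ?_
    have := norm_add_le u q
    rw [norm_mul, Complex.norm_ofNat]
    linarith
  have n2 : ‖q - z‖ ≤ 2 * D := (norm_sub_le _ _).trans (by linarith)
  have n3 : ‖q - u‖ ≤ D := (norm_sub_le _ _).trans (by linarith)
  have hqD : ‖q‖ ≤ D := by linarith
  constructor
  · have e1 : fieldQ a b d z q p / (z - 1) / q - exponent a b w
        = ((2 * w - a) * (u + q - 2 * z) - (b - 1) * (q - z) - d * (q - z)) / (z - 1) := by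
      have h1 : fieldQ a b d z q p / q = 2 * (q - 1) * (1 - u) * w - a * (q - 1) * (1 - u)
          - (b - 1) * (q - 1) - d * (q - z) := by
        rw [div_eq_iff hq, hzu, hw]
        simp only [fieldQ]
        ring
      rw [div_right_comm, h1, eq_div_iff hz1, sub_mul, div_mul_cancel₀ _ hz1, hzu]
      simp only [exponent]
      ring
    rw [e1, norm_div, div_le_iff₀ (by linarith)]
    have n : ‖(2 * w - a) * (u + q - 2 * z) - (b - 1) * (q - z) - d * (q - z)‖
        ≤ (2 * ‖w‖ + ‖a‖) * (2 * D) + (‖b‖ + 1) * (2 * D) + ‖d‖ * (2 * D) := by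
      refine (norm_sub_le _ _).trans (add_le_add ((norm_sub_le _ _).trans (add_le_add ?_ ?_)) ?_)
      · rw [norm_mul]
        have : ‖2 * w - a‖ ≤ 2 * ‖w‖ + ‖a‖ :=
          (norm_sub_le _ _).trans (by rw [norm_mul, Complex.norm_ofNat])
        gcongr
      · rw [norm_mul]; gcongr
      · rw [norm_mul]; gcongr
    refine n.trans ?_
    have h2 : 12 * k * D * (1 + ‖w‖) * (1 / 2) ≤ 12 * k * D * (1 + ‖w‖) * ‖z - 1‖ := by
      gcongr
    refine le_trans ?_ h2
    have h3 : (2 * ‖w‖ + ‖a‖) * (2 * D) + (‖b‖ + 1) * (2 * D) + ‖d‖ * (2 * D)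
        = 2 * D * (2 * ‖w‖ + (‖a‖ + ‖b‖ + ‖d‖ + 1)) := by ring
    have h4 : 12 * k * D * (1 + ‖w‖) * (1 / 2) = 2 * D * (3 * k * (1 + ‖w‖)) := by ring
    rw [h3, h4]
    gcongr
    nlinarith
  · rw [norm_div, div_le_iff₀ (by linarith)]
    have n : ‖(q - u) * w ^ 2 - (a * (q - u) + (b - 1) * q + d * q) * w + e * q‖
        ≤ D * ‖w‖ ^ 2 + (‖a‖ * D + (‖b‖ + 1) * D + ‖d‖ * D) * ‖w‖ + ‖e‖ * D := by
      refine (norm_add_le _ _).trans (add_le_add ((norm_sub_le _ _).trans (add_le_add ?_ ?_)) ?_)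
      · rw [norm_mul, norm_pow]; gcongr
      · rw [norm_mul]
        gcongr
        refine norm_add₃_le.trans ?_
        rw [norm_mul, norm_mul, norm_mul]
        gcongr
      · rw [norm_mul]; gcongr
    refine n.trans ?_
    have h2 : 12 * k * D * (1 + ‖w‖) ^ 2 * (1 / 2) ≤ 12 * k * D * (1 + ‖w‖) ^ 2 * ‖1 - z‖ := by
      gcongr
    refine le_trans ?_ h2
    have h3 : D * ‖w‖ ^ 2 + (‖a‖ * D + (‖b‖ + 1) * D + ‖d‖ * D) * ‖w‖ + ‖e‖ * D
        = D * (‖w‖ ^ 2 + (‖a‖ + ‖b‖ + ‖d‖ + 1) * ‖w‖ + ‖e‖) := by ring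
    have h4 : 12 * k * D * (1 + ‖w‖) ^ 2 * (1 / 2) = D * (6 * k * (1 + ‖w‖) ^ 2) := by ring
    rw [h3, h4]
    gcongr
    have h5 : (‖a‖ + ‖b‖ + ‖d‖ + 1) * ‖w‖ ≤ k * ‖w‖ := by gcongr; linarith
    have h6 : 1 * ‖w‖ ^ 2 ≤ k * ‖w‖ ^ 2 := by gcongr; linarith
    have h7 := mul_nonneg hk0.le hw0
    have h8 := mul_nonneg hk0.le (sq_nonneg ‖w‖)
    nlinarith

/-- Along a short straight path in the intermediate zone, `q` behaves like an exponential. -/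
theorem exists_norm_transport_le (a b d e : ℂ) : ∃ C : ℝ, 0 < C ∧
    ∀ (B : Set ℂ) (Q P : ℂ → ℂ), IsFlow a b d e B Q P → ∀ (t₀ v σ : ℂ) (δ : ℝ),
      Q t₀ ≠ 0 → σ = exponent a b (Q t₀ * P t₀) → ‖Q t₀‖ ≤ δ → ‖Complex.exp t₀ / Q t₀‖ ≤ δ →
      (∀ x ∈ Set.Icc (0 : ℝ) 1, t₀ + x * v ∉ B ∧ (t₀ + x * v).re < 0 ∧
        ‖Complex.exp (σ * (x * v))‖ ≤ 2 ∧ ‖Complex.exp ((1 - σ) * (x * v))‖ ≤ 2) →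
      C * δ * (1 + ‖v‖) ^ 2 * (1 + ‖Q t₀ * P t₀‖) ^ 2 ≤ 1 / 2 →
      ∀ x ∈ Set.Icc (0 : ℝ) 1, ‖Q (t₀ + x * v) / (Q t₀ * Complex.exp (σ * (x * v))) - 1‖
        ≤ C * δ * (1 + ‖v‖) ^ 2 * (1 + ‖Q t₀ * P t₀‖) ^ 2 := by
  obtain ⟨C₀, hC₀, hC⟩ := exists_norm_logDeriv_le a b d e
  refine ⟨14 + 240 * C₀, by positivity, ?_⟩
  intro B Q P h t₀ v σ δ hq₀ hσ hδ hδ' hpath hβ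
  set q₀ := Q t₀ with hq₀def
  set w₀ := Q t₀ * P t₀ with hw₀
  set M := 1 + ‖w₀‖ with hM
  have hM1 : 1 ≤ M := by linarith [norm_nonneg w₀]
  have hδ0 : 0 < δ := (norm_pos_iff.mpr hq₀).trans_le hδ
  set V := 1 + ‖v‖ with hV
  have hV1 : 1 ≤ V := by linarith [norm_nonneg v]
  have hvV : ‖v‖ < V := by linarith
  obtain ⟨β, hβdef⟩ : ∃ β, β = (14 + 240 * C₀) * δ * V ^ 2 * M ^ 2 := ⟨_, rfl⟩
  rw [← hβdef] at hβ ⊢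
  have hβ0 : 0 < β := by rw [hβdef]; positivity
  have hVM : δ * 1 ≤ δ * (V ^ 2 * M ^ 2) := by
    gcongr
    exact one_le_mul_of_one_le_of_one_le (one_le_pow₀ hV1) (one_le_pow₀ hM1)
  have hδβ : 14 * δ ≤ β := by
    rw [hβdef]
    have : 0 ≤ 240 * C₀ * (δ * (V ^ 2 * M ^ 2)) := by positivity
    linarith
  set E : ℝ → ℂ := fun x => q₀ * Complex.exp (σ * (x * v)) with hE
  have hE0 : ∀ x, E x ≠ 0 := fun x => mul_ne_zero hq₀ (Complex.exp_ne_zero _)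
  set Y : ℝ → ℂ := fun x => Q (t₀ + x * v) / E x with hY
  set W : ℝ → ℂ := fun x => Q (t₀ + x * v) * P (t₀ + x * v) with hW
  have hpathd : ∀ x : ℝ, HasDerivAt (fun x : ℝ => t₀ + x * v) v x := fun x => by
    simpa using (((hasDerivAt_id x).ofReal_comp).mul_const v).const_add t₀
  have hEd : ∀ x : ℝ, HasDerivAt E (E x * (σ * v)) x := fun x => by
    have h1 : HasDerivAt (fun x : ℝ => σ * (x * v)) (σ * v) x := by
      simpa using ((((hasDerivAt_id x).ofReal_comp).mul_const v).const_mul σ)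
    refine (h1.cexp.const_mul q₀).congr_deriv ?_
    simp only [hE]; ring
  have hYd : ∀ x ∈ Set.Icc (0 : ℝ) 1, HasDerivAt Y
      ((v * (fieldQ a b d (Complex.exp (t₀ + x * v)) (Q (t₀ + x * v)) (P (t₀ + x * v)) /
        (Complex.exp (t₀ + x * v) - 1)) * E x - Q (t₀ + x * v) * (E x * (σ * v))) / E x ^ 2) x := by
    intro x hx
    obtain ⟨h1, h2, -, -⟩ := hpath x hx
    have := HasDerivAt.scomp (g₁ := Q) x (h.hasDerivAt_fst _ h2 h1) (hpathd x)
    exact this.div (hEd x) (hE0 x)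
  have hWd : ∀ x ∈ Set.Icc (0 : ℝ) 1, DifferentiableAt ℝ W x := by
    intro x hx
    obtain ⟨h1, h2, -, -⟩ := hpath x hx
    have hq := HasDerivAt.scomp (g₁ := Q) x (h.hasDerivAt_fst _ h2 h1) (hpathd x)
    have hp := HasDerivAt.scomp (g₁ := P) x (h.hasDerivAt_snd _ h2 h1) (hpathd x)
    exact (hq.mul hp).differentiableAt
  set N : ℝ := 8 * V with hN
  have hNpos : 0 < N := by positivity
  set F : ℝ → ℂ × ℂ := fun x => (Y x - 1, N * (W x - w₀)) with hF
  have hFd : ∀ x ∈ Set.Icc (0 : ℝ) 1, HasDerivAt F (deriv Y x, N * deriv W x) x := by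
    intro x hx
    exact ((hYd x hx).differentiableAt.hasDerivAt.sub_const 1).prodMk
      (((hWd x hx).hasDerivAt.sub_const w₀).const_mul (N : ℂ))
  have key := image_norm_le_of_norm_deriv_right_lt_deriv_boundary (f := F)
    (f' := fun x => (deriv Y x, N * deriv W x)) (a := 0) (b := 1) (B := fun x => β * x)
    (B' := fun _ => β)
    (fun x hx => (hFd x hx).continuousAt.continuousWithinAt)
    (fun x hx => (hFd x ⟨hx.1, hx.2.le⟩).hasDerivWithinAt)
    (by
      have h1 : Y 0 = 1 := by
        simp only [hY, hE]
        simp [hq₀def]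
        exact hq₀
      have h2 : W 0 = w₀ := by simp [hW, hw₀]
      simp [hF, h1, h2])
    (fun x => by simpa using (hasDerivAt_id x).const_mul β)
    ?_
  · intro x hx
    have h1 : ‖Y x - 1‖ ≤ ‖F x‖ := norm_fst_le (F x)
    have h2 := key hx
    have h3 : β * x ≤ β * 1 := by gcongr; exact hx.2
    exact h1.trans (h2.trans (by linarith))
  intro x hx hFx
  have hx' : x ∈ Set.Icc (0 : ℝ) 1 := ⟨hx.1, hx.2.le⟩
  obtain ⟨hB, hre, hg1, hg2⟩ := hpath x hx'
  have hβx : β * x ≤ β := by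
    have : β * x ≤ β * 1 := by gcongr; exact hx'.2
    linarith
  have hY1 : ‖Y x - 1‖ ≤ β := (norm_fst_le (F x)).trans (hFx.trans_le hβx)
  have hW1 : N * ‖W x - w₀‖ ≤ β := by
    have : ‖(N : ℂ) * (W x - w₀)‖ ≤ ‖F x‖ := norm_snd_le (F x)
    rw [norm_mul, Complex.norm_real, Real.norm_of_nonneg hNpos.le] at this
    exact this.trans (hFx.trans_le hβx)
  have hYup : ‖Y x‖ ≤ 3 / 2 := by
    have := norm_add_le (Y x - 1) 1
    rw [sub_add_cancel, norm_one] at this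
    linarith
  have hYlo : 1 / 2 ≤ ‖Y x‖ := by
    have := norm_sub_norm_le 1 (Y x)
    rw [norm_one, norm_sub_rev] at this
    linarith
  set t := t₀ + x * v with ht
  have hqY : Q t = Y x * E x := by
    simp only [hY]; rw [div_mul_cancel₀ _ (hE0 x)]
  have hYne : Y x ≠ 0 := norm_pos_iff.mp (by linarith)
  have hqne : Q t ≠ 0 := by rw [hqY]; exact mul_ne_zero hYne (hE0 x)
  have hqn : ‖Q t‖ ≤ 3 * δ := by
    rw [hqY, norm_mul, norm_mul]
    calc ‖Y x‖ * (‖q₀‖ * ‖Complex.exp (σ * (x * v))‖) ≤ 3 / 2 * (δ * 2) := by gcongr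
      _ = 3 * δ := by ring
  have hun : ‖Complex.exp t / Q t‖ ≤ 4 * δ := by
    have : Complex.exp t / Q t
        = Complex.exp t₀ / q₀ * Complex.exp ((1 - σ) * (x * v)) * (Y x)⁻¹ := by
      rw [hqY, ht, Complex.exp_add, show (1 - σ) * (x * v) = x * v - σ * (x * v) by ring,
        Complex.exp_sub]
      simp only [hE]
      have := Complex.exp_ne_zero (σ * (x * v))
      field_simp
    rw [this, norm_mul, norm_mul, norm_inv]
    have h2 : ‖Y x‖⁻¹ ≤ 2 := by
      rw [inv_le_comm₀ (by linarith) (by norm_num)]; linarith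
    calc _ ≤ δ * 2 * 2 := by gcongr
      _ = 4 * δ := by ring
  obtain ⟨b1, b2⟩ := hC (Complex.exp t) (Q t) (P t) hqne (by linarith)
  have hsum : ‖Q t‖ + ‖Complex.exp t / Q t‖ ≤ 7 * δ := by linarith
  have hWdef : Q t * P t = W x := rfl
  have hWw : ‖W x - w₀‖ ≤ β / N := by rw [le_div_iff₀ hNpos]; linarith
  have hWn : 1 + ‖W x‖ ≤ 2 * M := by
    have h1 := norm_add_le (W x - w₀) w₀
    rw [sub_add_cancel] at h1
    have h2 : 1 * ‖W x - w₀‖ ≤ N * ‖W x - w₀‖ := by gcongr; linarith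
    linarith
  rw [hWdef] at b1 b2
  have hdY : deriv Y x = Y x * v * ((fieldQ a b d (Complex.exp t) (Q t) (P t) /
      (Complex.exp t - 1) / Q t - exponent a b (W x)) + 2 * (W x - w₀)) := by
    rw [(hYd x hx').deriv, ← ht, hqY]
    have h1 := hE0 x
    rw [hσ]
    simp only [exponent]
    field_simp
    ring
  have hdW : deriv W x = v * (((Q t - Complex.exp t / Q t) * (W x) ^ 2
        - (a * (Q t - Complex.exp t / Q t) + (b - 1) * Q t + d * Q t) * (W x)
        + e * Q t) / (1 - Complex.exp t)) :=
    (HasDerivAt.scomp (g₁ := fun t => Q t * P t) x (h.hasDerivAt_mul hre hB hqne)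
      (hpathd x)).deriv
  have hv0 := norm_nonneg v
  refine max_lt ?_ ?_
  · show ‖deriv Y x‖ < β
    rw [hdY, norm_mul, norm_mul]
    have h1 : ‖fieldQ a b d (Complex.exp t) (Q t) (P t) /
      (Complex.exp t - 1) / Q t - exponent a b (W x) + 2 * (W x - w₀)‖
        ≤ C₀ * (7 * δ) * (2 * M) + 2 * (β / N) := by
      refine (norm_add_le _ _).trans (add_le_add (b1.trans (by gcongr)) ?_)
      rw [norm_mul, Complex.norm_ofNat]
      gcongr
    calc _ ≤ 3 / 2 * V * (C₀ * (7 * δ) * (2 * M) + 2 * (β / N)) := by gcongr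
      _ = 21 * C₀ * δ * V * M + 3 / 8 * β := by rw [hN]; field_simp; ring
      _ ≤ 21 * C₀ * δ * V ^ 2 * M ^ 2 + 3 / 8 * β := by
        gcongr
        · exact le_self_pow₀ hV1 two_ne_zero
        · exact le_self_pow₀ hM1 two_ne_zero
      _ < β := by
        have : 0 < δ * V ^ 2 * M ^ 2 := by positivity
        have : 0 < C₀ * (δ * V ^ 2 * M ^ 2) := by positivity
        have h8 : β = 14 * (δ * V ^ 2 * M ^ 2) + 240 * (C₀ * (δ * V ^ 2 * M ^ 2)) := by
          rw [hβdef]; ring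
        linarith
  · show ‖(N : ℂ) * deriv W x‖ < β
    rw [hdW, norm_mul, norm_mul, Complex.norm_real, Real.norm_of_nonneg hNpos.le]
    calc _ ≤ N * (V * (C₀ * (7 * δ) * (2 * M) ^ 2)) := by
          gcongr
          exact b2.trans (by gcongr)
      _ = 224 * (C₀ * (δ * V ^ 2 * M ^ 2)) := by rw [hN]; ring
      _ < β := by
        have : 0 < δ * V ^ 2 * M ^ 2 := by positivity
        have : 0 < C₀ * (δ * V ^ 2 * M ^ 2) := by positivity
        have h8 : β = 14 * (δ * V ^ 2 * M ^ 2) + 240 * (C₀ * (δ * V ^ 2 * M ^ 2)) := by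
          rw [hβdef]; ring
        linarith

theorem exists_forall_lt_mul_exp_le (C : ℝ) {c μ : ℝ} (hc : 0 < c) (hμ : 0 < μ) :
    ∃ S : ℝ, 0 < S ∧ ∀ s < -S, C * Real.exp (c * s) ≤ μ := by
  have h1 : Filter.Tendsto (fun s : ℝ => C * Real.exp (c * s)) Filter.atBot (nhds (C * 0)) :=
    (Real.tendsto_exp_atBot.comp (Filter.tendsto_id.const_mul_atBot hc)).const_mul C
  rw [mul_zero] at h1
  obtain ⟨S, hS⟩ := Filter.eventually_atBot.mp (h1.eventually (gt_mem_nhds hμ))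
  refine ⟨|S| + 1, by positivity, fun s hs => (hS s ?_).le⟩
  linarith [neg_abs_le S]

open MeasureTheory in
theorem exists_norm_lt_forall_segment_notMem {B : Set ℂ} (hB : B.Countable) {t₁ t₂ : ℂ}
    (h₁ : t₁ ∉ B) (h₂ : t₂ ∉ B) (v₁ v₂ : ℂ) {ρ : ℝ} (hρ : 0 < ρ) :
    ∃ ξ : ℂ, ‖ξ‖ < ρ ∧ ∀ x ∈ Set.Icc (0 : ℝ) 1,
      t₁ + x * (v₁ + ξ) ∉ B ∧ t₂ + x * (v₂ + ξ) ∉ B := by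
  have hnull : ∀ c v : ℂ, volume {ξ : ℂ | ξ + v ∈ Submodule.span ℝ {c}} = 0 := by
    intro c v
    have h1 : Submodule.span ℝ {c} ≠ ⊤ := by
      intro h
      have h2 := finrank_span_le_card (R := ℝ) ({c} : Set ℂ)
      rw [h, finrank_top, Complex.finrank_real_complex] at h2
      simp at h2
    have h3 := Measure.addHaar_submodule (volume : Measure ℂ) _ h1
    have h4 := measure_preimage_add_right (volume : Measure ℂ) v
      (Submodule.span ℝ {c} : Set ℂ)
    rw [h3] at h4
    exact h4
  set N : Set ℂ := ⋃ β ∈ B, ({ξ : ℂ | ξ + v₁ ∈ Submodule.span ℝ {β - t₁}} ∪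
    {ξ : ℂ | ξ + v₂ ∈ Submodule.span ℝ {β - t₂}}) with hN
  have hN0 : volume N = 0 := by
    rw [hN, measure_biUnion_null_iff hB]
    intro β _
    exact measure_union_null (hnull _ _) (hnull _ _)
  have hpos : volume (Metric.ball (0 : ℂ) ρ \ N) ≠ 0 := by
    rw [measure_sdiff_null hN0]
    exact (Metric.measure_ball_pos volume 0 hρ).ne'
  obtain ⟨ξ, hξ, hξN⟩ := nonempty_of_measure_ne_zero hpos
  have hseg : ∀ (t v : ℂ) (x : ℝ), t ∉ B → t + x * (v + ξ) ∈ B →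
      ξ + v ∈ Submodule.span ℝ {(t + x * (v + ξ)) - t} := by
    intro t v x ht hmem
    have hx : x ≠ 0 := by
      rintro rfl
      apply ht
      simpa using hmem
    rw [Submodule.mem_span_singleton]
    refine ⟨x⁻¹, ?_⟩
    have : (x : ℂ) ≠ 0 := by exact_mod_cast hx
    rw [Complex.real_smul]
    push_cast
    field_simp
    ring
  refine ⟨ξ, by simpa using hξ, fun x _ => ⟨fun hmem => hξN ?_, fun hmem => hξN ?_⟩⟩
  · exact Set.mem_biUnion hmem (Or.inl (hseg t₁ v₁ x h₁ hmem))
  · exact Set.mem_biUnion hmem (Or.inr (hseg t₂ v₂ x h₂ hmem))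

theorem exists_int_norm_sub_le {u : ℂ} {η : ℝ} (hη : η ≤ 1 / 2) (h : ‖Complex.exp u - 1‖ ≤ η) :
    ∃ n : ℤ, ‖u - n * (2 * Real.pi * Complex.I)‖ ≤ 3 / 2 * η := by
  have h1 : Complex.exp u = Complex.exp (Complex.log (Complex.exp u)) :=
    (Complex.exp_log (Complex.exp_ne_zero u)).symm
  obtain ⟨n, hn⟩ := Complex.exp_eq_exp_iff_exists_int.mp h1
  refine ⟨n, ?_⟩
  have h2 := Complex.norm_log_one_add_half_le_self (h.trans hη)
  rw [add_sub_cancel] at h2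
  have h3 : u - n * (2 * Real.pi * Complex.I) = Complex.log (Complex.exp u) := by
    nth_rewrite 1 [hn]; ring
  rw [h3]
  exact h2.trans (by gcongr)

variable {a b d e : ℂ} {B : Set ℂ} {Q P : ℂ → ℂ}

theorem IsFlow.exists_zone_bound (h : IsFlow a b d e B Q P) :
    ∃ C S : ℝ, 0 < C ∧ 0 < S ∧ ∀ t ∉ B, t.re < -S →
      Real.exp t.re ≤ 16 * ‖Q t‖ ^ 2 → ‖Q t‖ ^ 2 ≤ 16 * Real.exp t.re →
      Q t ≠ 0 ∧ ‖Q t‖ ≤ 4 * Real.exp (t.re / 2) ∧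
      ‖Complex.exp t / Q t‖ ≤ 4 * Real.exp (t.re / 2) ∧
      (1 + ‖Q t * P t‖) ^ 2 ≤ C * Real.exp (-(t.re / 16)) ∧
      (1 + ‖exponent a b (Q t * P t)‖) ^ 2 ≤ C * Real.exp (-(t.re / 16)) := by
  obtain ⟨C, S, hC, hS, hb⟩ := h.exists_apriori_bound (ε := 1 / 16) (by norm_num)
  obtain ⟨k, hk⟩ : ∃ k, k = 1 + ‖a + b - 1‖ := ⟨_, rfl⟩
  have hk0 : 1 ≤ k := by linarith [norm_nonneg (a + b - 1)]
  refine ⟨8 * k ^ 2 * (1 + C), S, by positivity, hS, fun t ht hre h1 h2 => ?_⟩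
  have hpos := Real.exp_pos t.re
  have hw := (hb t ht hre).2.2 (by linarith [sq_nonneg ‖Q t‖]) (by linarith)
  set r := Real.exp (t.re / 2) with hr
  have hr0 : 0 < r := Real.exp_pos _
  have hr2 : r ^ 2 = Real.exp t.re := exp_half_sq _
  rw [← hr2] at h1 h2
  have hlow : r ≤ 4 * ‖Q t‖ := by
    refine (pow_le_pow_iff_left₀ hr0.le (by positivity) two_ne_zero).mp ?_
    linarith [mul_pow 4 ‖Q t‖ 2]
  have hup : ‖Q t‖ ≤ 4 * r := by
    refine (pow_le_pow_iff_left₀ (norm_nonneg _) (by positivity) two_ne_zero).mp ?_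
    linarith [mul_pow 4 r 2]
  have hq : 0 < ‖Q t‖ := by linarith
  have hE : Real.exp (-(1 / 16) * t.re) = Real.exp (-(t.re / 16)) := by congr 1; ring
  rw [hE] at hw
  have hE1 : 1 ≤ Real.exp (-(t.re / 16)) := Real.one_le_exp (by linarith)
  set y := ‖Q t * P t‖ with hy
  have hy0 : 0 ≤ y := norm_nonneg _
  set E := Real.exp (-(t.re / 16)) with hEdef
  have hCE : 0 ≤ C * E := by positivity
  have hkk : 1 ≤ k ^ 2 := one_le_pow₀ hk0
  refine ⟨norm_pos_iff.mp hq, hup, ?_, ?_, ?_⟩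
  · rw [norm_div, Complex.norm_exp, ← hr2, div_le_iff₀ hq]
    nlinarith
  · have h3 : (1 + y) ^ 2 ≤ 2 * ((1 + C) * E) := by linarith [sq_nonneg (y - 1)]
    have h4 : 0 ≤ (1 + C) * E := by positivity
    nlinarith
  · have h3 : ‖exponent a b (Q t * P t)‖ ≤ 2 * y + (k - 1) := by
      refine (norm_sub_le _ _).trans ?_
      rw [norm_mul, Complex.norm_ofNat, hk]
      linarith
    have h5 : (1 + ‖exponent a b (Q t * P t)‖) ^ 2 ≤ (2 * y + k) ^ 2 :=
      pow_le_pow_left₀ (by positivity) (by linarith) 2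
    have h6 : (2 * y + k) ^ 2 ≤ 8 * y ^ 2 + 2 * k ^ 2 := by linarith [sq_nonneg (2 * y - k)]
    have h7 : 8 * y ^ 2 ≤ 8 * k ^ 2 * (C * E) := by nlinarith
    have h8 : 2 * k ^ 2 * 1 ≤ 8 * k ^ 2 * E := by gcongr; linarith
    linarith

theorem re_mul_exponent_shift (σ : ℂ) : ∃ s : ℤ, (s = 1 ∨ s = -1) ∧ ∃ τ : ℂ,
    ‖τ‖ ≤ 4 * Real.pi * (1 + ‖σ‖) ∧ τ.re ≤ 0 ∧ (σ * τ).re ≤ 0 ∧ ((1 - σ) * τ).re ≤ 0 ∧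
    (σ * (τ - s * (2 * Real.pi * Complex.I))).re ≤ 0 ∧
    ((1 - σ) * (τ - s * (2 * Real.pi * Complex.I))).re ≤ 0 := by
  obtain ⟨s, hs, hsb⟩ : ∃ s : ℤ, (s = 1 ∨ s = -1) ∧ (s : ℝ) * σ.im = |σ.im| := by
    rcases le_total 0 σ.im with h | h
    · exact ⟨1, Or.inl rfl, by rw [abs_of_nonneg h]; simp⟩
    · exact ⟨-1, Or.inr rfl, by rw [abs_of_nonpos h]; simp⟩
  have hs2 : (s : ℝ) * s = 1 := by rcases hs with rfl | rfl <;> norm_num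
  have hsabs : |(s : ℝ)| = 1 := by rcases hs with rfl | rfl <;> norm_num
  have hpi := Real.pi_pos
  set A := |σ.im| with hA
  have hA0 : 0 ≤ A := abs_nonneg _
  set τ : ℂ := ⟨-(2 * Real.pi * A), 2 * Real.pi * s * (1 - σ.re)⟩ with hτ
  have him : σ.im = s * A := by rw [← hsb, ← mul_assoc, hs2, one_mul]
  refine ⟨s, hs, τ, ?_, ?_, ?_, ?_, ?_, ?_⟩
  · refine (Complex.norm_le_abs_re_add_abs_im _).trans ?_
    have h1 : A ≤ ‖σ‖ := Complex.abs_im_le_norm σ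
    have h2 : |1 - σ.re| ≤ 1 + ‖σ‖ := by
      refine (abs_sub _ _).trans ?_
      rw [abs_one]
      linarith [Complex.abs_re_le_norm σ]
    simp only [hτ, abs_neg, abs_mul, abs_two, hsabs, abs_of_pos hpi, abs_of_nonneg hA0, mul_one]
    calc 2 * Real.pi * A + 2 * Real.pi * |1 - σ.re|
        ≤ 2 * Real.pi * ‖σ‖ + 2 * Real.pi * (1 + ‖σ‖) := by gcongr
      _ ≤ _ := by nlinarith
  · simp only [hτ]; nlinarith
  · have : (σ * τ).re = -(2 * Real.pi * A) * σ.re - (s * s) * (2 * Real.pi * A * (1 - σ.re)) := by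
      simp only [hτ, Complex.mul_re, him]; ring
    rw [this, hs2]
    nlinarith
  · have : ((1 - σ) * τ).re
        = -(2 * Real.pi * A) * (1 - σ.re) + (s * s) * (2 * Real.pi * A * (1 - σ.re)) := by
      simp only [hτ, Complex.mul_re, Complex.sub_re, Complex.sub_im, Complex.one_re,
        Complex.one_im, him]; ring
    rw [this, hs2]
    linarith
  · have : (σ * (τ - s * (2 * Real.pi * Complex.I))).re
        = -(2 * Real.pi * A) * σ.re + (s * s) * (2 * Real.pi * A * σ.re) := by
      simp [hτ, Complex.mul_re, him]; ring
    rw [this, hs2]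
    linarith
  · have : ((1 - σ) * (τ - s * (2 * Real.pi * Complex.I))).re
        = -(2 * Real.pi * A) * (1 - σ.re) - (s * s) * (2 * Real.pi * A * σ.re) := by
      simp [hτ, Complex.mul_re, him]; ring
    rw [this, hs2]
    nlinarith

variable {a b d e : ℂ} {B : Set ℂ} {Q P : ℂ → ℂ}

theorem norm_exp_mul_le_two {u : ℂ} {x : ℝ} (hx : x ∈ Set.Icc (0 : ℝ) 1) (hu : u.re ≤ 1 / 2) :
    ‖Complex.exp (x * u)‖ ≤ 2 := by
  rw [Complex.norm_exp, Complex.re_ofReal_mul]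
  have h1 : x * u.re ≤ 1 / 2 := by
    rcases le_total 0 u.re with h | h
    · nlinarith [hx.1, hx.2]
    · nlinarith [hx.1, hx.2]
  have h2 : Real.exp (1 / 2) ^ 2 = Real.exp 1 := exp_half_sq 1
  have h3 := Real.exp_one_lt_d9
  have h4 : Real.exp (1 / 2) ≤ 2 := by
    refine (pow_le_pow_iff_left₀ (Real.exp_pos _).le (by norm_num) two_ne_zero).mp ?_
    rw [h2]; linarith
  exact (Real.exp_le_exp.mpr h1).trans h4

theorem IsFlow.exists_zone_transport (h : IsFlow a b d e B Q P) :
    ∃ C S : ℝ, 0 < C ∧ 1 ≤ S ∧ ∀ t ∉ B, t.re < -S →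
      Real.exp t.re ≤ 16 * ‖Q t‖ ^ 2 → ‖Q t‖ ^ 2 ≤ 16 * Real.exp t.re →
      Q t ≠ 0 ∧ ∀ σ v : ℂ, σ = exponent a b (Q t * P t) → ‖v‖ ≤ 23 * (1 + ‖σ‖) →
        v.re ≤ 1 → (σ * v).re ≤ 1 / 2 → ((1 - σ) * v).re ≤ 1 / 2 →
        (∀ x ∈ Set.Icc (0 : ℝ) 1, t + x * v ∉ B) →
        ‖Q (t + v) / (Q t * Complex.exp (σ * v)) - 1‖ ≤ C * Real.exp (3 / 8 * t.re) ∧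
        ‖Q (t + v) / (Q t * Complex.exp (σ * v)) - 1‖ ≤ 1 / 8 := by
  obtain ⟨C₁, hC₁, hT⟩ := exists_norm_transport_le a b d e
  obtain ⟨C₂, S₂, hC₂, hS₂, hZ⟩ := h.exists_zone_bound
  obtain ⟨S₃, hS₃, hsmall⟩ := exists_forall_lt_mul_exp_le (C₁ * 4 * 576 * C₂ ^ 2)
    (c := 3 / 8) (μ := 1 / 8) (by norm_num) (by norm_num)
  refine ⟨C₁ * 4 * 576 * C₂ ^ 2, S₂ + S₃ + 1, by positivity, by linarith,
    fun t ht hre h1 h2 => ?_⟩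
  obtain ⟨hq, hz1, hz2, hz3, hz4⟩ := hZ t ht (by linarith) h1 h2
  refine ⟨hq, fun σ v hσ hv hvre hu1 hu2 hseg => ?_⟩
  have hsm := hsmall t.re (by linarith)
  have hβ : C₁ * (4 * Real.exp (t.re / 2)) * (1 + ‖v‖) ^ 2 * (1 + ‖Q t * P t‖) ^ 2 ≤
      C₁ * 4 * 576 * C₂ ^ 2 * Real.exp (3 / 8 * t.re) := by
    have h3 : (1 + ‖v‖) ^ 2 ≤ 576 * (C₂ * Real.exp (-(t.re / 16))) := by
      calc (1 + ‖v‖) ^ 2 ≤ (24 * (1 + ‖σ‖)) ^ 2 := by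
            refine pow_le_pow_left₀ (by positivity) ?_ 2
            linarith [norm_nonneg σ]
        _ = 576 * (1 + ‖σ‖) ^ 2 := by ring
        _ ≤ _ := by rw [hσ]; gcongr
    have h4 : Real.exp (3 / 8 * t.re) =
        Real.exp (t.re / 2) * Real.exp (-(t.re / 16)) * Real.exp (-(t.re / 16)) := by
      rw [← Real.exp_add, ← Real.exp_add]; congr 1; ring
    calc _ ≤ C₁ * (4 * Real.exp (t.re / 2)) * (576 * (C₂ * Real.exp (-(t.re / 16)))) *
          (C₂ * Real.exp (-(t.re / 16))) := by gcongr
      _ = _ := by rw [h4]; ring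
  have hfin := hT B Q P h t v σ (4 * Real.exp (t.re / 2)) hq hσ hz1 hz2 ?_ (by linarith) 1
    ⟨zero_le_one, le_rfl⟩
  · rw [Complex.ofReal_one, one_mul] at hfin
    exact ⟨hfin.trans hβ, hfin.trans (hβ.trans hsm)⟩
  · intro x hx
    refine ⟨hseg x hx, ?_, ?_, ?_⟩
    · rw [Complex.add_re, Complex.re_ofReal_mul]
      rcases le_total 0 v.re with h | h
      · nlinarith [hx.1, hx.2]
      · nlinarith [hx.1, hx.2]
    · rw [show σ * (x * v) = x * (σ * v) by ring]
      exact norm_exp_mul_le_two hx hu1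
    · rw [show (1 - σ) * (x * v) = x * ((1 - σ) * v) by ring]
      exact norm_exp_mul_le_two hx hu2

theorem IsFlow.periodic_int (h : IsFlow a b d e B Q P) {s : ℤ} (hs : s = 1 ∨ s = -1) (t : ℂ) :
    Q (t + s * (2 * Real.pi * Complex.I)) = Q t ∧ P (t + s * (2 * Real.pi * Complex.I)) = P t ∧
      (t + s * (2 * Real.pi * Complex.I) ∈ B ↔ t ∈ B) := by
  rcases hs with rfl | rfl
  · simpa using ⟨h.periodic_fst t, h.periodic_snd t, h.periodic_set t⟩
  · have h1 := h.periodic_fst (t + (-1 : ℤ) * (2 * Real.pi * Complex.I))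
    have h2 := h.periodic_snd (t + (-1 : ℤ) * (2 * Real.pi * Complex.I))
    have h3 := h.periodic_set (t + (-1 : ℤ) * (2 * Real.pi * Complex.I))
    have h4 : t + (-1 : ℤ) * (2 * Real.pi * Complex.I) + 2 * Real.pi * Complex.I = t := by
      push_cast; ring
    rw [h4] at h1 h2 h3
    exact ⟨h1.symm, h2.symm, h3.symm⟩

/-- In the intermediate zone the local exponent is almost an integer. -/
theorem IsFlow.exists_int_exponent (h : IsFlow a b d e B Q P) :
    ∃ C S : ℝ, 0 < C ∧ 1 ≤ S ∧ ∀ t ∉ B, t.re < -S →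
      Real.exp t.re ≤ 16 * ‖Q t‖ ^ 2 → ‖Q t‖ ^ 2 ≤ 16 * Real.exp t.re →
      ∃ n : ℤ, ‖exponent a b (Q t * P t) - n‖ ≤ C * Real.exp (3 / 8 * t.re) := by
  obtain ⟨C, S, hC, hS, hT⟩ := h.exists_zone_transport
  obtain ⟨S₃, hS₃, hsmall⟩ := exists_forall_lt_mul_exp_le C
    (c := 3 / 8) (μ := 1 / 8) (by norm_num) (by norm_num)
  refine ⟨C, S + S₃, hC, by linarith, fun t ht hre h1 h2 => ?_⟩
  have hsm := hsmall t.re (by linarith)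
  obtain ⟨hq, hT1⟩ := hT t ht (by linarith) h1 h2
  obtain ⟨σ, hσ⟩ : ∃ σ, σ = exponent a b (Q t * P t) := ⟨_, rfl⟩
  obtain ⟨s, hs, τ, hτn, hτ0, hτ1, hτ2, hτ3, hτ4⟩ := re_mul_exponent_shift σ
  set ω : ℂ := s * (2 * Real.pi * Complex.I) with hω
  obtain ⟨hp1, hp2, hp3⟩ := h.periodic_int hs t
  have hωre : ω.re = 0 := by
    rw [hω]; rcases hs with rfl | rfl <;> simp
  have ht' : t + ω ∉ B := fun hm => ht (hp3.mp hm)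
  have hre' : (t + ω).re = t.re := by rw [Complex.add_re, hωre, add_zero]
  obtain ⟨-, hT2⟩ := hT (t + ω) ht' (by rw [hre']; linarith) (by rw [hre', hp1]; exact h1)
    (by rw [hre', hp1]; exact h2)
  have hσ0 := norm_nonneg σ
  obtain ⟨ξ, hξ, hseg⟩ := exists_norm_lt_forall_segment_notMem h.countable ht ht' τ (τ - ω)
    (ρ := 1 / (10 * (1 + ‖σ‖))) (by positivity)
  have hξ' : ‖ξ‖ * (1 + ‖σ‖) ≤ 1 / 10 := by
    rw [lt_div_iff₀ (by positivity)] at hξ; linarith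
  have hξ0 := norm_nonneg ξ
  have hξ1 : ‖ξ‖ ≤ 1 := by nlinarith
  have hξre : ξ.re ≤ 1 := (Complex.re_le_norm ξ).trans hξ1
  have hσξ : (σ * ξ).re ≤ 1 / 2 := by
    refine (Complex.re_le_norm _).trans ?_
    rw [norm_mul]; nlinarith
  have hσξ' : ((1 - σ) * ξ).re ≤ 1 / 2 := by
    refine (Complex.re_le_norm _).trans ?_
    rw [norm_mul]
    have : ‖1 - σ‖ ≤ 1 + ‖σ‖ := (norm_sub_le _ _).trans (by simp)
    nlinarith
  have hpi := Real.pi_lt_d2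
  have hpi0 := Real.pi_pos
  have hωn : ‖ω‖ ≤ 2 * Real.pi := by
    have hpn : ‖(2 * Real.pi * Complex.I : ℂ)‖ = 2 * Real.pi := by simp [abs_of_pos hpi0]
    rw [hω, norm_mul, hpn]
    rcases hs with rfl | rfl <;> simp
  obtain ⟨hA, hA'⟩ := hT1 σ (τ + ξ) hσ
    ((norm_add_le _ _).trans (by nlinarith)) (by rw [Complex.add_re]; linarith)
    (by rw [mul_add, Complex.add_re]; linarith) (by rw [mul_add, Complex.add_re]; linarith)
    (fun x hx => (hseg x hx).1)
  obtain ⟨hD, -⟩ := hT2 σ (τ - ω + ξ) (by rw [hp1, hp2]; exact hσ)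
    (((norm_add_le _ _).trans (add_le_add_left (norm_sub_le _ _) _)).trans (by nlinarith))
    (by rw [Complex.add_re, Complex.sub_re]; linarith)
    (by rw [mul_add, Complex.add_re]; linarith) (by rw [mul_add, Complex.add_re]; linarith)
    (fun x hx => (hseg x hx).2)
  rw [hre', hp1, show t + ω + (τ - ω + ξ) = t + (τ + ξ) by ring] at hD
  set A := Q (t + (τ + ξ)) / (Q t * Complex.exp (σ * (τ + ξ))) with hAdef
  have hAD : Q (t + (τ + ξ)) / (Q t * Complex.exp (σ * (τ - ω + ξ))) =
      Complex.exp (s * σ * (2 * Real.pi * Complex.I)) * A := by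
    have h5 : Complex.exp (σ * (τ + ξ)) = Complex.exp (s * σ * (2 * Real.pi * Complex.I)) *
        Complex.exp (σ * (τ - ω + ξ)) := by
      rw [← Complex.exp_add, hω]; congr 1; ring
    rw [hAdef, h5]
    have := Complex.exp_ne_zero (s * σ * (2 * Real.pi * Complex.I))
    have := Complex.exp_ne_zero (σ * (τ - ω + ξ))
    field_simp
  rw [hAD] at hD
  set E := Complex.exp (s * σ * (2 * Real.pi * Complex.I)) with hE
  set β := C * Real.exp (3 / 8 * t.re) with hβ
  have hA1 : 7 / 8 ≤ ‖A‖ := by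
    have := norm_sub_norm_le (1 : ℂ) A
    rw [norm_one, norm_sub_rev] at this
    linarith
  have hE1 : ‖E - 1‖ ≤ 4 * β := by
    have h6 : ‖(E - 1) * A‖ ≤ 2 * β := by
      rw [show (E - 1) * A = (E * A - 1) - (A - 1) by ring]
      exact (norm_sub_le _ _).trans (by linarith)
    rw [norm_mul] at h6
    nlinarith [norm_nonneg (E - 1)]
  obtain ⟨n, hn⟩ := exists_int_norm_sub_le (by linarith) hE1
  refine ⟨s * n, ?_⟩
  rw [← hσ]
  have h7 : s * σ * (2 * Real.pi * Complex.I) - n * (2 * Real.pi * Complex.I) =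
      s * (2 * Real.pi * Complex.I) * (σ - (s * n : ℤ)) := by
    rcases hs with rfl | rfl <;> push_cast <;> ring
  have h8 : ‖(s * (2 * Real.pi * Complex.I) : ℂ)‖ = 2 * Real.pi := by
    rcases hs with rfl | rfl <;> simp [abs_of_pos hpi0]
  rw [h7, norm_mul, h8] at hn
  have hpi3 := Real.pi_gt_three
  nlinarith [norm_nonneg (σ - (s * n : ℤ))]

/-- In the intermediate zone `‖q‖` varies little along circles. -/
theorem IsFlow.exists_norm_circle_le (h : IsFlow a b d e B Q P) :
    ∃ S : ℝ, 1 ≤ S ∧ ∀ t : ℂ, (∀ β ∈ B, β.re ≠ t.re) → t.re < -S →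
      Real.exp t.re ≤ 16 * ‖Q t‖ ^ 2 → ‖Q t‖ ^ 2 ≤ 16 * Real.exp t.re →
      ∀ φ : ℝ, |φ| ≤ 2 * Real.pi →
        ‖Q t‖ ≤ 2 * ‖Q (t + φ * Complex.I)‖ ∧ ‖Q (t + φ * Complex.I)‖ ≤ 2 * ‖Q t‖ := by
  obtain ⟨C, S, hC, hS, hT⟩ := h.exists_zone_transport
  obtain ⟨C₂, S₂, hC₂, hS₂, hI⟩ := h.exists_int_exponent
  obtain ⟨S₃, hS₃, hsmall⟩ := exists_forall_lt_mul_exp_le C₂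
    (c := 3 / 8) (μ := 1 / 40) (by norm_num) (by norm_num)
  refine ⟨S + S₂ + S₃, by linarith, fun t hB hre h1 h2 φ hφ => ?_⟩
  have ht : t ∉ B := fun hm => hB t hm rfl
  have hsm := hsmall t.re (by linarith)
  obtain ⟨hq, hT1⟩ := hT t ht (by linarith) h1 h2
  obtain ⟨n, hn⟩ := hI t ht (by linarith) h1 h2
  obtain ⟨σ, hσ⟩ : ∃ σ, σ = exponent a b (Q t * P t) := ⟨_, rfl⟩
  rw [← hσ] at hn
  have him : |σ.im| ≤ 1 / 40 := by
    have := (Complex.abs_im_le_norm (σ - n)).trans (hn.trans hsm)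
    simpa using this
  have hpi := Real.pi_lt_d2
  have hpi0 := Real.pi_pos
  have hprod : |φ * σ.im| ≤ 1 / 4 := by
    rw [abs_mul]
    nlinarith [abs_nonneg φ, abs_nonneg σ.im]
  obtain ⟨hp1, hp2⟩ := abs_le.mp hprod
  have hre1 : (σ * (φ * Complex.I)).re = -(φ * σ.im) := by simp; ring
  have hre2 : ((1 - σ) * (φ * Complex.I)).re = φ * σ.im := by simp; ring
  obtain ⟨-, hA⟩ := hT1 σ (φ * Complex.I) hσ
    (by rw [norm_mul, Complex.norm_I, mul_one, Complex.norm_real, Real.norm_eq_abs]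
        nlinarith [norm_nonneg σ])
    (by simp) (by rw [hre1]; linarith) (by rw [hre2]; linarith)
    (fun x _ hm => hB _ hm (by simp))
  have hQ0 : 0 < ‖Q t‖ := norm_pos_iff.mpr hq
  have hE : ‖Complex.exp (σ * (φ * Complex.I))‖ = Real.exp (-(φ * σ.im)) := by
    rw [Complex.norm_exp, hre1]
  set E := Real.exp (-(φ * σ.im)) with hEdef
  have hEpos : 0 < E := Real.exp_pos _
  have hEl : 3 / 4 ≤ E := by
    have := Real.add_one_le_exp (-(φ * σ.im)); linarith
  have hEu : E ≤ 4 / 3 := by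
    have h3 := Real.add_one_le_exp (φ * σ.im)
    have h4 : E * Real.exp (φ * σ.im) = 1 := by rw [hEdef, ← Real.exp_add]; simp
    nlinarith
  set A := Q (t + φ * Complex.I) / (Q t * Complex.exp (σ * (φ * Complex.I))) with hAdef
  have hAQ : ‖Q (t + φ * Complex.I)‖ = ‖A‖ * (‖Q t‖ * E) := by
    rw [← hE, ← norm_mul, ← norm_mul, hAdef, div_mul_cancel₀]
    exact mul_ne_zero hq (Complex.exp_ne_zero _)
  have hA1 : 7 / 8 ≤ ‖A‖ := by
    have := norm_sub_norm_le (1 : ℂ) A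
    rw [norm_one, norm_sub_rev] at this
    linarith
  have hA2 : ‖A‖ ≤ 9 / 8 := by
    have := norm_sub_norm_le A (1 : ℂ)
    rw [norm_one] at this
    linarith
  rw [hAQ]
  have hAE1 : 1 / 2 ≤ ‖A‖ * E := by nlinarith
  have hAE2 : ‖A‖ * E ≤ 2 := by nlinarith
  constructor
  · nlinarith
  · nlinarith

/-- A function whose zeros carry integers which shrink from each zero to the previous one has
only finitely many zeros towards `-∞`. -/
theorem exists_forall_lt_sign (g g' : ℝ → ℝ) (n : ℝ → ℤ) (S : ℝ)
    (hg : ∀ s < -S, HasDerivAt g (g' s) s)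
    (hneg : ∀ s < -S, g s = 0 → n s ≤ 0 → g' s < 0)
    (hpos : ∀ s < -S, g s = 0 → 1 ≤ n s → 0 < g' s)
    (hup : ∀ s₂ s₁, s₂ < s₁ → s₁ < -S → g s₂ = 0 → g s₁ = 0 →
      (∀ s ∈ Set.Icc s₂ s₁, 0 ≤ g s) → n s₂ ^ 2 = n s₁ ^ 2)
    (hdown : ∀ s₂ s₁, s₂ < s₁ → s₁ < -S → g s₂ = 0 → g s₁ = 0 →
      (∀ s ∈ Set.Icc s₂ s₁, g s ≤ 0) → (n s₂ - 1) ^ 2 = (n s₁ - 1) ^ 2) :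
    ∃ S' : ℝ, S ≤ S' ∧ ((∀ s < -S', 0 < g s) ∨ (∀ s < -S', g s < 0)) := by
  have hcont : ∀ s < -S, ContinuousAt g s := fun s hs => (hg s hs).continuousAt
  have hcontOn : ∀ x y, y < -S → ContinuousOn g (Set.Icc x y) := fun x y hy s hs =>
    (hcont s (hs.2.trans_lt hy)).continuousWithinAt
  have hsame : ∀ x y, x ≤ y → y < -S → (∀ s ∈ Set.Icc x y, g s ≠ 0) → (0 < g x ↔ 0 < g y) := by
    intro x y hxy hy hne
    constructor
    · intro hx
      by_contra hcon
      obtain ⟨s, hs, hs0⟩ := intermediate_value_Icc' hxy (hcontOn x y hy)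
        ⟨not_lt.mp hcon, hx.le⟩
      exact hne s hs hs0
    · intro hx
      by_contra hcon
      obtain ⟨s, hs, hs0⟩ := intermediate_value_Icc hxy (hcontOn x y hy)
        ⟨not_lt.mp hcon, hx.le⟩
      exact hne s hs hs0
  have hbase : ∀ s₁ ≤ -S, (∀ s < s₁, g s ≠ 0) →
      ∃ S' : ℝ, S ≤ S' ∧ ((∀ s < -S', 0 < g s) ∨ (∀ s < -S', g s < 0)) := by
    intro s₁ hs₁ hne
    refine ⟨-(s₁ - 1), by linarith, ?_⟩
    have key : ∀ s < s₁ - 1, (0 < g s ↔ 0 < g (s₁ - 1)) := fun s hs =>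
      hsame s (s₁ - 1) hs.le (by linarith) fun x hx => hne x (by linarith [hx.2])
    by_cases h : 0 < g (s₁ - 1)
    · exact Or.inl fun s hs => (key s (by linarith)).mpr h
    · refine Or.inr fun s hs => lt_of_le_of_ne (not_lt.mp fun h2 => h ?_) (hne s (by linarith))
      exact (key s (by linarith)).mp h2
  have hleft_pos : ∀ s < -S, g s = 0 → n s ≤ 0 →
      ∃ ρ > 0, (∀ x, s - ρ < x → x < s → 0 < g x) ∧ ∀ x, s < x → x < s + ρ → g x < 0 := by
    intro s hs h0 hn
    have h1 := eventually_nhdsWithin_sign_eq_of_deriv_neg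
      (by rw [(hg s hs).deriv]; exact hneg s hs h0 hn) h0
    obtain ⟨ρ, hρ, h2⟩ := Metric.eventually_nhds_iff.mp h1
    refine ⟨ρ, hρ, fun x h3 h4 => ?_, fun x h3 h4 => ?_⟩
    · have h5 := h2 (y := x) (by rw [Real.dist_eq, abs_lt]; constructor <;> linarith)
      rw [sign_pos (by linarith : (0 : ℝ) < s - x)] at h5
      exact sign_eq_one_iff.mp h5
    · have h5 := h2 (y := x) (by rw [Real.dist_eq, abs_lt]; constructor <;> linarith)
      rw [sign_neg (by linarith : s - x < (0 : ℝ))] at h5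
      exact sign_eq_neg_one_iff.mp h5
  have hleft_neg : ∀ s < -S, g s = 0 → 1 ≤ n s →
      ∃ ρ > 0, (∀ x, s - ρ < x → x < s → g x < 0) ∧ ∀ x, s < x → x < s + ρ → 0 < g x := by
    intro s hs h0 hn
    have h1 := eventually_nhdsWithin_sign_eq_of_deriv_pos
      (by rw [(hg s hs).deriv]; exact hpos s hs h0 hn) h0
    obtain ⟨ρ, hρ, h2⟩ := Metric.eventually_nhds_iff.mp h1
    refine ⟨ρ, hρ, fun x h3 h4 => ?_, fun x h3 h4 => ?_⟩
    · have h5 := h2 (y := x) (by rw [Real.dist_eq, abs_lt]; constructor <;> linarith)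
      rw [sign_neg (by linarith : x - s < (0 : ℝ))] at h5
      exact sign_eq_neg_one_iff.mp h5
    · have h5 := h2 (y := x) (by rw [Real.dist_eq, abs_lt]; constructor <;> linarith)
      rw [sign_pos (by linarith : (0 : ℝ) < x - s)] at h5
      exact sign_eq_one_iff.mp h5
  have hind : ∀ m : ℕ, ∀ s₁ < -S, g s₁ = 0 → (2 * n s₁ - 1).natAbs = m →
      ∃ S' : ℝ, S ≤ S' ∧ ((∀ s < -S', 0 < g s) ∨ (∀ s < -S', g s < 0)) := by
    intro m
    induction m using Nat.strong_induction_on with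
    | _ m ih =>
      intro s₁ hs₁ h0 hm
      by_cases hz : ∀ s < s₁, g s ≠ 0
      · exact hbase s₁ hs₁.le hz
      push Not at hz
      obtain ⟨z₀, hz₀, hz₀'⟩ := hz
      set Z : Set ℝ := {s | s < s₁ ∧ g s = 0} with hZ
      have hZne : Z.Nonempty := ⟨z₀, hz₀, hz₀'⟩
      have hZbdd : BddAbove Z := ⟨s₁, fun s hs => hs.1.le⟩
      set s₂ := sSup Z with hs₂
      have hs₂le : s₂ ≤ s₁ := csSup_le hZne fun s hs => hs.1.le
      have hs₂0 : g s₂ = 0 := by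
        have hmem := csSup_mem_closure hZne hZbdd
        have hfreq : ∃ᶠ s in nhds s₂, g s = 0 :=
          (mem_closure_iff_frequently.mp hmem).mono fun s hs => hs.2
        by_contra hne
        exact hfreq ((hcont s₂ (hs₂le.trans_lt hs₁)).eventually_ne hne)
      have hleft : ∃ ρ > 0, ∀ x, s₁ - ρ < x → x < s₁ → g x ≠ 0 := by
        rcases le_or_gt (n s₁) 0 with h | h
        · obtain ⟨ρ, hρ, h1, -⟩ := hleft_pos s₁ hs₁ h0 h
          exact ⟨ρ, hρ, fun x hx hx' => (h1 x hx hx').ne'⟩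
        · obtain ⟨ρ, hρ, h1, -⟩ := hleft_neg s₁ hs₁ h0 h
          exact ⟨ρ, hρ, fun x hx hx' => (h1 x hx hx').ne⟩
      obtain ⟨ρ, hρ, hρne⟩ := hleft
      have hlt : s₂ < s₁ := by
        have : s₂ ≤ s₁ - ρ := csSup_le hZne fun s hs => by
          by_contra hcon
          exact hρne s (not_le.mp hcon) hs.1 hs.2
        linarith
      have hne : ∀ x, s₂ < x → x < s₁ → g x ≠ 0 := fun x hx hx' hx0 =>
        absurd (le_csSup hZbdd ⟨hx', hx0⟩) (not_le.mpr hx)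
      have hs₂S := hlt.trans hs₁
      have hsign : ∀ x y, s₂ < x → x < s₁ → s₂ < y → y < s₁ → (0 < g x ↔ 0 < g y) := by
        intro x y hx hx' hy hy'
        rcases le_total x y with h | h
        · exact hsame x y h (by linarith) fun s hs =>
            hne s (by linarith [hs.1]) (by linarith [hs.2])
        · exact (hsame y x h (by linarith) fun s hs =>
            hne s (by linarith [hs.1]) (by linarith [hs.2])).symm
      rcases le_or_gt (n s₁) 0 with h | h
      · obtain ⟨ρ₁, hρ₁, h1, -⟩ := hleft_pos s₁ hs₁ h0 h
        have hx : ∃ x, s₂ < x ∧ x < s₁ ∧ 0 < g x := by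
          obtain ⟨x, hx1, hx2⟩ := exists_between (max_lt (by linarith : s₁ - ρ₁ < s₁) hlt)
          exact ⟨x, (le_max_right _ _).trans_lt hx1, hx2,
            h1 x ((le_max_left _ _).trans_lt hx1) hx2⟩
        obtain ⟨x, hx1, hx2, hx3⟩ := hx
        have hall : ∀ y, s₂ < y → y < s₁ → 0 < g y := fun y hy hy' =>
          (hsign x y hx1 hx2 hy hy').mp hx3
        have hsq := hup s₂ s₁ hlt hs₁ hs₂0 h0 fun s hs => by
          rcases eq_or_lt_of_le hs.1 with rfl | h1
          · exact hs₂0.ge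
          rcases eq_or_lt_of_le hs.2 with rfl | h2
          · exact h0.ge
          exact (hall s h1 h2).le
        have hn2 : 1 ≤ n s₂ := by
          by_contra hcon
          obtain ⟨ρ₂, hρ₂, -, h2⟩ := hleft_pos s₂ hs₂S hs₂0 (by omega)
          obtain ⟨y, hy1, hy2⟩ := exists_between (lt_min (by linarith : s₂ < s₂ + ρ₂) hlt)
          exact lt_asymm (h2 y hy1 (hy2.trans_le (min_le_left _ _)))
            (hall y hy1 (hy2.trans_le (min_le_right _ _)))
        have hn : n s₂ = -n s₁ := by
          rcases sq_eq_sq_iff_eq_or_eq_neg.mp hsq with h3 | h3 <;> omega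
        exact ih _ (by omega) s₂ hs₂S hs₂0 rfl
      · obtain ⟨ρ₁, hρ₁, h1, -⟩ := hleft_neg s₁ hs₁ h0 h
        have hx : ∃ x, s₂ < x ∧ x < s₁ ∧ g x < 0 := by
          obtain ⟨x, hx1, hx2⟩ := exists_between (max_lt (by linarith : s₁ - ρ₁ < s₁) hlt)
          exact ⟨x, (le_max_right _ _).trans_lt hx1, hx2,
            h1 x ((le_max_left _ _).trans_lt hx1) hx2⟩
        obtain ⟨x, hx1, hx2, hx3⟩ := hx
        have hall : ∀ y, s₂ < y → y < s₁ → g y < 0 := fun y hy hy' =>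
          lt_of_le_of_ne (not_lt.mp fun hcon =>
            lt_asymm hx3 ((hsign x y hx1 hx2 hy hy').mpr hcon)) (hne y hy hy')
        have hsq := hdown s₂ s₁ hlt hs₁ hs₂0 h0 fun s hs => by
          rcases eq_or_lt_of_le hs.1 with rfl | h1
          · exact hs₂0.le
          rcases eq_or_lt_of_le hs.2 with rfl | h2
          · exact h0.le
          exact (hall s h1 h2).le
        have hn2 : n s₂ ≤ 0 := by
          by_contra hcon
          obtain ⟨ρ₂, hρ₂, -, h2⟩ := hleft_neg s₂ hs₂S hs₂0 (by omega)
          obtain ⟨y, hy1, hy2⟩ := exists_between (lt_min (by linarith : s₂ < s₂ + ρ₂) hlt)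
          exact lt_asymm (h2 y hy1 (hy2.trans_le (min_le_left _ _)))
            (hall y hy1 (hy2.trans_le (min_le_right _ _)))
        have hn : n s₂ - 1 = -(n s₁ - 1) := by
          rcases sq_eq_sq_iff_eq_or_eq_neg.mp hsq with h3 | h3 <;> omega
        exact ih _ (by omega) s₂ hs₂S hs₂0 rfl
  by_cases hz : ∀ s < -S, g s ≠ 0
  · exact hbase (-S) le_rfl hz
  · push Not at hz
    obtain ⟨s₁, hs₁, h0⟩ := hz
    exact hind _ s₁ hs₁ h0 rfl

variable {a b d e : ℂ} {B : Set ℂ} {Q P : ℂ → ℂ}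

theorem exists_norm_energy_sub_le (a b d e : ℂ) : ∃ C : ℝ, 0 < C ∧ ∀ (z q p : ℂ) (δ : ℝ), q ≠ 0 →
    ‖q‖ ≤ δ → ‖z / q‖ ≤ δ → ‖z‖ ≤ δ →
    ‖4 * energyA a b d e z q p - ((a + b - 1) ^ 2 - exponent a b (q * p) ^ 2)‖
      ≤ C * δ * (1 + ‖q * p‖) ^ 2 ∧
    ‖4 * energyB a b d e z q p - ((a + b) ^ 2 - (exponent a b (q * p) - 1) ^ 2)‖
      ≤ C * δ * (1 + ‖q * p‖) ^ 2 := by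
  obtain ⟨k, hk⟩ : ∃ k, k = 2 + ‖a‖ + ‖b - 1‖ + ‖d‖ + ‖e‖ := ⟨_, rfl⟩
  have ha := norm_nonneg a
  have hb := norm_nonneg (b - 1)
  have hd := norm_nonneg d
  have he := norm_nonneg e
  have hk0 : 0 < k := by linarith
  refine ⟨40 * k, by positivity, fun z q p δ hq h1 h2 h3 => ?_⟩
  obtain ⟨u, hu⟩ : ∃ u, u = z / q := ⟨_, rfl⟩
  obtain ⟨w, hw⟩ : ∃ w, w = q * p := ⟨_, rfl⟩
  have hzu : z = u * q := by rw [hu]; field_simp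
  rw [← hu] at h2
  have hδ : 0 ≤ δ := (norm_nonneg z).trans h3
  set m := q + u - z with hm
  have hmn : ‖m‖ ≤ 3 * δ := by
    refine (norm_sub_le _ _).trans ?_
    linarith [norm_add_le q u]
  have hqz : ‖q - z‖ ≤ 2 * δ := (norm_sub_le _ _).trans (by linarith)
  set N := m * w ^ 2 - (a * m + (b - 1) * q + d * (q - z)) * w + e * (q - z) with hN
  have hA : 4 * energyA a b d e z q p - ((a + b - 1) ^ 2 - exponent a b (q * p) ^ 2) =
      4 * N := by
    rw [hN, hm, hzu, hw]; simp only [energyA, exponent]; ring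
  have hB : 4 * energyB a b d e z q p - ((a + b) ^ 2 - (exponent a b (q * p) - 1) ^ 2) =
      4 * N - 4 * (z * w) := by
    rw [hN, hm, hzu, hw]; simp only [energyA, energyB, exponent]; ring
  rw [hA, hB, ← hw]
  set y := ‖w‖ with hy
  have hy0 : 0 ≤ y := norm_nonneg _
  have hNn : ‖N‖ ≤ 3 * δ * y ^ 2 + (‖a‖ * (3 * δ) + ‖b - 1‖ * δ + ‖d‖ * (2 * δ)) * y +
      ‖e‖ * (2 * δ) := by
    refine (norm_add_le _ _).trans (add_le_add ((norm_sub_le _ _).trans (add_le_add ?_ ?_)) ?_)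
    · rw [norm_mul, norm_pow]; gcongr
    · rw [norm_mul]
      gcongr
      refine (norm_add₃_le).trans ?_
      simp only [norm_mul]
      gcongr
    · rw [norm_mul]; gcongr
  have hδk : 0 ≤ δ * k := by positivity
  have hNk : ‖N‖ ≤ 9 * (k * δ) * (1 + y) ^ 2 := by
    have t1 : 3 * δ * y ^ 2 ≤ 3 * (k * δ) * y ^ 2 := by
      gcongr
      nlinarith
    have t2 : (‖a‖ * (3 * δ) + ‖b - 1‖ * δ + ‖d‖ * (2 * δ)) ≤ 3 * (k * δ) := by
      rw [hk]; nlinarith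
    have t3 : (‖a‖ * (3 * δ) + ‖b - 1‖ * δ + ‖d‖ * (2 * δ)) * y ≤ 3 * (k * δ) * y := by gcongr
    have t4 : ‖e‖ * (2 * δ) ≤ 3 * (k * δ) := by rw [hk]; nlinarith
    nlinarith [mul_nonneg hδk hy0, mul_nonneg hδk (sq_nonneg y)]
  have hzw : ‖z * w‖ ≤ (k * δ) * (1 + y) ^ 2 := by
    rw [norm_mul]
    have t1 : ‖z‖ ≤ k * δ := by nlinarith
    have t2 : y ≤ (1 + y) ^ 2 := by nlinarith
    gcongr
  have h4 : ‖(4 : ℂ)‖ = 4 := by norm_num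
  constructor
  · rw [norm_mul, h4]
    nlinarith [mul_nonneg hδk (sq_nonneg (1 + y))]
  · refine (norm_sub_le _ _).trans ?_
    rw [norm_mul 4, norm_mul 4, h4]
    linarith

/-- The integer attached to a point where `‖q‖² = ‖z‖`. -/
theorem IsFlow.exists_int_crossing (h : IsFlow a b d e B Q P) :
    ∃ S : ℝ, 1 ≤ S ∧ ∀ t ∉ B, t.re < -S → ‖Q t‖ ^ 2 = Real.exp t.re →
      Q t ≠ 0 ∧ ∃ n : ℤ,
        ‖fieldQ a b d (Complex.exp t) (Q t) (P t) / (Complex.exp t - 1) / Q t - n‖ ≤ 1 / 8 ∧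
        ‖4 * energyA a b d e (Complex.exp t) (Q t) (P t) - ((a + b - 1) ^ 2 - n ^ 2)‖ ≤ 1 / 8 ∧
        ‖4 * energyB a b d e (Complex.exp t) (Q t) (P t) - ((a + b) ^ 2 - (n - 1) ^ 2)‖
          ≤ 1 / 8 := by
  obtain ⟨C₁, hC₁, hE⟩ := exists_norm_energy_sub_le a b d e
  obtain ⟨C₂, S₂, hC₂, hS₂, hZ⟩ := h.exists_zone_bound
  obtain ⟨C₃, S₃, hC₃, hS₃, hI⟩ := h.exists_int_exponent
  obtain ⟨C₄, hC₄, hL⟩ := exists_norm_logDeriv_le a b d e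
  obtain ⟨S₅, hS₅, hs5⟩ := exists_forall_lt_mul_exp_le (C₁ * 4 * C₂)
    (c := 7 / 16) (μ := 1 / 16) (by norm_num) (by norm_num)
  obtain ⟨S₆, hS₆, hs6⟩ := exists_forall_lt_mul_exp_le (C₄ * 8 * C₂)
    (c := 7 / 16) (μ := 1 / 16) (by norm_num) (by norm_num)
  obtain ⟨S₇, hS₇, hs7⟩ := exists_forall_lt_mul_exp_le (3 * C₃ * C₂)
    (c := 5 / 16) (μ := 1 / 16) (by norm_num) (by norm_num)
  obtain ⟨S₈, hS₈, hs8⟩ := exists_forall_lt_mul_exp_le C₃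
    (c := 3 / 8) (μ := 1 / 16) (by norm_num) (by norm_num)
  obtain ⟨S₉, hS₉, hs9⟩ := exists_forall_lt_mul_exp_le 8
    (c := 1 / 2) (μ := 1 / 2) (by norm_num) (by norm_num)
  refine ⟨S₂ + S₃ + S₅ + S₆ + S₇ + S₈ + S₉, by linarith, fun t ht hre hcr => ?_⟩
  have hpos := Real.exp_pos t.re
  obtain ⟨hq, hz1, hz2, hz3, hz4⟩ := hZ t ht (by linarith) (by linarith) (by linarith)
  obtain ⟨n, hn⟩ := hI t ht (by linarith) (by linarith) (by linarith)
  have k5 := hs5 t.re (by linarith)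
  have k6 := hs6 t.re (by linarith)
  have k7 := hs7 t.re (by linarith)
  have k8 := hs8 t.re (by linarith)
  have k9 := hs9 t.re (by linarith)
  rw [show (1 : ℝ) / 2 * t.re = t.re / 2 by ring] at k9
  set y := ‖Q t * P t‖ with hy
  have hy0 : 0 ≤ y := norm_nonneg _
  set r := Real.exp (t.re / 2) with hr
  have hr0 : 0 < r := Real.exp_pos _
  have hr1 : r ^ 2 = Real.exp t.re := exp_half_sq _
  have hzn : ‖Complex.exp t‖ ≤ 4 * r := by
    rw [Complex.norm_exp, ← hr1]; nlinarith
  have hrE : r * Real.exp (-(t.re / 16)) = Real.exp (7 / 16 * t.re) := by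
    rw [hr, ← Real.exp_add]; congr 1; ring
  have hEE : Real.exp (3 / 8 * t.re) * Real.exp (-(t.re / 16)) = Real.exp (5 / 16 * t.re) := by
    rw [← Real.exp_add]; congr 1; ring
  obtain ⟨hA, hK⟩ := hE (Complex.exp t) (Q t) (P t) (4 * r) hq hz1 hz2 hzn
  have hAb : C₁ * (4 * r) * (1 + y) ^ 2 ≤ 1 / 16 := by
    calc _ ≤ C₁ * (4 * r) * (C₂ * Real.exp (-(t.re / 16))) := by gcongr
      _ = C₁ * 4 * C₂ * Real.exp (7 / 16 * t.re) := by rw [← hrE]; ring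
      _ ≤ _ := k5
  obtain ⟨hl, -⟩ := hL (Complex.exp t) (Q t) (P t) hq (by linarith)
  have hlb : C₄ * (‖Q t‖ + ‖Complex.exp t / Q t‖) * (1 + y) ≤ 1 / 16 := by
    calc _ ≤ C₄ * (4 * r + 4 * r) * (1 + y) ^ 2 := by gcongr; nlinarith
      _ ≤ C₄ * (4 * r + 4 * r) * (C₂ * Real.exp (-(t.re / 16))) := by gcongr
      _ = C₄ * 8 * C₂ * Real.exp (7 / 16 * t.re) := by rw [← hrE]; ring
      _ ≤ _ := k6
  set σ := exponent a b (Q t * P t) with hσ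
  have hn' := hn.trans k8
  have hprod : ∀ c : ℂ, ‖c‖ ≤ 1 → ‖(σ - n) * (2 * σ - (σ - n) - 2 * c)‖ ≤ 1 / 16 := by
    intro c hc
    have h1 : ‖2 * σ - (σ - n) - 2 * c‖ ≤ 3 * (1 + ‖σ‖) ^ 2 := by
      refine (norm_sub_le _ _).trans ?_
      have := norm_sub_le (2 * σ) (σ - n)
      rw [norm_mul, Complex.norm_ofNat] at this
      rw [norm_mul 2 c, Complex.norm_ofNat]
      have hs1 : 1 + ‖σ‖ ≤ (1 + ‖σ‖) ^ 2 :=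
        le_self_pow₀ (by linarith [norm_nonneg σ]) two_ne_zero
      linarith [norm_nonneg σ]
    rw [norm_mul]
    calc _ ≤ (C₃ * Real.exp (3 / 8 * t.re)) * (3 * (C₂ * Real.exp (-(t.re / 16)))) := by
          refine mul_le_mul hn (h1.trans ?_) (norm_nonneg _) (by positivity)
          gcongr
      _ = 3 * C₃ * C₂ * Real.exp (5 / 16 * t.re) := by rw [← hEE]; ring
      _ ≤ _ := k7
  refine ⟨hq, n, ?_, ?_, ?_⟩
  · have := norm_add_le (fieldQ a b d (Complex.exp t) (Q t) (P t) / (Complex.exp t - 1) / Q t - σ)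
      (σ - n)
    rw [sub_add_sub_cancel] at this
    linarith
  · have h1 := hprod 0 (by simp)
    have := norm_sub_le (4 * energyA a b d e (Complex.exp t) (Q t) (P t) -
      ((a + b - 1) ^ 2 - σ ^ 2)) ((σ - n) * (2 * σ - (σ - n) - 2 * 0))
    calc _ = _ := by congr 1; ring
      _ ≤ _ := this
      _ ≤ _ := by linarith
  · have h1 := hprod 1 (by simp)
    have := norm_sub_le (4 * energyB a b d e (Complex.exp t) (Q t) (P t) -
      ((a + b) ^ 2 - (σ - 1) ^ 2)) ((σ - n) * (2 * σ - (σ - n) - 2 * 1))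
    calc _ = _ := by congr 1; ring
      _ ≤ _ := this
      _ ≤ _ := by linarith

theorem norm_sub_le_of_deriv_le_exp {f f' : ℝ → ℂ} {K c x y : ℝ} (hc : 0 < c) (hxy : x ≤ y)
    (hf : ∀ s ∈ Set.Icc x y, HasDerivAt f (f' s) s)
    (hK : ∀ s ∈ Set.Icc x y, ‖f' s‖ ≤ K * Real.exp (c * s)) (hK0 : 0 ≤ K) :
    ‖f y - f x‖ ≤ K / c * Real.exp (c * y) := by
  have hb : ∀ s, HasDerivAt (fun s => K / c * (Real.exp (c * s) - Real.exp (c * x)))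
      (K * Real.exp (c * s)) s := by
    intro s
    have h1 := ((((hasDerivAt_id s).const_mul c).exp).sub_const (Real.exp (c * x))).const_mul (K / c)
    refine h1.congr_deriv ?_
    simp only [id]
    field_simp
  have h2 := image_norm_le_of_norm_deriv_right_le_deriv_boundary (f := fun s => f s - f x)
    (f' := f') (fun s hs => ((hf s hs).sub_const _).continuousAt.continuousWithinAt)
    (fun s hs => ((hf s ⟨hs.1, hs.2.le⟩).sub_const _).hasDerivWithinAt)
    (by simp) hb (fun s hs => hK s ⟨hs.1, hs.2.le⟩) (Set.right_mem_Icc.mpr hxy)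
  refine h2.trans ?_
  have := Real.exp_pos (c * x)
  gcongr
  linarith

variable {a b d e : ℂ} {B : Set ℂ} {Q P : ℂ → ℂ}

theorem hasDerivAt_ray {f : ℂ → ℂ} {f' : ℂ} {s θ : ℝ}
    (hf : HasDerivAt f f' (s + θ * Complex.I)) :
    HasDerivAt (fun x : ℝ => f (x + θ * Complex.I)) f' s :=
  (HasDerivAt.comp_add_const (s : ℂ) (θ * Complex.I) hf).comp_ofReal

theorem int_eq_of_norm_sub_le {m n : ℤ} {A A' c : ℂ} (h1 : ‖A - (c - m)‖ ≤ 1 / 8)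
    (h2 : ‖A' - (c - n)‖ ≤ 1 / 8) (h3 : ‖A - A'‖ ≤ 1 / 4) : m = n := by
  have h4 : ((m - n : ℤ) : ℂ) = (A - (c - m)) - (A' - (c - n)) - (A - A') := by push_cast; ring
  have h5 : ‖((m - n : ℤ) : ℂ)‖ < 1 := by
    rw [h4]
    refine ((norm_sub_le _ _).trans (add_le_add_left (norm_sub_le _ _) _)).trans_lt ?_
    linarith
  rw [Complex.norm_intCast, ← Int.cast_abs] at h5
  have h6 : |m - n| < 1 := by exact_mod_cast h5
  rw [Int.abs_lt_one_iff] at h6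
  omega

theorem IsFlow.exists_norm_energyA_sub_le (h : IsFlow a b d e B Q P) {θ : ℝ}
    (hθ : ∀ β ∈ B, β.im ≠ θ) :
    ∃ S : ℝ, 1 ≤ S ∧ ∀ s₂ s₁ : ℝ, s₂ ≤ s₁ → s₁ < -S →
      (∀ s ∈ Set.Icc s₂ s₁, Real.exp s ≤ ‖Q (s + θ * Complex.I)‖ ^ 2) →
      ‖energyA a b d e (Complex.exp (s₁ + θ * Complex.I)) (Q (s₁ + θ * Complex.I))
          (P (s₁ + θ * Complex.I)) -
        energyA a b d e (Complex.exp (s₂ + θ * Complex.I)) (Q (s₂ + θ * Complex.I))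
          (P (s₂ + θ * Complex.I))‖ ≤ 1 / 16 := by
  obtain ⟨C₁, S₁, hC₁, hS₁, hA⟩ := h.exists_apriori_bound (ε := 1 / 16) (by norm_num)
  obtain ⟨C₂, hC₂, hsl⟩ := norm_slopeA_le a b d e
  obtain ⟨S₃, hS₃, hs3⟩ := exists_forall_lt_mul_exp_le (2 * C₂ * (1 + C₁) / (7 / 16))
    (c := 7 / 16) (μ := 1 / 16) (by norm_num) (by norm_num)
  obtain ⟨S₄, hS₄, hs4⟩ := exists_forall_lt_mul_exp_le 2
    (c := 1 / 2) (μ := 1) (by norm_num) (by norm_num)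
  refine ⟨S₁ + S₃ + S₄ + 1, by linarith, fun s₂ s₁ h12 h1 hup => ?_⟩
  have hmem : ∀ s : ℝ, (s + θ * Complex.I : ℂ) ∉ B := fun s hm => hθ _ hm (by simp)
  have hre : ∀ s : ℝ, (s + θ * Complex.I : ℂ).re = s := fun s => by simp
  refine (norm_sub_le_of_deriv_le_exp (f := fun s : ℝ => energyA a b d e
    (Complex.exp (s + θ * Complex.I)) (Q (s + θ * Complex.I)) (P (s + θ * Complex.I)))
    (c := 7 / 16) (K := 2 * C₂ * (1 + C₁)) (by norm_num) h12
    (fun s hs => hasDerivAt_ray (h.hasDerivAt_energyA (by rw [hre]; linarith [hs.2]) (hmem s)))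
    (fun s hs => ?_) (by positivity)).trans (hs3 s₁ (by linarith))
  have hs1 := hs.2
  have hb := (hA _ (hmem s) (by rw [hre]; linarith)).1
  rw [hre] at hb
  have hq := hup s hs
  have k4 := hs4 s (by linarith)
  set q := Q (s + θ * Complex.I)
  set p := P (s + θ * Complex.I)
  rw [show 1 / 2 * s = s / 2 by ring] at k4
  set r := Real.exp (s / 2) with hr
  have hr0 : 0 < r := Real.exp_pos _
  have hr2 : r ^ 2 = Real.exp s := exp_half_sq s
  have hb' := hb (by linarith [Real.exp_pos s])
  rw [show -(1 / 16) * s = -(s / 16) by ring] at hb'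
  have hE1 : 1 ≤ Real.exp (-(s / 16)) := Real.one_le_exp (by linarith)
  rw [← hr2] at hq
  have hrq : r ≤ ‖q‖ := (pow_le_pow_iff_left₀ hr0.le (norm_nonneg _) two_ne_zero).mp hq
  have hz : ‖Complex.exp (s + θ * Complex.I)‖ = r ^ 2 := by rw [Complex.norm_exp, hre, hr2]
  have hsl' := hsl (Complex.exp (s + θ * Complex.I)) q p (by rw [hz]; nlinarith)
  have hEE : Real.exp (7 / 16 * s) = r * Real.exp (-(s / 16)) := by
    rw [hr, ← Real.exp_add]; congr 1; ring
  rw [norm_mul, hz, hEE]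
  have h5 : 1 + ‖energyA a b d e (Complex.exp (s + θ * Complex.I)) q p‖ ≤
      (1 + C₁) * Real.exp (-(s / 16)) := by linarith
  have hq0 : 0 < ‖q‖ := hr0.trans_le hrq
  have h6 : r * (1 + ‖q‖) ≤ 2 * ‖q‖ := by nlinarith
  refine le_of_mul_le_mul_left ?_ hq0
  calc ‖q‖ * (r ^ 2 * ‖slopeA a d e q p‖) = r ^ 2 * (‖q‖ * ‖slopeA a d e q p‖) := by ring
    _ ≤ r ^ 2 * (C₂ * (1 + ‖q‖) * ((1 + C₁) * Real.exp (-(s / 16)))) := by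
        exact mul_le_mul_of_nonneg_left (hsl'.trans (by gcongr)) (by positivity)
    _ = r * (r * (1 + ‖q‖)) * (C₂ * ((1 + C₁) * Real.exp (-(s / 16)))) := by ring
    _ ≤ r * (2 * ‖q‖) * (C₂ * ((1 + C₁) * Real.exp (-(s / 16)))) := by gcongr
    _ = _ := by ring

theorem IsFlow.exists_norm_energyB_sub_le (h : IsFlow a b d e B Q P) {θ : ℝ}
    (hθ : ∀ β ∈ B, β.im ≠ θ) :
    ∃ S : ℝ, 1 ≤ S ∧ ∀ s₂ s₁ : ℝ, s₂ ≤ s₁ → s₁ < -S →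
      (∀ s ∈ Set.Icc s₂ s₁, ‖Q (s + θ * Complex.I)‖ ^ 2 ≤ Real.exp s) →
      ‖energyB a b d e (Complex.exp (s₁ + θ * Complex.I)) (Q (s₁ + θ * Complex.I))
          (P (s₁ + θ * Complex.I)) -
        energyB a b d e (Complex.exp (s₂ + θ * Complex.I)) (Q (s₂ + θ * Complex.I))
          (P (s₂ + θ * Complex.I))‖ ≤ 1 / 16 := by
  obtain ⟨C₁, S₁, hC₁, hS₁, hA⟩ := h.exists_apriori_bound (ε := 1 / 16) (by norm_num)
  obtain ⟨C₂, hC₂, hsl⟩ := norm_slopeB_le a b d e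
  obtain ⟨S₃, hS₃, hs3⟩ := exists_forall_lt_mul_exp_le (2 * C₂ * (1 + C₁) / (7 / 16))
    (c := 7 / 16) (μ := 1 / 16) (by norm_num) (by norm_num)
  obtain ⟨S₄, hS₄, hs4⟩ := exists_forall_lt_mul_exp_le 2
    (c := 1 / 2) (μ := 1) (by norm_num) (by norm_num)
  refine ⟨S₁ + S₃ + S₄ + 1, by linarith, fun s₂ s₁ h12 h1 hup => ?_⟩
  have hmem : ∀ s : ℝ, (s + θ * Complex.I : ℂ) ∉ B := fun s hm => hθ _ hm (by simp)
  have hre : ∀ s : ℝ, (s + θ * Complex.I : ℂ).re = s := fun s => by simp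
  refine (norm_sub_le_of_deriv_le_exp (f := fun s : ℝ => energyB a b d e
    (Complex.exp (s + θ * Complex.I)) (Q (s + θ * Complex.I)) (P (s + θ * Complex.I)))
    (c := 7 / 16) (K := 2 * C₂ * (1 + C₁)) (by norm_num) h12
    (fun s hs => hasDerivAt_ray (h.hasDerivAt_energyB (by rw [hre]; linarith [hs.2]) (hmem s)))
    (fun s hs => ?_) (by positivity)).trans (hs3 s₁ (by linarith))
  have hs1 := hs.2
  have hb := (hA _ (hmem s) (by rw [hre]; linarith)).2.1
  rw [hre] at hb
  have hq := hup s hs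
  have k4 := hs4 s (by linarith)
  set q := Q (s + θ * Complex.I)
  set p := P (s + θ * Complex.I)
  rw [show 1 / 2 * s = s / 2 by ring] at k4
  set r := Real.exp (s / 2) with hr
  have hr0 : 0 < r := Real.exp_pos _
  have hr2 : r ^ 2 = Real.exp s := exp_half_sq s
  have hb' := hb (by linarith [Real.exp_pos s])
  rw [show -(1 / 16) * s = -(s / 16) by ring] at hb'
  have hE1 : 1 ≤ Real.exp (-(s / 16)) := Real.one_le_exp (by linarith)
  rw [← hr2] at hq
  have hrq : ‖q‖ ≤ r := (pow_le_pow_iff_left₀ (norm_nonneg _) hr0.le two_ne_zero).mp hq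
  have hz : ‖Complex.exp (s + θ * Complex.I)‖ = r ^ 2 := by rw [Complex.norm_exp, hre, hr2]
  have hsl' := hsl (Complex.exp (s + θ * Complex.I)) q p (by linarith)
  have hEE : Real.exp (7 / 16 * s) = r * Real.exp (-(s / 16)) := by
    rw [hr, ← Real.exp_add]; congr 1; ring
  rw [hEE]
  have h5 : 1 + ‖energyB a b d e (Complex.exp (s + θ * Complex.I)) q p‖ ≤
      (1 + C₁) * Real.exp (-(s / 16)) := by linarith
  have h6 : ‖q‖ + ‖Complex.exp (s + θ * Complex.I)‖ ≤ 2 * r := by rw [hz]; nlinarith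
  calc _ ≤ _ := hsl'
    _ ≤ C₂ * (2 * r) * ((1 + C₁) * Real.exp (-(s / 16))) := by gcongr
    _ = _ := by ring

/-- Along a ray avoiding the singular set, `‖q‖² - ‖z‖` eventually has constant sign. -/
theorem IsFlow.exists_ray_sign (h : IsFlow a b d e B Q P) {θ : ℝ} (hθ : ∀ β ∈ B, β.im ≠ θ) :
    ∃ S : ℝ, 1 ≤ S ∧ ((∀ s < -S, Real.exp s < ‖Q (s + θ * Complex.I)‖ ^ 2) ∨
      (∀ s < -S, ‖Q (s + θ * Complex.I)‖ ^ 2 < Real.exp s)) := by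
  obtain ⟨S₁, hS₁, hcr⟩ := h.exists_int_crossing
  obtain ⟨S₂, hS₂, hA⟩ := h.exists_norm_energyA_sub_le hθ
  obtain ⟨S₃, hS₃, hB⟩ := h.exists_norm_energyB_sub_le hθ
  have hmem : ∀ s : ℝ, (s + θ * Complex.I : ℂ) ∉ B := fun s hm => hθ _ hm (by simp)
  have hre : ∀ s : ℝ, (s + θ * Complex.I : ℂ).re = s := fun s => by simp
  set S := S₁ + S₂ + S₃ with hS
  set g : ℝ → ℝ := fun s => ‖Q (s + θ * Complex.I)‖ ^ 2 * Real.exp (-s) - 1 with hg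
  have hgexp : ∀ s : ℝ, ‖Q (s + θ * Complex.I)‖ ^ 2 = (g s + 1) * Real.exp s := by
    intro s
    rw [hg]
    simp only [sub_add_cancel]
    rw [mul_assoc, ← Real.exp_add, neg_add_cancel, Real.exp_zero, mul_one]
  have hzero : ∀ s, g s = 0 → ‖Q (s + θ * Complex.I)‖ ^ 2 = Real.exp s := by
    intro s hs; rw [hgexp, hs]; ring
  have hex : ∀ s : ℝ, ∃ n : ℤ, s < -S → g s = 0 → Q (s + θ * Complex.I) ≠ 0 ∧
      ‖fieldQ a b d (Complex.exp (s + θ * Complex.I)) (Q (s + θ * Complex.I))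
        (P (s + θ * Complex.I)) / (Complex.exp (s + θ * Complex.I) - 1) /
          Q (s + θ * Complex.I) - n‖ ≤ 1 / 8 ∧
      ‖4 * energyA a b d e (Complex.exp (s + θ * Complex.I)) (Q (s + θ * Complex.I))
        (P (s + θ * Complex.I)) - ((a + b - 1) ^ 2 - n ^ 2)‖ ≤ 1 / 8 ∧
      ‖4 * energyB a b d e (Complex.exp (s + θ * Complex.I)) (Q (s + θ * Complex.I))
        (P (s + θ * Complex.I)) - ((a + b) ^ 2 - (n - 1) ^ 2)‖ ≤ 1 / 8 := by
    intro s
    by_cases hc : s < -S ∧ g s = 0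
    · obtain ⟨hq, n, hn⟩ := hcr _ (hmem s) (by rw [hre]; linarith [hc.1])
        (by rw [hre]; exact hzero s hc.2)
      exact ⟨n, fun _ _ => ⟨hq, hn⟩⟩
    · exact ⟨0, fun h1 h2 => absurd ⟨h1, h2⟩ hc⟩
  choose n hn using hex
  have hder : ∀ s < -S, HasDerivAt g
      (2 * inner ℝ (Q (s + θ * Complex.I)) (fieldQ a b d (Complex.exp (s + θ * Complex.I))
        (Q (s + θ * Complex.I)) (P (s + θ * Complex.I)) /
          (Complex.exp (s + θ * Complex.I) - 1)) * Real.exp (-s) +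
        ‖Q (s + θ * Complex.I)‖ ^ 2 * (Real.exp (-s) * -1)) s := by
    intro s hs
    have h1 := hasDerivAt_ray (h.hasDerivAt_fst _ (by rw [hre]; linarith) (hmem s))
    exact (h1.norm_sq.mul (hasDerivAt_neg s).exp).sub_const 1
  have hval : ∀ s < -S, g s = 0 → ∃ x : ℝ, |x - (2 * n s - 1)| ≤ 1 / 4 ∧
      2 * inner ℝ (Q (s + θ * Complex.I)) (fieldQ a b d (Complex.exp (s + θ * Complex.I))
        (Q (s + θ * Complex.I)) (P (s + θ * Complex.I)) /
          (Complex.exp (s + θ * Complex.I) - 1)) * Real.exp (-s) +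
        ‖Q (s + θ * Complex.I)‖ ^ 2 * (Real.exp (-s) * -1) = x := by
    intro s hs h0
    obtain ⟨hq, hl, -, -⟩ := hn s hs h0
    set L := fieldQ a b d (Complex.exp (s + θ * Complex.I)) (Q (s + θ * Complex.I))
        (P (s + θ * Complex.I)) / (Complex.exp (s + θ * Complex.I) - 1) /
          Q (s + θ * Complex.I) with hL
    refine ⟨2 * L.re - 1, ?_, ?_⟩
    · have := (Complex.abs_re_le_norm _).trans hl
      rw [Complex.sub_re, Complex.intCast_re, abs_le] at this
      rw [abs_le]; constructor <;> linarith [this.1, this.2]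
    · rw [← div_mul_cancel₀ (fieldQ a b d (Complex.exp (s + θ * Complex.I))
        (Q (s + θ * Complex.I)) (P (s + θ * Complex.I)) /
          (Complex.exp (s + θ * Complex.I) - 1)) hq, ← hL, Complex.inner]
      have h1 : (L * Q (s + θ * Complex.I) * (starRingEnd ℂ) (Q (s + θ * Complex.I))).re =
          ‖Q (s + θ * Complex.I)‖ ^ 2 * L.re := by
        rw [mul_assoc, Complex.mul_conj, Complex.re_mul_ofReal, Complex.normSq_eq_norm_sq]; ring
      have h2 : Real.exp s * Real.exp (-s) = 1 := by rw [← Real.exp_add]; simp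
      rw [h1, hzero s h0]
      linear_combination (2 * L.re - 1) * h2
  have hmain := exists_forall_lt_sign g _ n S hder ?_ ?_ ?_ ?_
  · obtain ⟨S', hSS', hS'⟩ := hmain
    refine ⟨S', by linarith, hS'.imp (fun h1 s hs => ?_) fun h1 s hs => ?_⟩
    · have := h1 s hs
      rw [hgexp]; nlinarith [Real.exp_pos s]
    · have := h1 s hs
      rw [hgexp]; nlinarith [Real.exp_pos s]
  · intro s hs h0 hns
    obtain ⟨x, hx, hx'⟩ := hval s hs h0
    rw [hx']
    have : (n s : ℝ) ≤ 0 := by exact_mod_cast hns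
    linarith [(abs_le.mp hx).2]
  · intro s hs h0 hns
    obtain ⟨x, hx, hx'⟩ := hval s hs h0
    rw [hx']
    have : (1 : ℝ) ≤ n s := by exact_mod_cast hns
    linarith [(abs_le.mp hx).1]
  · intro s₂ s₁ h21 hs₁ h2 h1 hsg
    obtain ⟨-, -, k1, -⟩ := hn s₁ hs₁ h1
    obtain ⟨-, -, k2, -⟩ := hn s₂ (h21.trans hs₁) h2
    have k3 := hA s₂ s₁ h21.le (by linarith) fun s hs => by
      rw [hgexp]; nlinarith [Real.exp_pos s, hsg s hs]
    refine int_eq_of_norm_sub_le (by push_cast; exact k2) (by push_cast; exact k1) ?_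
    rw [← mul_sub, norm_mul, norm_sub_rev, Complex.norm_ofNat]
    linarith
  · intro s₂ s₁ h21 hs₁ h2 h1 hsg
    obtain ⟨-, -, -, k1⟩ := hn s₁ hs₁ h1
    obtain ⟨-, -, -, k2⟩ := hn s₂ (h21.trans hs₁) h2
    have k3 := hB s₂ s₁ h21.le (by linarith) fun s hs => by
      rw [hgexp]; nlinarith [Real.exp_pos s, hsg s hs]
    refine int_eq_of_norm_sub_le (by push_cast; exact k2) (by push_cast; exact k1) ?_
    rw [← mul_sub, norm_mul, norm_sub_rev, Complex.norm_ofNat]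
    linarith

variable {a b d e : ℂ} {B : Set ℂ} {Q P : ℂ → ℂ}

theorem IsFlow.exists_good_circle (h : IsFlow a b d e B Q P) {t : ℂ} (ht : t ∉ B) {S : ℝ}
    (hS : 0 ≤ S) (hre : t.re < -S) {U : Set (ℝ × ℝ)} (hU : IsOpen U)
    (hmem : (t.re, ‖Q t‖) ∈ U) :
    ∃ x : ℝ, x < -S ∧ (∀ β ∈ B, β.re ≠ x) ∧ (x, ‖Q (x + t.im * Complex.I)‖) ∈ U := by
  have hcont : ContinuousAt (fun x : ℝ => (x, ‖Q (x + t.im * Complex.I)‖)) t.re := by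
    have h1 := h.hasDerivAt_fst t (by linarith) ht
    rw [← Complex.re_add_im t] at h1
    have h2 := (hasDerivAt_ray h1).continuousAt.norm
    exact continuousAt_id.prodMk h2
  have h2 : ∀ᶠ x in nhds t.re, x < -S ∧ (x, ‖Q (x + t.im * Complex.I)‖) ∈ U := by
    refine (gt_mem_nhds hre).and (hcont.eventually_mem (hU.mem_nhds ?_))
    simpa [Complex.re_add_im] using hmem
  obtain ⟨V, hV, hVo, hxV⟩ := eventually_nhds_iff.mp h2
  obtain ⟨x, hx1, hx2⟩ := (dense_forall_re_ne h.countable).inter_open_nonempty V hVo ⟨_, hxV⟩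
  exact ⟨x, (hV x hx1).1, hx2, (hV x hx1).2⟩

/-- If `‖Q‖²` takes values on both sides of a level of the intermediate zone on a circle, then it
is comparable to that level everywhere on the circle. -/
theorem IsFlow.exists_circle_level (h : IsFlow a b d e B Q P) :
    ∃ S : ℝ, 1 ≤ S ∧ ∀ x : ℝ, x < -S → (∀ β ∈ B, β.re ≠ x) → ∀ c : ℝ, 1 / 16 ≤ c → c ≤ 16 →
      ∀ φ₁ φ₂ : ℝ, ‖Q (x + φ₁ * Complex.I)‖ ^ 2 ≤ c * Real.exp x →
        c * Real.exp x ≤ ‖Q (x + φ₂ * Complex.I)‖ ^ 2 → ∀ θ : ℝ,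
        c * Real.exp x ≤ 4 * ‖Q (x + θ * Complex.I)‖ ^ 2 ∧
          ‖Q (x + θ * Complex.I)‖ ^ 2 ≤ 4 * (c * Real.exp x) := by
  obtain ⟨S, hS, hC⟩ := h.exists_norm_circle_le
  refine ⟨S, hS, fun x hx hB c hc1 hc2 φ₁ φ₂ h1 h2 θ => ?_⟩
  have hcont : Continuous fun φ : ℝ => ‖Q (x + φ * Complex.I)‖ ^ 2 := by
    rw [continuous_iff_continuousAt]
    intro φ
    have : ContinuousAt Q (x + φ * Complex.I) :=
      (h.hasDerivAt_fst _ (by simp; linarith) fun hm => hB _ hm (by simp)).continuousAt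
    exact (ContinuousAt.comp (f := fun φ : ℝ => (x + φ * Complex.I : ℂ)) this
      (by fun_prop)).norm.pow 2
  obtain ⟨φ, hφ⟩ := mem_range_of_exists_le_of_exists_ge hcont ⟨φ₁, h1⟩ ⟨φ₂, h2⟩
  simp only at hφ
  have hper : Function.Periodic (fun φ : ℝ => Q (x + φ * Complex.I)) (2 * Real.pi) := by
    intro y
    have := h.periodic_fst (x + y * Complex.I)
    simp only
    rw [← this]
    congr 1; push_cast; ring
  have hpi := Real.two_pi_pos
  set k := ⌊(φ - θ) / (2 * Real.pi)⌋ with hk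
  have hk1 : k * (2 * Real.pi) ≤ φ - θ := by
    rw [← le_div_iff₀ hpi]; exact Int.floor_le _
  have hk2 : φ - θ < (k + 1) * (2 * Real.pi) := by
    rw [← div_lt_iff₀ hpi]; exact Int.lt_floor_add_one _
  have hre : (x + φ * Complex.I : ℂ).re = x := by simp
  have hE := Real.exp_pos x
  have h3 := hC (x + φ * Complex.I) (by rwa [hre]) (by rwa [hre])
    (by rw [hre, hφ]; nlinarith) (by rw [hre, hφ]; nlinarith) (θ + k * (2 * Real.pi) - φ)
    (by rw [abs_le]; constructor <;> linarith)
  have h4 : Q (x + φ * Complex.I + ((θ + k * (2 * Real.pi) - φ : ℝ) : ℂ) * Complex.I) =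
      Q (x + θ * Complex.I) := by
    have := hper.int_mul k θ
    rw [← this]
    congr 1; push_cast; ring
  rw [h4] at h3
  rw [← hφ]
  constructor
  · have := pow_le_pow_left₀ (norm_nonneg _) h3.1 2
    rw [mul_pow] at this
    linarith
  · have := pow_le_pow_left₀ (norm_nonneg _) h3.2 2
    rw [mul_pow] at this
    linarith

theorem IsFlow.dichotomy (h : IsFlow a b d e B Q P) :
    ∃ S : ℝ, 1 ≤ S ∧ ((∀ t ∉ B, t.re < -S → Real.exp t.re ≤ 16 * ‖Q t‖ ^ 2) ∨
      (∀ t ∉ B, t.re < -S → ‖Q t‖ ^ 2 ≤ 16 * Real.exp t.re)) := by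
  obtain ⟨θ, -, hθ⟩ := (dense_forall_im_ne h.countable).inter_open_nonempty Set.univ isOpen_univ
    ⟨0, trivial⟩
  obtain ⟨S₁, hS₁, hray⟩ := h.exists_ray_sign hθ
  obtain ⟨S₂, hS₂, hcirc⟩ := h.exists_circle_level
  refine ⟨S₁ + S₂, by linarith, hray.imp (fun hr t ht hre => ?_) fun hr t ht hre => ?_⟩
  · by_contra! hcon
    obtain ⟨x, hx, hxB, hxU⟩ := h.exists_good_circle ht (by linarith) hre
      (U := {y | 16 * y.2 ^ 2 < Real.exp y.1}) (isOpen_lt (by fun_prop) (by fun_prop)) hcon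
    have h1 := hr x (by linarith)
    have hE := Real.exp_pos x
    have h2 := hcirc x (by linarith) hxB (1 / 16) le_rfl (by norm_num) t.im θ
      (by linarith [hxU.out]) (by linarith) θ
    linarith [h2.2]
  · by_contra! hcon
    obtain ⟨x, hx, hxB, hxU⟩ := h.exists_good_circle ht (by linarith) hre
      (U := {y | 16 * Real.exp y.1 < y.2 ^ 2}) (isOpen_lt (by fun_prop) (by fun_prop)) hcon
    have h1 := hr x (by linarith)
    have hE := Real.exp_pos x
    have h2 := hcirc x (by linarith) hxB 16 (by norm_num) le_rfl θ t.im
      (by linarith) (by linarith [hxU.out]) θ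
    linarith [h2.1]

open Filter Topology

/-- Up to changes on a discrete subset of a punctured neighbourhood of `c`, the function `f` is
meromorphic at `c`. -/
def EventuallyMeromorphicAt (f : ℂ → ℂ) (c : ℂ) : Prop :=
  ∃ g, MeromorphicAt g c ∧ ∀ᶠ x in 𝓝[≠] c, f =ᶠ[𝓝[≠] x] g

theorem EventuallyMeromorphicAt.of_meromorphicAt {f : ℂ → ℂ} {c : ℂ} (h : MeromorphicAt f c) :
    EventuallyMeromorphicAt f c :=
  ⟨f, h, Eventually.of_forall fun _ => EventuallyEq.rfl⟩

theorem EventuallyMeromorphicAt.congr {f g : ℂ → ℂ} {c : ℂ} (hf : EventuallyMeromorphicAt f c)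
    (h : ∀ᶠ x in 𝓝[≠] c, f =ᶠ[𝓝[≠] x] g) : EventuallyMeromorphicAt g c := by
  obtain ⟨F, hF, hfF⟩ := hf
  exact ⟨F, hF, by filter_upwards [h, hfF] with x h1 h2 using h1.symm.trans h2⟩

theorem EventuallyMeromorphicAt.add {f g : ℂ → ℂ} {c : ℂ} (hf : EventuallyMeromorphicAt f c)
    (hg : EventuallyMeromorphicAt g c) : EventuallyMeromorphicAt (f + g) c := by
  obtain ⟨F, hF, hfF⟩ := hf
  obtain ⟨G, hG, hgG⟩ := hg
  exact ⟨F + G, hF.add hG, by filter_upwards [hfF, hgG] with x h1 h2 using h1.add h2⟩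

theorem EventuallyMeromorphicAt.sub {f g : ℂ → ℂ} {c : ℂ} (hf : EventuallyMeromorphicAt f c)
    (hg : EventuallyMeromorphicAt g c) : EventuallyMeromorphicAt (f - g) c := by
  obtain ⟨F, hF, hfF⟩ := hf
  obtain ⟨G, hG, hgG⟩ := hg
  exact ⟨F - G, hF.sub hG, by filter_upwards [hfF, hgG] with x h1 h2 using h1.sub h2⟩

theorem EventuallyMeromorphicAt.mul {f g : ℂ → ℂ} {c : ℂ} (hf : EventuallyMeromorphicAt f c)
    (hg : EventuallyMeromorphicAt g c) : EventuallyMeromorphicAt (f * g) c := by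
  obtain ⟨F, hF, hfF⟩ := hf
  obtain ⟨G, hG, hgG⟩ := hg
  exact ⟨F * G, hF.mul hG, by filter_upwards [hfF, hgG] with x h1 h2 using h1.mul h2⟩

theorem EventuallyMeromorphicAt.inv {f : ℂ → ℂ} {c : ℂ} (hf : EventuallyMeromorphicAt f c) :
    EventuallyMeromorphicAt f⁻¹ c := by
  obtain ⟨F, hF, hfF⟩ := hf
  exact ⟨F⁻¹, hF.inv, by filter_upwards [hfF] with x h1 using h1.inv⟩

theorem EventuallyMeromorphicAt.div {f g : ℂ → ℂ} {c : ℂ} (hf : EventuallyMeromorphicAt f c)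
    (hg : EventuallyMeromorphicAt g c) : EventuallyMeromorphicAt (f / g) c := by
  rw [div_eq_mul_inv]
  exact hf.mul hg.inv

/-- A meromorphic function that is bounded outside a discrete set near `x` is bounded below in
order. -/
theorem meromorphicOrderAt_nonneg_of_eventually_norm_le {f : ℂ → ℂ} {x : ℂ} {C : ℝ}
    (hf : MeromorphicAt f x) (hb : ∀ᶠ z in 𝓝[≠] x, ‖f z‖ ≤ C) : 0 ≤ meromorphicOrderAt f x := by
  by_contra! h
  have h1 := (tendsto_cobounded_iff_meromorphicOrderAt_neg hf).2 h
  rw [← tendsto_norm_atTop_iff_cobounded] at h1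
  obtain ⟨z, hz1, hz2⟩ := ((h1.eventually_gt_atTop C).and hb).exists
  linarith

theorem EventuallyMeromorphicAt.of_bounded {f : ℂ → ℂ} {c : ℂ} {C : ℝ}
    (hf : ∀ᶠ x in 𝓝[≠] c, MeromorphicAt f x)
    (hb : ∀ᶠ x in 𝓝[≠] c, ∀ᶠ z in 𝓝[≠] x, ‖f z‖ ≤ C) : EventuallyMeromorphicAt f c := by
  have hV := hf.and hb
  set V : Set ℂ := {x | MeromorphicAt f x ∧ ∀ᶠ z in 𝓝[≠] x, ‖f z‖ ≤ C} with hVdef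
  have hVmem : V ∈ 𝓝[≠] c := hV
  have hmer : MeromorphicOn f V := fun x hx => hx.1
  set F := toMeromorphicNFOn f V
  have hNF : MeromorphicNFOn F V := meromorphicNFOn_toMeromorphicNFOn f V
  have hFf : ∀ x ∈ V, f =ᶠ[𝓝[≠] x] F :=
    fun x hx => (hmer.toMeromorphicNFOn_eq_self_on_nhdsNE hx).symm
  have hFb : ∀ x ∈ V, ∀ᶠ z in 𝓝[≠] x, ‖F z‖ ≤ C := fun x hx => by
    filter_upwards [hFf x hx, hx.2] with z h1 h2
    rwa [← h1]
  have hFan : ∀ x ∈ V, AnalyticAt ℂ F x := fun x hx =>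
    (hNF hx).meromorphicOrderAt_nonneg_iff_analyticAt.1
      (meromorphicOrderAt_nonneg_of_eventually_norm_le (hNF hx).meromorphicAt (hFb x hx))
  have hFle : ∀ x ∈ V, ‖F x‖ ≤ C := fun x hx =>
    le_of_tendsto ((hFan x hx).continuousAt.norm.tendsto.mono_left nhdsWithin_le_nhds) (hFb x hx)
  have hW : insert c V ∈ 𝓝 c := by
    rw [mem_nhdsWithin_iff_eventually] at hVmem
    filter_upwards [hVmem] with x hx
    by_cases h : x = c
    · exact Or.inl h
    · exact Or.inr (hx h)
  have hG := Complex.differentiableOn_update_limUnder_of_bddAbove (f := F) hW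
    (fun x hx => (hFan x (hx.1.resolve_left hx.2)).differentiableAt.differentiableWithinAt)
    ⟨C, by rintro _ ⟨x, hx, rfl⟩; exact hFle x (hx.1.resolve_left hx.2)⟩
  refine ⟨_, (hG.analyticAt hW).meromorphicAt, ?_⟩
  filter_upwards [hV, self_mem_nhdsWithin] with x hx hxc
  refine (hFf x hx).trans ?_
  have : ∀ᶠ z in 𝓝[≠] x, z ≠ c :=
    (eventually_ne_nhds hxc).filter_mono nhdsWithin_le_nhds
  filter_upwards [this] with z hz
  rw [Function.update_of_ne hz]

/-- A property that holds on a punctured neighbourhood of each point of `U` fails at most at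
countably many points of `U`. -/
theorem countable_of_eventually_nhdsNE {U : Set ℂ} {P : ℂ → Prop}
    (h : ∀ x ∈ U, ∀ᶠ z in 𝓝[≠] x, P z) : {x ∈ U | ¬ P x}.Countable := by
  have hd : DiscreteTopology {x ∈ U | ¬ P x} := by
    rw [discreteTopology_subtype_iff]
    intro x hx
    rw [← disjoint_iff, disjoint_principal_right]
    filter_upwards [h x hx.1] with z hz h1 using h1.2 hz
  exact (HereditarilyLindelofSpace.isLindelof _).countable hd

/-- A pair of functions, meromorphic on the plane punctured at `0` and `1`, that solves the sixth
Painlevé system outside a discrete set. -/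
structure IsSolution (a b d e : ℂ) (q p : ℂ → ℂ) : Prop where
  meromorphicAt_fst : ∀ x : ℂ, x ≠ 0 → x ≠ 1 → MeromorphicAt q x
  meromorphicAt_snd : ∀ x : ℂ, x ≠ 0 → x ≠ 1 → MeromorphicAt p x
  hasDerivAt_fst : ∀ x : ℂ, x ≠ 0 → x ≠ 1 → ∀ᶠ z in 𝓝[≠] x,
    HasDerivAt q (fieldQ a b d z (q z) (p z) / (z * (z - 1))) z
  hasDerivAt_snd : ∀ x : ℂ, x ≠ 0 → x ≠ 1 → ∀ᶠ z in 𝓝[≠] x,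
    HasDerivAt p (fieldP a b d e z (q z) (p z) / (z * (z - 1))) z

theorem countable_preimage_exp {S : Set ℂ} (hS : S.Countable) : (Complex.exp ⁻¹' S).Countable := by
  have h : Complex.exp ⁻¹' S = ⋃ z ∈ S, Complex.exp ⁻¹' {z} := by ext; simp
  rw [h]
  refine hS.biUnion fun z _ => ?_
  rcases (Complex.exp ⁻¹' {z}).eq_empty_or_nonempty with h0 | ⟨t, ht⟩
  · simp [h0]
  · refine (Set.countable_range fun n : ℤ => t + n * (2 * Real.pi * Complex.I)).mono fun s hs => ?_
    obtain ⟨n, hn⟩ := Complex.exp_eq_exp_iff_exists_int.1 ((hs : _ = z).trans ht.symm)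
    exact ⟨n, hn.symm⟩

section Solution

variable {a b d e : ℂ} {q p : ℂ → ℂ}

/-- The points at which the system fails. -/
def badSet (a b d e : ℂ) (q p : ℂ → ℂ) : Set ℂ :=
  {z ∈ {x : ℂ | x ≠ 0 ∧ x ≠ 1} | ¬ (HasDerivAt q (fieldQ a b d z (q z) (p z) / (z * (z - 1))) z ∧
    HasDerivAt p (fieldP a b d e z (q z) (p z) / (z * (z - 1))) z)}

theorem IsSolution.countable_badSet (h : IsSolution a b d e q p) : (badSet a b d e q p).Countable :=
  countable_of_eventually_nhdsNE fun x hx =>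
    (h.hasDerivAt_fst x hx.1 hx.2).and (h.hasDerivAt_snd x hx.1 hx.2)

theorem IsSolution.eventually_notMem_badSet (h : IsSolution a b d e q p) {x : ℂ} (hx : x ≠ 0)
    (hx1 : x ≠ 1) : ∀ᶠ z in 𝓝[≠] x, z ∉ badSet a b d e q p := by
  filter_upwards [h.hasDerivAt_fst x hx hx1, h.hasDerivAt_snd x hx hx1] with z h1 h2 h3
  exact h3.2 ⟨h1, h2⟩

theorem IsSolution.isFlow (h : IsSolution a b d e q p) :
    IsFlow a b d e (Complex.exp ⁻¹' badSet a b d e q p) (fun t => q (Complex.exp t))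
      (fun t => p (Complex.exp t)) := by
  have hper : ∀ t : ℂ, Complex.exp (t + 2 * Real.pi * Complex.I) = Complex.exp t :=
    Complex.exp_periodic
  have good : ∀ t : ℂ, t.re < 0 → t ∉ Complex.exp ⁻¹' badSet a b d e q p →
      HasDerivAt q (fieldQ a b d (Complex.exp t) (q (Complex.exp t)) (p (Complex.exp t)) /
        (Complex.exp t * (Complex.exp t - 1))) (Complex.exp t) ∧
      HasDerivAt p (fieldP a b d e (Complex.exp t) (q (Complex.exp t)) (p (Complex.exp t)) /
        (Complex.exp t * (Complex.exp t - 1))) (Complex.exp t) := by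
    intro t ht hB
    by_contra hn
    exact hB ⟨⟨Complex.exp_ne_zero t, sub_ne_zero.1 (exp_sub_one_ne_zero ht)⟩, hn⟩
  refine ⟨countable_preimage_exp h.countable_badSet, fun t ht hB => ?_, fun t ht hB => ?_,
    fun t => by simp only [hper], fun t => by simp only [hper], fun t => by
      simp only [Set.mem_preimage, hper]⟩
  · refine ((good t ht hB).1.comp t (Complex.hasDerivAt_exp t)).congr_deriv ?_
    have := exp_sub_one_ne_zero ht
    have := Complex.exp_ne_zero t
    field_simp
  · refine ((good t ht hB).2.comp t (Complex.hasDerivAt_exp t)).congr_deriv ?_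
    have := exp_sub_one_ne_zero ht
    have := Complex.exp_ne_zero t
    field_simp

theorem eventually_nhdsNE_zero_ne_one : ∀ᶠ x : ℂ in 𝓝[≠] 0, x ≠ 0 ∧ x ≠ 1 := by
  filter_upwards [self_mem_nhdsWithin,
    (eventually_ne_nhds (zero_ne_one' ℂ)).filter_mono nhdsWithin_le_nhds] with x h1 h2
  exact ⟨h1, h2⟩

theorem IsSolution.eventually_meromorphicAt_fst (h : IsSolution a b d e q p) :
    ∀ᶠ x in 𝓝[≠] (0 : ℂ), MeromorphicAt q x := by
  filter_upwards [eventually_nhdsNE_zero_ne_one] with x hx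
  exact h.meromorphicAt_fst x hx.1 hx.2

theorem IsSolution.eventuallyMeromorphicAt_fst_zero (h : IsSolution a b d e q p) :
    EventuallyMeromorphicAt q 0 := by
  obtain ⟨S, hS1, hS⟩ := h.isFlow.dichotomy
  have hlog : ∀ z : ℂ, z ≠ 0 → ‖z‖ < Real.exp (-S) →
      (Complex.log z).re < -S ∧ Real.exp (Complex.log z).re = ‖z‖ := by
    intro z hz hzS
    have hpos := norm_pos_iff.2 hz
    rw [Complex.log_re, Real.exp_log hpos]
    exact ⟨by rwa [Real.log_lt_iff_lt_exp hpos], rfl⟩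
  have hle1 : Real.exp (-S) ≤ 1 := by rw [Real.exp_le_one_iff]; linarith
  have hgood : ∀ᶠ x in 𝓝[≠] (0 : ℂ), ∀ᶠ z in 𝓝[≠] x,
      z ≠ 0 ∧ ‖z‖ < Real.exp (-S) ∧ z ∉ badSet a b d e q p := by
    have hball : ∀ᶠ x : ℂ in 𝓝[≠] 0, x ∈ Metric.ball (0 : ℂ) (Real.exp (-S)) :=
      nhdsWithin_le_nhds (Metric.ball_mem_nhds _ (Real.exp_pos _))
    filter_upwards [eventually_nhdsNE_zero_ne_one, hball] with x hx hxb
    have h1 : ∀ᶠ z in 𝓝[≠] x, z ∈ Metric.ball (0 : ℂ) (Real.exp (-S)) :=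
      nhdsWithin_le_nhds (Metric.isOpen_ball.mem_nhds hxb)
    filter_upwards [h1, h.eventually_notMem_badSet hx.1 hx.2,
      (eventually_ne_nhds hx.1).filter_mono nhdsWithin_le_nhds] with z h2 h3 h4
    exact ⟨h4, by simpa using h2, h3⟩
  rcases hS with hS | hS
  · have hb : EventuallyMeromorphicAt (id / q) 0 := by
      refine EventuallyMeromorphicAt.of_bounded (C := 4) ?_ ?_
      · filter_upwards [h.eventually_meromorphicAt_fst] with x hx
        exact (MeromorphicAt.id x).div hx
      · filter_upwards [hgood] with x hx
        filter_upwards [hx] with z hz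
        obtain ⟨hl1, hl2⟩ := hlog z hz.1 hz.2.1
        have := hS (Complex.log z) (by simpa [Complex.exp_log hz.1] using hz.2.2) hl1
        simp only [Complex.exp_log hz.1, hl2] at this
        have hpos := norm_pos_iff.2 hz.1
        have hq : 0 < ‖q z‖ := by
          rcases (norm_nonneg (q z)).eq_or_lt with h0 | h0
          · rw [← h0] at this; simp at this; exact absurd this hz.1
          · exact h0
        rw [Pi.div_apply, norm_div, id, div_le_iff₀ hq]
        have h2 : ‖z‖ ^ 2 ≤ (4 * ‖q z‖) ^ 2 := by nlinarith [hz.2.1]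
        exact (pow_le_pow_iff_left₀ hpos.le (by positivity) two_ne_zero).1 h2
    refine ((EventuallyMeromorphicAt.of_meromorphicAt (MeromorphicAt.id 0)).div hb).congr ?_
    filter_upwards [hgood] with x hx
    filter_upwards [hx] with z hz
    have := hz.1
    simp only [Pi.div_apply, id]
    field_simp
  · refine EventuallyMeromorphicAt.of_bounded (C := 4) h.eventually_meromorphicAt_fst ?_
    filter_upwards [hgood] with x hx
    filter_upwards [hx] with z hz
    obtain ⟨hl1, hl2⟩ := hlog z hz.1 hz.2.1
    have := hS (Complex.log z) (by simpa [Complex.exp_log hz.1] using hz.2.2) hl1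
    simp only [Complex.exp_log hz.1, hl2] at this
    refine (pow_le_pow_iff_left₀ (norm_nonneg _) (by norm_num) two_ne_zero).1 ?_
    linarith [hz.2.1]

end Solution

section Symmetry

variable {a b d e r s : ℂ} {q p : ℂ → ℂ}

theorem eventually_nhdsNE_ne {x : ℂ} (hx : x ≠ 0) (hx1 : x ≠ 1) :
    ∀ᶠ z in 𝓝[≠] x, z ≠ 0 ∧ z - 1 ≠ 0 := by
  filter_upwards [(eventually_ne_nhds hx).filter_mono nhdsWithin_le_nhds,
    (eventually_ne_nhds hx1).filter_mono nhdsWithin_le_nhds] with z h1 h2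
  exact ⟨h1, sub_ne_zero.2 h2⟩

/-- The Bäcklund transformation attached to `κ₀`. -/
theorem IsSolution.add_div (h : IsSolution a b d (r * s) q p) (hrs : r + s = 1 - a - b - d)
    (hp : ∀ x : ℂ, x ≠ 0 → x ≠ 1 → ∀ᶠ z in 𝓝[≠] x, p z ≠ 0) :
    IsSolution (a + r) (b + r) (d + r) (-r * (s - r)) (fun z => q z + r / p z) p := by
  obtain rfl : s = 1 - a - b - d - r := by linear_combination hrs
  refine ⟨fun x h0 h1 => ?_, h.meromorphicAt_snd, fun x h0 h1 => ?_, fun x h0 h1 => ?_⟩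
  · exact (h.meromorphicAt_fst x h0 h1).add
      ((MeromorphicAt.const r x).div (h.meromorphicAt_snd x h0 h1))
  · filter_upwards [h.hasDerivAt_fst x h0 h1, h.hasDerivAt_snd x h0 h1, hp x h0 h1,
      eventually_nhdsNE_ne h0 h1] with z hq hp' hz hz'
    obtain ⟨hz0, hz1⟩ := hz'
    refine (hq.add ((hasDerivAt_const z r).div hp' hz)).congr_deriv ?_
    simp only [fieldQ, fieldP]
    field_simp
    ring
  · filter_upwards [h.hasDerivAt_snd x h0 h1, hp x h0 h1, eventually_nhdsNE_ne h0 h1]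
      with z hp' hz hz'
    obtain ⟨hz0, hz1⟩ := hz'
    refine hp'.congr_deriv ?_
    simp only [fieldP]
    field_simp
    ring

/-- The Bäcklund transformation attached to `κ₁`. -/
theorem IsSolution.sub_div_fst (h : IsSolution a b d (r * s) q p) (hrs : r + s = 1 - a - b - d)
    (hq0 : ∀ x : ℂ, x ≠ 0 → x ≠ 1 → ∀ᶠ z in 𝓝[≠] x, q z ≠ 0) :
    IsSolution (-a) b d ((r + a) * (s + a)) q (fun z => p z - a / q z) := by
  obtain rfl : s = 1 - a - b - d - r := by linear_combination hrs
  refine ⟨h.meromorphicAt_fst, fun x h0 h1 => ?_, fun x h0 h1 => ?_, fun x h0 h1 => ?_⟩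
  · exact (h.meromorphicAt_snd x h0 h1).sub
      ((MeromorphicAt.const a x).div (h.meromorphicAt_fst x h0 h1))
  · filter_upwards [h.hasDerivAt_fst x h0 h1, hq0 x h0 h1,
      eventually_nhdsNE_ne h0 h1] with z hq hz hz'
    obtain ⟨hz0, hz1⟩ := hz'
    refine hq.congr_deriv ?_
    simp only [fieldQ]
    field_simp
    ring
  · filter_upwards [h.hasDerivAt_fst x h0 h1, h.hasDerivAt_snd x h0 h1, hq0 x h0 h1,
      eventually_nhdsNE_ne h0 h1] with z hq hp' hz hz'
    obtain ⟨hz0, hz1⟩ := hz'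
    refine (hp'.sub ((hasDerivAt_const z a).div hq hz)).congr_deriv ?_
    simp only [fieldQ, fieldP]
    field_simp
    ring

/-- The Bäcklund transformation attached to `κ₂`. -/
theorem IsSolution.sub_div_fst_sub_id (h : IsSolution a b d (r * s) q p)
    (hrs : r + s = 1 - a - b - d)
    (hq0 : ∀ x : ℂ, x ≠ 0 → x ≠ 1 → ∀ᶠ z in 𝓝[≠] x, q z - z ≠ 0) :
    IsSolution a (-b) d ((r + b) * (s + b)) q (fun z => p z - b / (q z - z)) := by
  obtain rfl : s = 1 - a - b - d - r := by linear_combination hrs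
  refine ⟨h.meromorphicAt_fst, fun x h0 h1 => ?_, fun x h0 h1 => ?_, fun x h0 h1 => ?_⟩
  · exact (h.meromorphicAt_snd x h0 h1).sub
      ((MeromorphicAt.const b x).div ((h.meromorphicAt_fst x h0 h1).sub (MeromorphicAt.id x)))
  · filter_upwards [h.hasDerivAt_fst x h0 h1, hq0 x h0 h1,
      eventually_nhdsNE_ne h0 h1] with z hq hz hz'
    obtain ⟨hz0, hz1⟩ := hz'
    refine hq.congr_deriv ?_
    simp only [fieldQ]
    field_simp
    ring
  · filter_upwards [h.hasDerivAt_fst x h0 h1, h.hasDerivAt_snd x h0 h1, hq0 x h0 h1,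
      eventually_nhdsNE_ne h0 h1] with z hq hp' hz hz'
    obtain ⟨hz0, hz1⟩ := hz'
    refine (hp'.sub ((hasDerivAt_const z b).div (hq.sub (hasDerivAt_id z)) hz)).congr_deriv ?_
    simp only [fieldQ, fieldP, Pi.sub_apply, id]
    field_simp
    ring

theorem tendsto_nhdsNE_of_injective {f : ℂ → ℂ} (hf : Function.Injective f) {x : ℂ}
    (hc : ContinuousAt f x) : Tendsto f (𝓝[≠] x) (𝓝[≠] (f x)) :=
  tendsto_nhdsWithin_of_tendsto_nhds_of_eventually_within _
    (hc.tendsto.mono_left nhdsWithin_le_nhds)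
    (eventually_nhdsWithin_of_forall fun _ hz => fun h => hz (hf h))

theorem tendsto_one_sub_nhdsNE (x : ℂ) :
    Tendsto (fun z : ℂ => 1 - z) (𝓝[≠] x) (𝓝[≠] (1 - x)) :=
  tendsto_nhdsNE_of_injective (f := fun z : ℂ => 1 - z) (sub_right_injective) (by fun_prop)

theorem tendsto_inv_nhdsNE {x : ℂ} (hx : x ≠ 0) :
    Tendsto (fun z : ℂ => z⁻¹) (𝓝[≠] x) (𝓝[≠] x⁻¹) :=
  tendsto_nhdsNE_of_injective (f := fun z : ℂ => z⁻¹) inv_injective (continuousAt_inv₀ hx)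

/-- The symmetry exchanging the singular points `0` and `1`. -/
theorem IsSolution.reflect (h : IsSolution a b d e q p) :
    IsSolution d b a e (fun z => 1 - q (1 - z)) (fun z => -p (1 - z)) := by
  have hd : ∀ z : ℂ, HasDerivAt (fun z : ℂ => 1 - z) (-1) z := fun z =>
    (hasDerivAt_id z).const_sub 1
  have h10 : ∀ x : ℂ, x ≠ 1 → 1 - x ≠ 0 := fun x hx => sub_ne_zero.2 hx.symm
  have h11 : ∀ x : ℂ, x ≠ 0 → 1 - x ≠ 1 := fun x hx h => hx (by linear_combination -h)
  refine ⟨fun x h0 h1 => ?_, fun x h0 h1 => ?_, fun x h0 h1 => ?_, fun x h0 h1 => ?_⟩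
  · have := (h.meromorphicAt_fst (1 - x) (h10 x h1) (h11 x h0)).comp_analyticAt
      (g := fun z => 1 - z) (by fun_prop)
    exact (MeromorphicAt.const 1 x).sub this
  · have := (h.meromorphicAt_snd (1 - x) (h10 x h1) (h11 x h0)).comp_analyticAt
      (g := fun z => 1 - z) (by fun_prop)
    exact this.neg
  · filter_upwards [(tendsto_one_sub_nhdsNE x).eventually (h.hasDerivAt_fst _ (h10 x h1) (h11 x h0)),
      eventually_nhdsNE_ne h0 h1] with z hq hz'
    obtain ⟨hz0, hz1⟩ := hz'
    have hz2 : 1 - z ≠ 0 := fun h => hz1 (by linear_combination -h)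
    refine ((HasDerivAt.comp z hq (hd z)).const_sub 1).congr_deriv ?_
    simp only [fieldQ]
    rw [show 1 - z - 1 = -z by ring, show z - 1 = -(1 - z) by ring]
    field_simp
    ring
  · filter_upwards [(tendsto_one_sub_nhdsNE x).eventually (h.hasDerivAt_snd _ (h10 x h1) (h11 x h0)),
      eventually_nhdsNE_ne h0 h1] with z hp hz'
    obtain ⟨hz0, hz1⟩ := hz'
    have hz2 : 1 - z ≠ 0 := fun h => hz1 (by linear_combination -h)
    refine ((HasDerivAt.comp z hp (hd z)).neg).congr_deriv ?_
    simp only [fieldP]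
    rw [show 1 - z - 1 = -z by ring, show z - 1 = -(1 - z) by ring]
    field_simp
    ring

/-- The symmetry exchanging the singular points `0` and `∞`. -/
theorem IsSolution.invert (h : IsSolution a b d (r * s) q p) (hrs : r + s = 1 - a - b - d) :
    IsSolution a d b (r * s) (fun z => z * q z⁻¹) (fun z => p z⁻¹ / z) := by
  obtain rfl : s = 1 - a - b - d - r := by linear_combination hrs
  have h11 : ∀ x : ℂ, x ≠ 1 → x⁻¹ ≠ 1 := fun x hx => by simpa using hx
  refine ⟨fun x h0 h1 => ?_, fun x h0 h1 => ?_, fun x h0 h1 => ?_, fun x h0 h1 => ?_⟩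
  · have := (h.meromorphicAt_fst x⁻¹ (inv_ne_zero h0) (h11 x h1)).comp_analyticAt
      (g := fun z => z⁻¹) (analyticAt_inv h0)
    exact (MeromorphicAt.id x).mul this
  · have := (h.meromorphicAt_snd x⁻¹ (inv_ne_zero h0) (h11 x h1)).comp_analyticAt
      (g := fun z => z⁻¹) (analyticAt_inv h0)
    exact this.div (MeromorphicAt.id x)
  · filter_upwards [(tendsto_inv_nhdsNE h0).eventually
      (h.hasDerivAt_fst _ (inv_ne_zero h0) (h11 x h1)), eventually_nhdsNE_ne h0 h1] with z hq hz'
    obtain ⟨hz0, hz1⟩ := hz'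
    have hz2 : 1 - z ≠ 0 := fun h => hz1 (by linear_combination -h)
    refine ((hasDerivAt_id z).mul (HasDerivAt.comp z hq (hasDerivAt_inv hz0))).congr_deriv ?_
    simp only [fieldQ, Function.comp, id]
    rw [show z⁻¹ - 1 = (1 - z) / z by field_simp, show z - 1 = -(1 - z) by ring]
    field_simp
    ring
  · filter_upwards [(tendsto_inv_nhdsNE h0).eventually
      (h.hasDerivAt_snd _ (inv_ne_zero h0) (h11 x h1)), eventually_nhdsNE_ne h0 h1] with z hp hz'
    obtain ⟨hz0, hz1⟩ := hz'
    have hz2 : 1 - z ≠ 0 := fun h => hz1 (by linear_combination -h)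
    refine ((HasDerivAt.comp z hp (hasDerivAt_inv hz0)).div (hasDerivAt_id z) hz0).congr_deriv ?_
    simp only [fieldP, Function.comp, id]
    rw [show z⁻¹ - 1 = (1 - z) / z by field_simp, show z - 1 = -(1 - z) by ring]
    field_simp
    ring

end Symmetry

section Second

variable {a b d e r s : ℂ} {q p : ℂ → ℂ}

theorem isConnected_ne_zero_ne_one : IsConnected {x : ℂ | x ≠ 0 ∧ x ≠ 1} := by
  have h := Set.Countable.isConnected_compl_of_one_lt_rank (E := ℂ)
    (by simp) (Set.toFinite {(0 : ℂ), 1}).countable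
  convert h using 1
  ext x
  simp

/-- The identity theorem on the plane punctured at `0` and `1`. -/
theorem eventually_eq_zero_or_ne_zero {f : ℂ → ℂ}
    (hf : ∀ x : ℂ, x ≠ 0 → x ≠ 1 → MeromorphicAt f x) :
    (∀ x : ℂ, x ≠ 0 → x ≠ 1 → ∀ᶠ z in 𝓝[≠] x, f z = 0) ∨
      (∀ x : ℂ, x ≠ 0 → x ≠ 1 → ∀ᶠ z in 𝓝[≠] x, f z ≠ 0) := by
  have hm : MeromorphicOn f {x : ℂ | x ≠ 0 ∧ x ≠ 1} := fun x hx => hf x hx.1 hx.2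
  have h := hm.exists_meromorphicOrderAt_ne_top_iff_forall isConnected_ne_zero_ne_one
  by_cases hex : ∃ u : {x : ℂ | x ≠ 0 ∧ x ≠ 1}, meromorphicOrderAt f u ≠ ⊤
  · right
    intro x h0 h1
    exact (meromorphicOrderAt_ne_top_iff_eventually_ne_zero (hf x h0 h1)).1
      (h.1 hex ⟨x, h0, h1⟩)
  · left
    push Not at hex
    intro x h0 h1
    exact meromorphicOrderAt_eq_top_iff.1 (hex ⟨x, h0, h1⟩)

theorem eventually_nhdsNE_const_zero {f : ℂ → ℂ}
    (hf : ∀ x : ℂ, x ≠ 0 → x ≠ 1 → ∀ᶠ z in 𝓝[≠] x, f z = 0) : EventuallyMeromorphicAt f 0 := by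
  refine (EventuallyMeromorphicAt.of_meromorphicAt (MeromorphicAt.const 0 0)).congr ?_
  filter_upwards [eventually_nhdsNE_zero_ne_one] with x hx
  filter_upwards [hf x hx.1 hx.2] with z hz using hz.symm

theorem IsSolution.eventuallyMeromorphicAt_snd_zero_of_ne_zero (h : IsSolution a b d (r * s) q p)
    (hrs : r + s = 1 - a - b - d) (hr : r ≠ 0) : EventuallyMeromorphicAt p 0 := by
  rcases eventually_eq_zero_or_ne_zero h.meromorphicAt_snd with hp | hp
  · exact eventually_nhdsNE_const_zero hp
  · have h1 := (h.add_div hrs hp).eventuallyMeromorphicAt_fst_zero.sub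
      h.eventuallyMeromorphicAt_fst_zero
    refine ((EventuallyMeromorphicAt.of_meromorphicAt (MeromorphicAt.const r 0)).div h1).congr ?_
    filter_upwards [eventually_nhdsNE_zero_ne_one] with x hx
    filter_upwards [hp x hx.1 hx.2] with z hz
    simp only [Pi.div_apply, Pi.sub_apply]
    field_simp
    ring_nf
    field_simp

/-- If `q - c` vanishes near a point, where `c` is `0`, `1` or `z`, then the derivative of `q`
agrees with that of `c` near that point. -/
theorem IsSolution.exists_eq_of_not_eventually_ne (h : IsSolution a b d e q p) {c : ℂ → ℂ} {c' : ℂ}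
    (hc : ∀ z, HasDerivAt c c' z) {x : ℂ} (h0 : x ≠ 0) (h1 : x ≠ 1)
    (hq : ¬ ∀ᶠ z in 𝓝[≠] x, q z - c z ≠ 0) :
    ∃ z, z ≠ 0 ∧ z - 1 ≠ 0 ∧ q z = c z ∧ fieldQ a b d z (c z) (p z) / (z * (z - 1)) = c' := by
  have hcan : MeromorphicAt c x := by
    have hd : Differentiable ℂ c := fun z => (hc z).differentiableAt
    exact (hd.analyticAt x).meromorphicAt
  have h2 : ∀ᶠ z in 𝓝[≠] x, q z - c z = 0 :=
    (((h.meromorphicAt_fst x h0 h1).sub hcan).eventually_eq_zero_or_eventually_ne_zero).resolve_right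
      hq
  have h3 : ∀ᶠ z in 𝓝[≠] x, ∀ᶠ w in 𝓝 z, q w - c w = 0 := by
    rwa [eventually_nhdsNE_eventually_nhds_iff]
  obtain ⟨z, hz, hz', hzq, hne⟩ :=
    (((eventually_nhdsNE_ne h0 h1).and (h3.and (h2.and (h.hasDerivAt_fst x h0 h1))))).exists
  have hqz := sub_eq_zero.1 hzq
  refine ⟨z, hz.1, hz.2, hqz, ?_⟩
  rw [← hqz]
  refine hne.unique ((hc z).congr_of_eventuallyEq ?_)
  filter_upwards [hz'] with w hw using sub_eq_zero.1 hw

theorem IsSolution.eventuallyMeromorphicAt_snd_zero_of_fst_ne_zero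
    (h : IsSolution a b d (r * s) q p) (hrs : r + s = 1 - a - b - d) (hr : r = 0) (ha : a ≠ 0) :
    EventuallyMeromorphicAt p 0 := by
  have hq : ∀ x : ℂ, x ≠ 0 → x ≠ 1 → ∀ᶠ z in 𝓝[≠] x, q z ≠ 0 := by
    intro x h0 h1
    by_contra hn
    obtain ⟨z, hz, hz1, -, hf⟩ := h.exists_eq_of_not_eventually_ne (c := fun _ => 0)
      (fun z => hasDerivAt_const z 0) h0 h1 (by simpa using hn)
    rw [div_eq_zero_iff] at hf
    have := hf.resolve_right (mul_ne_zero hz hz1)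
    simp only [fieldQ] at this
    exact mul_ne_zero ha hz (by linear_combination -this)
  have h1 := (h.sub_div_fst hrs hq).eventuallyMeromorphicAt_snd_zero_of_ne_zero
    (by linear_combination hrs) (by rwa [hr, zero_add])
  refine (h1.add ((EventuallyMeromorphicAt.of_meromorphicAt (MeromorphicAt.const a 0)).div
    h.eventuallyMeromorphicAt_fst_zero)).congr ?_
  exact Eventually.of_forall fun x => Eventually.of_forall fun z => by simp

theorem IsSolution.eventuallyMeromorphicAt_snd_zero_of_snd_ne_zero
    (h : IsSolution a b d (r * s) q p) (hrs : r + s = 1 - a - b - d) (hr : r = 0) (hb : b ≠ 0) :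
    EventuallyMeromorphicAt p 0 := by
  have hq : ∀ x : ℂ, x ≠ 0 → x ≠ 1 → ∀ᶠ z in 𝓝[≠] x, q z - z ≠ 0 := by
    intro x h0 h1
    by_contra hn
    obtain ⟨z, hz, hz1, -, hf⟩ := h.exists_eq_of_not_eventually_ne (c := fun z => z)
      (fun z => hasDerivAt_id z) h0 h1 hn
    rw [div_eq_iff (mul_ne_zero hz hz1)] at hf
    simp only [fieldQ] at hf
    exact mul_ne_zero hb (mul_ne_zero hz hz1) (by linear_combination -hf)
  have h1 := (h.sub_div_fst_sub_id hrs hq).eventuallyMeromorphicAt_snd_zero_of_ne_zero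
    (by linear_combination hrs) (by rwa [hr, zero_add])
  refine (h1.add ((EventuallyMeromorphicAt.of_meromorphicAt (MeromorphicAt.const b 0)).div
    (h.eventuallyMeromorphicAt_fst_zero.sub (.of_meromorphicAt (MeromorphicAt.id 0))))).congr ?_
  exact Eventually.of_forall fun x => Eventually.of_forall fun z => by simp

theorem IsSolution.eventuallyMeromorphicAt_snd_zero_of_thd_ne_zero
    (h : IsSolution a b d (r * s) q p) (hrs : r + s = 1 - a - b - d) (hr : r = 0) (hd : d ≠ 0) :
    EventuallyMeromorphicAt p 0 := by
  have hq : ∀ x : ℂ, x ≠ 0 → x ≠ 1 → ∀ᶠ z in 𝓝[≠] x, 1 - q (1 - z) ≠ 0 := by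
    intro x h0 h1
    by_contra hn
    obtain ⟨z, hz, hz1, -, hf⟩ := h.reflect.exists_eq_of_not_eventually_ne (c := fun _ => 0)
      (fun z => hasDerivAt_const z 0) h0 h1 (by simpa using hn)
    rw [div_eq_zero_iff] at hf
    have := hf.resolve_right (mul_ne_zero hz hz1)
    simp only [fieldQ] at this
    exact mul_ne_zero hd hz (by linear_combination -this)
  have h1 := (h.reflect.sub_div_fst (by linear_combination hrs) hq).reflect
  have h2 := h1.eventuallyMeromorphicAt_snd_zero_of_ne_zero
    (by linear_combination hrs) (by rwa [hr, zero_add])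
  refine (h2.add ((EventuallyMeromorphicAt.of_meromorphicAt (MeromorphicAt.const d 0)).div
    (h.eventuallyMeromorphicAt_fst_zero.sub (.of_meromorphicAt (MeromorphicAt.const 1 0))))).congr ?_
  refine Eventually.of_forall fun x => Eventually.of_forall fun z => ?_
  simp only [Pi.add_apply, Pi.div_apply, Pi.sub_apply, sub_sub_cancel]
  rw [show q z - 1 = -(1 - q z) by ring, div_neg]
  ring

theorem IsSolution.eventuallyMeromorphicAt_snd_zero (h : IsSolution a b d (r * s) q p)
    (hrs : r + s = 1 - a - b - d) : EventuallyMeromorphicAt p 0 := by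
  by_cases hr : r = 0
  · by_cases ha : a = 0
    · by_cases hb : b = 0
      · by_cases hd : d = 0
        · exact IsSolution.eventuallyMeromorphicAt_snd_zero_of_ne_zero (r := s) (s := r)
            (by rwa [mul_comm]) (by linear_combination hrs)
            (by rw [hr, ha, hb, hd] at hrs; simp at hrs; simp [hrs])
        · exact h.eventuallyMeromorphicAt_snd_zero_of_thd_ne_zero hrs hr hd
      · exact h.eventuallyMeromorphicAt_snd_zero_of_snd_ne_zero hrs hr hb
    · exact h.eventuallyMeromorphicAt_snd_zero_of_fst_ne_zero hrs hr ha
  · exact h.eventuallyMeromorphicAt_snd_zero_of_ne_zero hrs hr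

end Second

/-- An entire function of polynomial growth is a polynomial. -/
theorem exists_polynomial_of_norm_le (n : ℕ) : ∀ {G : ℂ → ℂ} {C : ℝ}, Differentiable ℂ G →
    (∀ z, ‖G z‖ ≤ C * (1 + ‖z‖) ^ n) → ∃ A : Polynomial ℂ, ∀ z, G z = A.eval z := by
  induction n with
  | zero =>
    intro G C hG hb
    obtain ⟨c, hc⟩ := hG.exists_const_forall_eq_of_bounded
      (isBounded_iff_forall_norm_le.2 ⟨C, by rintro _ ⟨z, rfl⟩; simpa using hb z⟩)
    exact ⟨Polynomial.C c, fun z => by simp [hc z]⟩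
  | succ n ih =>
    intro G C hG hb
    have hH : Differentiable ℂ (dslope G 0) := by
      rw [← differentiableOn_univ] at hG ⊢
      exact (Complex.differentiableOn_dslope univ_mem).2 hG
    have hGH : ∀ z, G z = G 0 + z * dslope G 0 z := fun z => by
      have := sub_smul_dslope G 0 z
      simp only [sub_zero, smul_eq_mul] at this
      rw [this]; ring
    obtain ⟨K, hK⟩ := (isCompact_closedBall (0 : ℂ) 1).exists_bound_of_continuousOn
      hH.continuous.continuousOn
    have hC0 : 0 ≤ C := by simpa using (norm_nonneg _).trans (hb 0)
    have hK0 : 0 ≤ K := (norm_nonneg _).trans (hK 0 (by simp))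
    obtain ⟨A, hA⟩ := ih (C := K + 2 * (C + ‖G 0‖)) hH (fun z => by
      have h1 : (1 : ℝ) ≤ (1 + ‖z‖) ^ n := one_le_pow₀ (by linarith [norm_nonneg z])
      rcases le_or_gt ‖z‖ 1 with hz | hz
      · have := hK z (by simpa using hz)
        nlinarith [norm_nonneg (G 0), mul_nonneg hC0 (sub_nonneg.2 h1),
          mul_nonneg hK0 (sub_nonneg.2 h1), mul_nonneg (norm_nonneg (G 0)) (sub_nonneg.2 h1)]
      · have h2 : ‖z‖ * ‖dslope G 0 z‖ ≤ C * (1 + ‖z‖) ^ (n + 1) + ‖G 0‖ := by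
          rw [← norm_mul, show z * dslope G 0 z = G z - G 0 by rw [hGH z]; ring]
          exact (norm_sub_le _ _).trans (add_le_add (hb z) le_rfl)
        set y := (1 + ‖z‖) ^ n
        have h3 : ‖z‖ * ‖dslope G 0 z‖ ≤ ‖z‖ * (2 * (C + ‖G 0‖) * y) := by
          refine h2.trans ?_
          have h4 : (1 + ‖z‖) ^ (n + 1) = y * (1 + ‖z‖) := pow_succ _ _
          have h5 : C * (y * (1 + ‖z‖)) ≤ C * (y * (2 * ‖z‖)) := by gcongr; linarith
          have h6 : ‖G 0‖ * 1 ≤ ‖G 0‖ * (2 * ‖z‖ * y) := by gcongr; nlinarith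
          rw [h4]
          linarith
        have h7 := le_of_mul_le_mul_left h3 (by linarith)
        nlinarith [mul_nonneg hK0 (zero_le_one.trans h1)])
    exact ⟨Polynomial.C (G 0) + Polynomial.X * A, fun z => by simp [hGH z, hA z]⟩

/-- An entire function that is meromorphic at infinity is a polynomial. -/
theorem exists_polynomial_of_meromorphicAt_inv {G : ℂ → ℂ} (hG : Differentiable ℂ G)
    (hinf : MeromorphicAt (fun z => G z⁻¹) 0) : ∃ A : Polynomial ℂ, ∀ z, G z = A.eval z := by
  obtain ⟨n, hn⟩ := hinf
  obtain ⟨ε, hε, hball⟩ := Metric.eventually_nhds_iff.1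
    (hn.continuousAt.norm.eventually_lt_const (lt_add_one _))
  set C := ‖(0 - 0 : ℂ) ^ n • G 0⁻¹‖ + 1
  have hC : 0 ≤ C := by positivity
  obtain ⟨K, hK⟩ := (isCompact_closedBall (0 : ℂ) (2 / ε)).exists_bound_of_continuousOn
    hG.continuous.continuousOn
  have hK0 : 0 ≤ K := (norm_nonneg _).trans (hK 0 (by simp; positivity))
  refine exists_polynomial_of_norm_le n (C := K + C) hG fun z => ?_
  have h1 : (1 : ℝ) ≤ (1 + ‖z‖) ^ n := one_le_pow₀ (by linarith [norm_nonneg z])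
  rcases le_or_gt ‖z‖ (2 / ε) with hz | hz
  · have := hK z (by simpa using hz)
    nlinarith
  · have hzpos : 0 < ‖z‖ := lt_trans (by positivity) hz
    have hz0 : z ≠ 0 := norm_pos_iff.1 hzpos
    have h2 := hball (y := z⁻¹) (by
      rw [dist_zero_right, norm_inv, inv_lt_comm₀ hzpos hε, inv_eq_one_div]
      exact lt_of_le_of_lt (by gcongr; norm_num) hz)
    simp only [sub_zero, inv_inv, smul_eq_mul, norm_mul, norm_pow, norm_inv] at h2
    rw [inv_pow, inv_mul_lt_iff₀ (by positivity)] at h2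
    have h3 : ‖z‖ ^ n ≤ (1 + ‖z‖) ^ n := by gcongr; linarith
    nlinarith

theorem EventuallyMeromorphicAt.meromorphicAt_of_meromorphicNFAt {f : ℂ → ℂ} {c : ℂ}
    (h : EventuallyMeromorphicAt f c) (hf : ∀ᶠ x in 𝓝[≠] c, MeromorphicNFAt f x) :
    MeromorphicAt f c := by
  obtain ⟨g, hg, hfg⟩ := h
  refine hg.congr ?_
  filter_upwards [hfg, hf, hg.eventually_analyticAt] with x h1 h2 h3
  exact ((h2.eventuallyEq_nhdsNE_iff_eventuallyEq_nhds h3.meromorphicNFAt).1 h1).eq_of_nhds.symm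

theorem EventuallyMeromorphicAt.comp_analyticAt {f φ : ℂ → ℂ} {c : ℂ}
    (h : EventuallyMeromorphicAt f (φ c)) (hφ : AnalyticAt ℂ φ c)
    (ht : ∀ᶠ x in 𝓝 c, Tendsto φ (𝓝[≠] x) (𝓝[≠] (φ x))) :
    EventuallyMeromorphicAt (f ∘ φ) c := by
  obtain ⟨g, hg, hfg⟩ := h
  refine ⟨g ∘ φ, hg.comp_analyticAt hφ, ?_⟩
  filter_upwards [ht.self_of_nhds.eventually hfg, ht.filter_mono nhdsWithin_le_nhds] with x h1 h2
  exact h2.eventually h1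

theorem analyticAt_eval (B : Polynomial ℂ) (x : ℂ) : AnalyticAt ℂ (fun z => B.eval z) x :=
  B.differentiable.analyticAt x

/-- The poles of a function meromorphic near a compact set are cleared by a polynomial. -/
theorem exists_polynomial_meromorphicOrderAt_nonneg {F : ℂ → ℂ} (hF : ∀ x, MeromorphicAt F x)
    {K : Set ℂ} (hK : IsCompact K) : ∃ B : Polynomial ℂ, B ≠ 0 ∧
      ∀ x ∈ K, 0 ≤ meromorphicOrderAt ((fun z => B.eval z) * F) x := by
  have key : ∀ (B₁ B₂ : Polynomial ℂ) (x : ℂ),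
      0 ≤ meromorphicOrderAt ((fun z => B₁.eval z) * F) x →
      0 ≤ meromorphicOrderAt ((fun z => (B₂ * B₁).eval z) * F) x := by
    intro B₁ B₂ x h
    have : (fun z => (B₂ * B₁).eval z) * F =
        (fun z => B₂.eval z) * ((fun z => B₁.eval z) * F) := by
      ext z; simp [mul_assoc]
    rw [this, meromorphicOrderAt_mul (analyticAt_eval B₂ x).meromorphicAt
      ((analyticAt_eval B₁ x).meromorphicAt.mul (hF x))]
    exact add_nonneg (analyticAt_eval B₂ x).meromorphicOrderAt_nonneg h
  refine hK.induction_on ⟨1, one_ne_zero, by simp⟩ ?_ ?_ ?_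
  · rintro s t hst ⟨B, hB, h⟩
    exact ⟨B, hB, fun x hx => h x (hst hx)⟩
  · rintro s t ⟨B, hB, h⟩ ⟨B', hB', h'⟩
    refine ⟨B * B', mul_ne_zero hB hB', ?_⟩
    rintro x (hx | hx)
    · rw [mul_comm B]; exact key B B' x (h x hx)
    · exact key B' B x (h' x hx)
  · intro x _
    obtain ⟨n, hn⟩ := hF x
    refine ⟨_, nhdsWithin_le_nhds hn.eventually_analyticAt,
      (Polynomial.X - Polynomial.C x) ^ n, pow_ne_zero _ (Polynomial.X_sub_C_ne_zero x), ?_⟩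
    intro y hy
    have h := AnalyticAt.meromorphicOrderAt_nonneg hy
    convert h using 2
    ext z
    simp

/-- A function meromorphic on the Riemann sphere is rational. -/
theorem exists_eq_div_of_meromorphicAt {F : ℂ → ℂ} (hF : ∀ x, MeromorphicAt F x)
    (hinf : MeromorphicAt (fun z => F z⁻¹) 0) : ∃ A B : Polynomial ℂ, B ≠ 0 ∧
      ∀ x, ∀ᶠ z in 𝓝[≠] x, F z * B.eval z = A.eval z := by
  have hout : ∀ᶠ z in Bornology.cobounded ℂ, AnalyticAt ℂ F z := by
    filter_upwards [tendsto_inv₀_cobounded'.eventually hinf.eventually_analyticAt,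
      Bornology.eventually_ne_cobounded (0 : ℂ)] with z hz hz0
    have : AnalyticAt ℂ ((fun z => F z⁻¹) ∘ fun z => z⁻¹) z :=
      AnalyticAt.comp hz (analyticAt_inv hz0)
    simpa [Function.comp_def] using this
  obtain ⟨R, -, hR⟩ := (Metric.hasBasis_cobounded_compl_closedBall (0 : ℂ)).eventually_iff.1 hout
  obtain ⟨B, hB, hBF⟩ := exists_polynomial_meromorphicOrderAt_nonneg hF
    (isCompact_closedBall (0 : ℂ) R)
  set H : ℂ → ℂ := (fun z => B.eval z) * F
  have hH : MeromorphicOn H Set.univ := fun x _ => (analyticAt_eval B x).meromorphicAt.mul (hF x)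
  have hHord : ∀ x, 0 ≤ meromorphicOrderAt H x := fun x => by
    by_cases hx : x ∈ Metric.closedBall (0 : ℂ) R
    · exact hBF x hx
    · exact ((analyticAt_eval B x).mul (hR hx)).meromorphicOrderAt_nonneg
  set G := toMeromorphicNFOn H Set.univ
  have hGH : ∀ x, G =ᶠ[𝓝[≠] x] H :=
    fun x => hH.toMeromorphicNFOn_eq_self_on_nhdsNE (Set.mem_univ x)
  have hGan : ∀ x, AnalyticAt ℂ G x := fun x => by
    have hNF : MeromorphicNFAt G x := meromorphicNFOn_toMeromorphicNFOn H _ (Set.mem_univ x)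
    rw [← hNF.meromorphicOrderAt_nonneg_iff_analyticAt, meromorphicOrderAt_congr (hGH x)]
    exact hHord x
  have hBinv : MeromorphicAt (fun z : ℂ => B.eval z⁻¹) 0 := by
    simp only [Polynomial.eval_eq_sum_range]
    exact MeromorphicAt.fun_sum fun i _ =>
      (MeromorphicAt.const (B.coeff i) 0).mul ((MeromorphicAt.id (0 : ℂ)).inv.pow i)
  have hGinf : MeromorphicAt (fun z => G z⁻¹) 0 := by
    refine EventuallyMeromorphicAt.meromorphicAt_of_meromorphicNFAt
      ((EventuallyMeromorphicAt.of_meromorphicAt (hBinv.mul hinf)).congr ?_) ?_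
    · filter_upwards [self_mem_nhdsWithin] with x hx
      exact ((tendsto_inv_nhdsNE hx).eventually (hGH x⁻¹)).mono fun z hz => by
        exact hz.symm
    · filter_upwards [self_mem_nhdsWithin] with x hx
      exact (AnalyticAt.comp (hGan x⁻¹) (analyticAt_inv hx)).meromorphicNFAt
  obtain ⟨A, hA⟩ := exists_polynomial_of_meromorphicAt_inv
    (fun x => (hGan x).differentiableAt) hGinf
  refine ⟨A, B, hB, fun x => ?_⟩
  filter_upwards [hGH x] with z hz
  rw [← hA, hz, mul_comm]
  rfl

/-- A function meromorphic outside `0` and `1` that is meromorphic at `0`, `1` and infinity up to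
a discrete set is rational. -/
theorem exists_eq_div_of_eventuallyMeromorphicAt {f : ℂ → ℂ}
    (hf : ∀ x : ℂ, x ≠ 0 → x ≠ 1 → MeromorphicAt f x) (h0 : EventuallyMeromorphicAt f 0)
    (h1 : EventuallyMeromorphicAt (fun z => f (1 - z)) 0)
    (hinf : EventuallyMeromorphicAt (fun z => f z⁻¹) 0) : ∃ A B : Polynomial ℂ, B ≠ 0 ∧
      ∀ x : ℂ, x ≠ 0 → x ≠ 1 → ∀ᶠ z in 𝓝[≠] x, f z * B.eval z = A.eval z := by
  set U : Set ℂ := {x | x ≠ 0 ∧ x ≠ 1}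
  have hm : MeromorphicOn f U := fun x hx => hf x hx.1 hx.2
  set F := toMeromorphicNFOn f U
  have hNF : ∀ x ∈ U, MeromorphicNFAt F x := fun x hx => meromorphicNFOn_toMeromorphicNFOn f U hx
  have hFf : ∀ x ∈ U, F =ᶠ[𝓝[≠] x] f := fun x hx => hm.toMeromorphicNFOn_eq_self_on_nhdsNE hx
  have hU0 : ∀ᶠ x in 𝓝[≠] (0 : ℂ), x ∈ U := eventually_nhdsNE_zero_ne_one
  have hU1 : ∀ᶠ x in 𝓝[≠] (1 : ℂ), x ∈ U := by
    filter_upwards [self_mem_nhdsWithin,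
      (eventually_ne_nhds (one_ne_zero' ℂ)).filter_mono nhdsWithin_le_nhds] with x h1 h2
    exact ⟨h2, h1⟩
  have hF0 : MeromorphicAt F 0 := by
    refine (h0.congr ?_).meromorphicAt_of_meromorphicNFAt (hU0.mono hNF)
    filter_upwards [hU0] with x hx using (hFf x hx).symm
  have hf1 : EventuallyMeromorphicAt f 1 := by
    have := EventuallyMeromorphicAt.comp_analyticAt (φ := fun z : ℂ => 1 - z) (c := 1)
      (by simpa using h1) (by fun_prop) (Eventually.of_forall tendsto_one_sub_nhdsNE)
    simpa [Function.comp_def] using this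
  have hF1 : MeromorphicAt F 1 := by
    refine (hf1.congr ?_).meromorphicAt_of_meromorphicNFAt (hU1.mono hNF)
    filter_upwards [hU1] with x hx using (hFf x hx).symm
  have hF : ∀ x, MeromorphicAt F x := fun x => by
    by_cases hx0 : x = 0
    · rwa [hx0]
    by_cases hx1 : x = 1
    · rwa [hx1]
    exact (hNF x ⟨hx0, hx1⟩).meromorphicAt
  have hUinv : ∀ᶠ x in 𝓝[≠] (0 : ℂ), x ≠ 0 ∧ x⁻¹ ∈ U := by
    filter_upwards [hU0] with x hx
    exact ⟨hx.1, inv_ne_zero hx.1, by simpa using hx.2⟩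
  have hFinf : MeromorphicAt (fun z => F z⁻¹) 0 := by
    refine (hinf.congr ?_).meromorphicAt_of_meromorphicNFAt ?_
    · filter_upwards [hUinv] with x hx
      exact ((tendsto_inv_nhdsNE hx.1).eventually (hFf x⁻¹ hx.2)).mono fun z hz => hz.symm
    · filter_upwards [hUinv] with x hx
      exact MeromorphicNFAt.comp_analyticAt (hNF x⁻¹ hx.2) (analyticAt_inv hx.1)
  obtain ⟨A, B, hB, hAB⟩ := exists_eq_div_of_meromorphicAt hF hFinf
  refine ⟨A, B, hB, fun x hx0 hx1 => ?_⟩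
  filter_upwards [hAB x, hFf x ⟨hx0, hx1⟩] with z hz1 hz2
  rw [← hz2, hz1]

theorem eq_div_of_eventually_mul_eq {f : ℂ → ℂ} {A B : Polynomial ℂ} {x : ℂ}
    (h : ∀ᶠ z in 𝓝[≠] x, f z * B.eval z = A.eval z) (hf : AnalyticAt ℂ f x) (hB : B.eval x ≠ 0) :
    f x = A.eval x / B.eval x := by
  rw [eq_div_iff hB]
  have h1 : ContinuousAt (fun z => f z * B.eval z) x := hf.continuousAt.mul B.continuousAt
  exact ((h1.eventuallyEq_nhds_iff_eventuallyEq_nhdsNE A.continuousAt).1 h).eq_of_nhds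

section Rational

variable {a b d r s : ℂ} {q p : ℂ → ℂ}

theorem eventuallyMeromorphicAt_congr_nhdsNE_zero {f g : ℂ → ℂ} (hf : EventuallyMeromorphicAt f 0)
    (h : ∀ z, z ≠ 0 → f z = g z) : EventuallyMeromorphicAt g 0 := by
  refine hf.congr ?_
  filter_upwards [self_mem_nhdsWithin] with x hx
  filter_upwards [(eventually_ne_nhds hx).filter_mono nhdsWithin_le_nhds] with z hz using h z hz

theorem IsSolution.exists_fst_eq_div (h : IsSolution a b d (r * s) q p)
    (hrs : r + s = 1 - a - b - d) : ∃ A B : Polynomial ℂ, B ≠ 0 ∧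
      ∀ x : ℂ, x ≠ 0 → x ≠ 1 → ∀ᶠ z in 𝓝[≠] x, q z * B.eval z = A.eval z := by
  refine exists_eq_div_of_eventuallyMeromorphicAt h.meromorphicAt_fst
    h.eventuallyMeromorphicAt_fst_zero ?_ ?_
  · exact eventuallyMeromorphicAt_congr_nhdsNE_zero
      ((EventuallyMeromorphicAt.of_meromorphicAt (MeromorphicAt.const 1 0)).sub
        h.reflect.eventuallyMeromorphicAt_fst_zero) fun z _ => by simp
  · exact eventuallyMeromorphicAt_congr_nhdsNE_zero
      ((h.invert hrs).eventuallyMeromorphicAt_fst_zero.div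
        (EventuallyMeromorphicAt.of_meromorphicAt (MeromorphicAt.id 0))) fun z hz => by
          simp only [Pi.div_apply, id]
          field_simp

theorem IsSolution.exists_snd_eq_div (h : IsSolution a b d (r * s) q p)
    (hrs : r + s = 1 - a - b - d) : ∃ A B : Polynomial ℂ, B ≠ 0 ∧
      ∀ x : ℂ, x ≠ 0 → x ≠ 1 → ∀ᶠ z in 𝓝[≠] x, p z * B.eval z = A.eval z := by
  refine exists_eq_div_of_eventuallyMeromorphicAt h.meromorphicAt_snd
    (h.eventuallyMeromorphicAt_snd_zero hrs) ?_ ?_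
  · exact eventuallyMeromorphicAt_congr_nhdsNE_zero
      ((EventuallyMeromorphicAt.of_meromorphicAt (MeromorphicAt.const 0 0)).sub
        (h.reflect.eventuallyMeromorphicAt_snd_zero (by linear_combination hrs))) fun z _ => by simp
  · exact eventuallyMeromorphicAt_congr_nhdsNE_zero
      (((h.invert hrs).eventuallyMeromorphicAt_snd_zero (by linear_combination hrs)).mul
        (EventuallyMeromorphicAt.of_meromorphicAt (MeromorphicAt.id 0))) fun z hz => by
          simp only [Pi.mul_apply, id]
          field_simp

end Rational

theorem isSolution_of_solvesPVIAt {κ₀ κ₁ κ₂ κ₃ κ₄ : ℂ} {q p : ℂ → ℂ}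
    (hq : ∀ z : ℂ, z ≠ 0 → z ≠ 1 → MeromorphicAt q z)
    (hp : ∀ z : ℂ, z ≠ 0 → z ≠ 1 → MeromorphicAt p z)
    (hsol : ∀ z : ℂ, z ≠ 0 → z ≠ 1 → AnalyticAt ℂ q z → AnalyticAt ℂ p z →
      SolvesPVIAt κ₀ κ₁ κ₂ κ₃ κ₄ q p z) :
    IsSolution κ₁ κ₂ κ₃ (κ₀ * (κ₀ + κ₄)) q p := by
  refine ⟨hq, hp, fun x h0 h1 => ?_, fun x h0 h1 => ?_⟩
  · filter_upwards [(hq x h0 h1).eventually_analyticAt, (hp x h0 h1).eventually_analyticAt,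
      eventually_nhdsNE_ne h0 h1] with z hqz hpz hz
    refine hqz.differentiableAt.hasDerivAt.congr_deriv ?_
    rw [eq_div_iff (mul_ne_zero hz.1 hz.2), mul_comm,
      (hsol z hz.1 (sub_ne_zero.1 hz.2) hqz hpz).1, fieldQ]
  · filter_upwards [(hq x h0 h1).eventually_analyticAt, (hp x h0 h1).eventually_analyticAt,
      eventually_nhdsNE_ne h0 h1] with z hqz hpz hz
    refine hpz.differentiableAt.hasDerivAt.congr_deriv ?_
    rw [eq_div_iff (mul_ne_zero hz.1 hz.2), mul_comm,
      (hsol z hz.1 (sub_ne_zero.1 hz.2) hqz hpz).2, fieldP]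

end PainleveSix

/-- Any single-valued global solution of Painlevé VI (a pair `(q, p)` meromorphic on
`ℂ ∖ {0, 1}` solving `P_VI(κ)` there) is a rational solution. -/
theorem single_valued_global_solution_is_rational
    (κ₀ κ₁ κ₂ κ₃ κ₄ : ℂ) (hκ : 2 * κ₀ + κ₁ + κ₂ + κ₃ + κ₄ = 1)
    (q p : ℂ → ℂ)
    (hq : ∀ z : ℂ, z ≠ 0 → z ≠ 1 → MeromorphicAt q z)
    (hp : ∀ z : ℂ, z ≠ 0 → z ≠ 1 → MeromorphicAt p z)
    (hsol : ∀ z : ℂ, z ≠ 0 → z ≠ 1 → AnalyticAt ℂ q z → AnalyticAt ℂ p z →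
      SolvesPVIAt κ₀ κ₁ κ₂ κ₃ κ₄ q p z) :
    ∃ A B C D : Polynomial ℂ, B ≠ 0 ∧ D ≠ 0 ∧
      (∀ z : ℂ, z ≠ 0 → z ≠ 1 → AnalyticAt ℂ q z → Polynomial.eval z B ≠ 0 →
        q z = Polynomial.eval z A / Polynomial.eval z B) ∧
      (∀ z : ℂ, z ≠ 0 → z ≠ 1 → AnalyticAt ℂ p z → Polynomial.eval z D ≠ 0 →
        p z = Polynomial.eval z C / Polynomial.eval z D) := by
  have h := PainleveSix.isSolution_of_solvesPVIAt hq hp hsol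
  have hrs : κ₀ + (κ₀ + κ₄) = 1 - κ₁ - κ₂ - κ₃ := by linear_combination hκ
  obtain ⟨A, B, hB, hAB⟩ := h.exists_fst_eq_div hrs
  obtain ⟨C, D, hD, hCD⟩ := h.exists_snd_eq_div hrs
  exact ⟨A, B, C, D, hB, hD,
    fun z h0 h1 han hz => PainleveSix.eq_div_of_eventually_mul_eq (hAB z h0 h1) han hz,
    fun z h0 h1 han hz => PainleveSix.eq_div_of_eventually_mul_eq (hCD z h0 h1) han hz⟩
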